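/- arXiv:1011.1690 — 2 statements merged into one kernel-verified Lean document; each statement's English description precedes it below -/
import Mathlib

section
/- Local existence of pseudoholomorphic curves: Let J be an almost complex structure on ℂⁿ. For every point p ∈ ℂⁿ and every vector X ∈ ℂⁿ there exist ε > 0 and a smooth J-holomorphic map u : B_ε → ℂⁿ such that u(0) = p and ∂ₛu(0) = X. -/
open Metric Complex

noncomputable section

open scoped ContDiff Topology

section Superposition

universe u

variable {K : Type*} {X Y : Type u} [TopologicalSpace K] [CompactSpace K]
  [NormedAddCommGroup X] [NormedSpace ℝ X] [NormedAddCommGroup Y] [NormedSpace ℝ Y]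

/-- Pointwise application of a continuous field of operators to a continuous function. -/
def fieldApply : C(K, X →L[ℝ] Y) →L[ℝ] C(K, X) →L[ℝ] C(K, Y) :=
  LinearMap.mkContinuous₂
    (LinearMap.mk₂ ℝ
      (fun (A : C(K, X →L[ℝ] Y)) (u : C(K, X)) =>
        (⟨fun x => A x (u x), by fun_prop⟩ : C(K, Y)))
      (fun _ _ _ => by ext; simp) (fun _ _ _ => by ext; simp)
      (fun _ _ _ => by ext; simp) (fun _ _ _ => by ext; simp)) 1
    (fun A u => by
      refine (ContinuousMap.norm_le _ (by positivity)).2 fun x => ?_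
      rw [one_mul]
      exact ((A x).le_opNorm (u x)).trans (mul_le_mul (A.norm_coe_le_norm x)
        (u.norm_coe_le_norm x) (norm_nonneg (u x)) (norm_nonneg A)))

@[simp] theorem fieldApply_apply (A : C(K, X →L[ℝ] Y)) (u : C(K, X)) (x : K) :
    fieldApply A u x = A x (u x) := rfl

/-- The superposition operator `u ↦ f ∘ u` on continuous functions. -/
def superpose (f : X → Y) (hf : Continuous f) (u : C(K, X)) : C(K, Y) :=
  ⟨fun x => f (u x), hf.comp u.continuous⟩

omit [CompactSpace K] [NormedSpace ℝ X] [NormedSpace ℝ Y] in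
@[simp] theorem superpose_apply (f : X → Y) (hf : Continuous f) (u : C(K, X)) (x : K) :
    superpose f hf u x = f (u x) := rfl

variable [FiniteDimensional ℝ X]

theorem hasFDerivAt_superpose {f : X → Y} (hf : ContDiff ℝ 1 f) (u : C(K, X)) :
    HasFDerivAt (superpose f hf.continuous)
      (fieldApply (superpose (fderiv ℝ f) (hf.continuous_fderiv (by simp)) u)) u := by
  have : ProperSpace X := FiniteDimensional.proper ℝ X
  rw [hasFDerivAt_iff_isLittleO_nhds_zero, Asymptotics.isLittleO_iff]
  intro c hc
  have hcpt : IsCompact (cthickening 1 (Set.range u)) :=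
    (isCompact_range u.continuous).cthickening
  have huc := hcpt.uniformContinuousOn_of_continuous
    (hf.continuous_fderiv (by simp)).continuousOn
  obtain ⟨r, hr, hr'⟩ := Metric.uniformContinuousOn_iff.1 huc c hc
  filter_upwards [ball_mem_nhds (0 : C(K, X)) (lt_min hr one_pos)] with h hh
  rw [mem_ball_zero_iff, lt_min_iff] at hh
  refine (ContinuousMap.norm_le _ (by positivity)).2 fun x => ?_
  have hx : ‖h x‖ ≤ ‖h‖ := h.norm_coe_le_norm x
  have hball : ∀ y ∈ ball (u x) (min r 1), ‖fderiv ℝ f y - fderiv ℝ f (u x)‖ ≤ c := by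
    intro y hy
    rw [mem_ball, lt_min_iff] at hy
    rw [← dist_eq_norm]
    refine (hr' _ ?_ _ ?_ hy.1).le
    · exact mem_cthickening_of_dist_le _ (u x) _ _ ⟨x, rfl⟩ hy.2.le
    · exact mem_cthickening_of_dist_le _ (u x) _ _ ⟨x, rfl⟩ (by simp)
  have key := (convex_ball (u x) (min r 1)).norm_image_sub_le_of_norm_hasFDerivWithin_le'
    (f := f) (f' := fderiv ℝ f) (φ := fderiv ℝ f (u x)) (C := c) (x := u x) (y := u x + h x)
    (fun y _ => ((hf.differentiable (by simp)) y).hasFDerivAt.hasFDerivWithinAt) hball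
    (mem_ball_self (lt_min hr one_pos))
    (by
      rw [mem_ball, dist_eq_norm, add_sub_cancel_left, lt_min_iff]
      exact ⟨hx.trans_lt hh.1, hx.trans_lt hh.2⟩)
  simp only [add_sub_cancel_left] at key
  calc _ = ‖f (u x + h x) - f (u x) - fderiv ℝ f (u x) (h x)‖ := by simp
    _ ≤ c * ‖h x‖ := key
    _ ≤ c * ‖h‖ := by gcongr

theorem contDiff_superpose {f : X → Y} (hf : ContDiff ℝ ∞ f) :
    ContDiff ℝ ∞ (superpose f hf.continuous : C(K, X) → C(K, Y)) := by
  rw [contDiff_infty]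
  intro m
  induction m generalizing Y with
  | zero =>
    refine contDiff_zero.2 (continuous_iff_continuousAt.2 fun u => ?_)
    exact (hasFDerivAt_superpose (hf.of_le (by simp)) u).continuousAt
  | succ m ih =>
    refine contDiff_succ_iff_hasFDerivAt.2 ⟨_, ?_,
      fun u => hasFDerivAt_superpose (hf.of_le (by simp)) u⟩
    exact fieldApply.contDiff.comp (ih (hf.fderiv_right (m := ∞) (by norm_num)))

end Superposition

section Implicit

variable {E F : Type*} [NormedAddCommGroup E] [NormedSpace ℝ E] [CompleteSpace E]
  [NormedAddCommGroup F] [NormedSpace ℝ F] [CompleteSpace F]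

/-- A smooth family of equations which at the base parameter reads `x = x₀` has a smooth
family of locally unique solutions. -/
theorem exists_smooth_solution {f : E × F → F} {e₀ : E} {x₀ : F}
    (hf : ∀ᶠ v in 𝓝 (e₀, x₀), ContDiffAt ℝ ∞ f v)
    (hbase : ∀ᶠ x in 𝓝 x₀, f (e₀, x) = x - x₀) :
    ∃ Ψ : E → F, Ψ e₀ = x₀ ∧ (∀ᶠ e in 𝓝 e₀, ContDiffAt ℝ ∞ Ψ e) ∧
      ∀ᶠ v in 𝓝 (e₀, x₀), f v = 0 ↔ Ψ v.1 = v.2 := by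
  have h0 : f (e₀, x₀) = 0 := by simpa using hbase.self_of_nhds
  have hfu := hf.self_of_nhds
  have hder : fderiv ℝ f (e₀, x₀) ∘L .inr ℝ E F = .id ℝ F := by
    have h1 : HasFDerivAt (fun x => f (e₀, x)) (fderiv ℝ f (e₀, x₀) ∘L .inr ℝ E F) x₀ :=
      (hfu.differentiableAt (by simp)).hasFDerivAt.comp x₀ (hasFDerivAt_prodMk_right e₀ x₀)
    exact h1.unique (((hasFDerivAt_id x₀).sub_const x₀).congr_of_eventuallyEq hbase)
  have hinv : (fderiv ℝ f (e₀, x₀) ∘L .inr ℝ E F).IsInvertible :=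
    hder ▸ ⟨ContinuousLinearEquiv.refl ℝ F, rfl⟩
  have hinv' : ∀ᶠ v in 𝓝 (e₀, x₀), (fderiv ℝ f v ∘L .inr ℝ E F).IsInvertible := by
    have hc : ContinuousAt (fun v => fderiv ℝ f v ∘L .inr ℝ E F) (e₀, x₀) :=
      (hfu.fderiv_right (m := 0) (by simp)).continuousAt.clm_comp continuousAt_const
    obtain ⟨g, hg⟩ := hinv
    filter_upwards [hc.preimage_mem_nhds (hg ▸ g.nhds)] with v hv
    exact hv
  have hne : (∞ : ℕ∞ω) ≠ 0 := by simp
  have hev := hfu.eventually_apply_eq_iff_implicitFunction hne hinv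
  have hself := hfu.implicitFunction_apply_self hne hinv
  have hcont := (hfu.contDiffAt_implicitFunction hne hinv).continuousAt
  refine ⟨hfu.implicitFunction hne hinv, hself, ?_, by simpa [h0] using hev⟩
  have hzero := hfu.eventually_apply_implicitFunction hne hinv
  generalize hfu.implicitFunction hne hinv = Ψ at *
  simp only at hself hcont hzero
  have hpair : Filter.Tendsto (fun e => (e, Ψ e)) (𝓝 e₀) (𝓝 (e₀, x₀)) := by
    have := continuousAt_id.prodMk hcont
    simpa [ContinuousAt, hself] using this
  filter_upwards [hpair.eventually hev.eventually_nhds, hpair.eventually hinv',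
    hpair.eventually hf, hzero] with e he hie hfe hze
  refine (hfe.contDiffAt_implicitFunction hne hie).congr_of_eventuallyEq ?_
  have hc2 := (hfe.contDiffAt_implicitFunction hne hie).continuousAt
  have hs2 := hfe.implicitFunction_apply_self hne hie
  have hz2 := hfe.eventually_apply_implicitFunction hne hie
  generalize hfe.implicitFunction hne hie = Ψ' at *
  have hpair' : Filter.Tendsto (fun e => (e, Ψ' e)) (𝓝 e) (𝓝 (e, Ψ e)) := by
    have := continuousAt_id.prodMk hc2
    simp only at hs2
    simpa [ContinuousAt, hs2] using this
  filter_upwards [hpair'.eventually he, hz2] with e' h1 h2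
  exact h1.1 (h2.trans hze)

end Implicit

section Torus

open MeasureTheory UnitAddTorus
open scoped ENNReal lp ComplexConjugate

attribute [local instance] instMeasureSpaceUnitAddCircle

local instance isAddHaarMeasure_unitAddCircle :
    Measure.IsAddHaarMeasure (volume : Measure UnitAddCircle) :=
  inferInstanceAs (Measure.IsAddHaarMeasure AddCircle.haarAddCircle)

local instance isProbabilityMeasure_unitAddCircle :
    IsProbabilityMeasure (volume : Measure UnitAddCircle) :=
  inferInstanceAs (IsProbabilityMeasure AddCircle.haarAddCircle)

/-- The two-dimensional torus. -/
abbrev Torus : Type := UnitAddTorus (Fin 2)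

/-- The lattice of frequencies. -/
abbrev Freq : Type := Fin 2 → ℤ

variable {V : Type} [NormedAddCommGroup V] [InnerProductSpace ℂ V]

/-- The square summable families of Fourier coefficients. -/
abbrev Coeffs (V : Type) [NormedAddCommGroup V] [InnerProductSpace ℂ V] : Type :=
  lp (fun _ : Freq => V) 2

/-- The square integrable functions on the torus. -/
abbrev L2Torus (X : Type) [NormedAddCommGroup X] : Type := Lp X 2 (volume : Measure Torus)

/-- Continuous functions as square integrable functions. -/
abbrev toL2 {X : Type} [NormedAddCommGroup X] [NormedSpace ℝ X] : C(Torus, X) →L[ℝ] L2Torus X :=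
  ContinuousMap.toLp 2 volume ℝ

/-- The function `x ↦ e^{2πi k·x} v`. -/
def mode (k : Freq) (v : V) : C(Torus, V) := ⟨fun x => mFourier k x • v, by fun_prop⟩

@[simp] theorem mode_apply (k : Freq) (v : V) (x : Torus) : mode k v x = mFourier k x • v := rfl

theorem norm_mFourier_apply (k : Freq) (x : Torus) : ‖mFourier k x‖ = 1 := by
  simp only [mFourier, fourier_apply, ContinuousMap.coe_mk, norm_prod, Circle.norm_coe,
    Finset.prod_const_one]

theorem norm_mode_le (k : Freq) (v : V) : ‖mode k v‖ ≤ ‖v‖ :=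
  (ContinuousMap.norm_le _ (by positivity)).2 fun x => by
    simp [norm_smul, norm_mFourier_apply]

theorem tsum_norm_mul_norm_le (ν : lp (fun _ : Freq => ℂ) 2) (c : Coeffs V) :
    (Summable fun k => ‖ν k‖ * ‖c k‖) ∧ ∑' k, ‖ν k‖ * ‖c k‖ ≤ ‖ν‖ * ‖c‖ := by
  have := lp.tsum_mul_le_mul_norm (p := 2) (q := 2)
    (by simpa using Real.HolderConjugate.two_two) (lp.toNorm ν) (lp.toNorm c)
  simpa [lp.norm_toNorm] using this

theorem norm_smul_mode_le (a : ℂ) (k : Freq) (v : V) : ‖a • mode k v‖ ≤ ‖a‖ * ‖v‖ := by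
  rw [norm_smul]
  exact mul_le_mul_of_nonneg_left (norm_mode_le k v) (norm_nonneg a)

variable [FiniteDimensional ℂ V]

theorem summable_smul_mode (ν : lp (fun _ : Freq => ℂ) 2) (c : Coeffs V) :
    Summable fun k => ν k • mode k (c k) :=
  haveI : CompleteSpace V := FiniteDimensional.complete ℂ V
  .of_norm_bounded (tsum_norm_mul_norm_le ν c).1 fun _ => norm_smul_mode_le _ _ _

/-- The Fourier series `∑ ν k e^{2πi k·x} c k`, for square summable `ν` and `c`. -/
def synth (ν : lp (fun _ : Freq => ℂ) 2) : Coeffs V →L[ℝ] C(Torus, V) :=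
  LinearMap.mkContinuous
    { toFun c := ∑' k, ν k • mode k (c k)
      map_add' c d := by
        rw [← (summable_smul_mode ν c).tsum_add (summable_smul_mode ν d)]
        congr! 2 with k
        ext x
        simp
      map_smul' a c := by
        rw [RingHom.id_apply, ← (summable_smul_mode ν c).tsum_const_smul]
        congr! 2 with k
        ext x
        simp [smul_comm a] } ‖ν‖ fun c =>
    (tsum_of_norm_bounded (tsum_norm_mul_norm_le ν c).1.hasSum
      fun k => norm_smul_mode_le _ _ _).trans (tsum_norm_mul_norm_le ν c).2

theorem hasSum_synth (ν : lp (fun _ : Freq => ℂ) 2) (c : Coeffs V) :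
    HasSum (fun k => ν k • mode k (c k)) (synth ν c) :=
  (summable_smul_mode ν c).hasSum

theorem synth_single (ν : lp (fun _ : Freq => ℂ) 2) (k : Freq) (v : V) :
    synth ν (lp.single 2 k v) = ν k • mode k v := by
  refine (hasSum_synth ν (lp.single 2 k v)).unique ?_
  have := hasSum_single (f := fun j => ν j • mode j ((lp.single 2 k v : Coeffs V) j)) k
    fun j hj => by
      rw [lp.single_apply_ne (E := fun _ => V) 2 k v hj]
      ext x
      simp
  rwa [lp.single_apply_self (E := fun _ => V)] at this

theorem inner_toL2 (f g : C(Torus, V)) :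
    inner ℂ (toL2 f) (toL2 g) = ∫ x, inner ℂ (f x) (g x) := by
  rw [L2.inner_def]
  refine integral_congr_ae ?_
  filter_upwards [ContinuousMap.coeFn_toLp (p := 2) (𝕜 := ℝ) volume f,
    ContinuousMap.coeFn_toLp (p := 2) (𝕜 := ℝ) volume g] with x hf hg
  rw [hf, hg]

theorem integral_conj_mFourier_mul (j k : Freq) :
    ∫ x : Torus, conj (mFourier j x) * mFourier k x = if j = k then 1 else 0 := by
  rw [← orthonormal_iff_ite.1 (orthonormal_mFourier (d := Fin 2)) j k]
  refine Eq.trans ?_ (ContinuousMap.inner_toLp volume (mFourier j) (mFourier k)).symm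
  simp_rw [mul_comm]

theorem inner_mode (j k : Freq) (v w : V) :
    inner ℂ (toL2 (mode j v)) (toL2 (mode k w)) = if j = k then inner ℂ v w else 0 := by
  have h : ∀ x, inner ℂ (mode j v x) (mode k w x)
      = (conj (mFourier j x) * mFourier k x) * inner ℂ v w := fun x => by
    rw [mode_apply, mode_apply, inner_smul_left, inner_smul_right, mul_assoc]
  simp_rw [inner_toL2, h]
  rw [integral_mul_const, integral_conj_mFourier_mul, ite_mul, one_mul, zero_mul]

/-- The `k`-th Fourier mode in the space of square integrable functions. -/
def modeL2 (k : Freq) : V →ₗᵢ[ℂ] L2Torus V :=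
  LinearMap.isometryOfInner
    { toFun v := toL2 (mode k v)
      map_add' v w := by
        rw [← map_add]
        congr 1
        ext x
        simp
      map_smul' a v := by
        have h : mode k (a • v) = a • mode k v := by
          ext x
          simp [smul_comm a]
        rw [h]
        exact (ContinuousMap.toLp 2 volume ℂ : C(Torus, V) →L[ℂ] L2Torus V).map_smul _ _ }
    fun v w => by simp [inner_mode]

theorem orthogonalFamily_modeL2 :
    OrthogonalFamily ℂ (fun _ : Freq => V) (fun k => modeL2 (V := V) k) := fun j k hjk v w => by
  exact (inner_mode j k v w).trans (if_neg hjk)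

/-- The Fourier series `∑ e^{2πi k·x} c k`, as a square integrable function. -/
def synthL2 : Coeffs V →ₗᵢ[ℂ] L2Torus V :=
  haveI : CompleteSpace V := FiniteDimensional.complete ℂ V
  orthogonalFamily_modeL2.linearIsometry

theorem synthL2_single (k : Freq) (v : V) :
    synthL2 (lp.single 2 k v : Coeffs V) = toL2 (mode k v) :=
  haveI : CompleteSpace V := FiniteDimensional.complete ℂ V
  orthogonalFamily_modeL2.linearIsometry_apply_single v

/-- The Fourier coefficients of a square integrable function. -/
def analysis : L2Torus V →L[ℝ] Coeffs V :=
  haveI : CompleteSpace V := FiniteDimensional.complete ℂ V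
  (ContinuousLinearMap.adjoint (synthL2 (V := V)).toContinuousLinearMap).restrictScalars ℝ

/-- The `k`-th Fourier coefficient of a continuous function. -/
def coeff (k : Freq) : C(Torus, V) →L[ℝ] V :=
  lp.evalCLM ℝ (fun _ : Freq => V) 2 k ∘L analysis ∘L toL2

theorem analysis_toL2 (f : C(Torus, V)) (k : Freq) : analysis (toL2 f) k = coeff k f := rfl

theorem coeff_eq_integral (k : Freq) (f : C(Torus, V)) :
    coeff k f = ∫ x, conj (mFourier k x) • f x := by
  have : CompleteSpace V := FiniteDimensional.complete ℂ V
  refine ext_inner_left ℂ fun v => ?_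
  have h : inner ℂ v (coeff k f) = inner ℂ (lp.single 2 k v : Coeffs V) (analysis (toL2 f)) :=
    (lp.inner_single_left (𝕜 := ℂ) (G := fun _ : Freq => V) k v (analysis (toL2 f))).symm
  rw [h]
  refine (ContinuousLinearMap.adjoint_inner_right _ _ _).trans ?_
  refine (congrArg (inner ℂ · _) (synthL2_single k v)).trans ?_
  rw [inner_toL2, ← integral_inner]
  · congr! 2 with x
    rw [mode_apply, inner_smul_left, inner_smul_right]
  · exact (Continuous.integrable_of_hasCompactSupport (by fun_prop)
      (HasCompactSupport.of_compactSpace _))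

theorem coeff_smul (k : Freq) (a : ℂ) (f : C(Torus, V)) : coeff k (a • f) = a • coeff k f := by
  simp only [coeff_eq_integral, ContinuousMap.smul_apply]
  rw [← integral_smul]
  simp_rw [smul_comm a]

theorem analysis_synthL2 (c : Coeffs V) : analysis (synthL2 c) = c :=
  haveI : CompleteSpace V := FiniteDimensional.complete ℂ V
  DFunLike.congr_fun (synthL2 (V := V)).adjoint_comp_self c

theorem coeff_mode (k j : Freq) (v : V) :
    coeff k (mode j v) = (lp.single 2 j v : Coeffs V) k := by
  rw [← analysis_toL2, ← synthL2_single, analysis_synthL2]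

theorem coeff_synth (ν : lp (fun _ : Freq => ℂ) 2) (c : Coeffs V) (k : Freq) :
    coeff k (synth ν c) = ν k • c k := by
  refine ((coeff k).hasSum (hasSum_synth ν c)).unique ?_
  have := hasSum_single (f := fun j => coeff k (ν j • mode j (c j))) k fun j hj => by
    rw [coeff_smul, coeff_mode, lp.single_apply_ne (E := fun _ => V) 2 j _ hj.symm, smul_zero]
  rwa [coeff_smul, coeff_mode, lp.single_apply_self (E := fun _ => V)] at this

theorem eq_of_coeff_eq {f g : C(Torus, V)} (h : ∀ k, coeff k f = coeff k g) : f = g := by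
  have : CompleteSpace V := FiniteDimensional.complete ℂ V
  ext x
  refine ext_inner_left ℂ fun v => ?_
  rw [← sub_eq_zero, ← inner_sub_right]
  let F : C(Torus, ℂ) := ⟨fun x => inner ℂ v (f x - g x), by fun_prop⟩
  have hF : ∀ k, mFourierCoeff F k = 0 := fun k => by
    have h1 : coeff k (f - g) = 0 := by rw [map_sub, h, sub_self]
    rw [coeff_eq_integral] at h1
    have h2 := congrArg (inner ℂ v) h1
    rw [inner_zero_right, ← integral_inner] at h2
    · rw [← h2, mFourierCoeff]
      congr! 2 with x
      simp only [mFourier_neg, inner_smul_right, smul_eq_mul]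
      rfl
    · exact (Continuous.integrable_of_hasCompactSupport (by fun_prop)
        (HasCompactSupport.of_compactSpace _))
  have h3 := hasSum_mFourier_series_apply_of_summable (f := F)
    (by simp [funext hF]) x
  simp only [hF, zero_smul] at h3
  exact h3.unique hasSum_zero

/-- The Fourier series `∑ μ k e^{2πi k·x} c k` for a bounded multiplier `μ`, as a square
integrable function. -/
def multiplier (μ : Freq → ℂ) {C : ℝ} (hC : ∀ k, ‖μ k‖ ≤ C) : Coeffs V →L[ℝ] L2Torus V :=
  ((synthL2 (V := V)).toContinuousLinearMap ∘L lp.mapCLM 2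
    (fun k => μ k • ContinuousLinearMap.id ℂ V) ((norm_nonneg _).trans (hC 0)) fun k => by
      refine (norm_smul_le _ _).trans ((mul_le_mul_of_nonneg_left
        ContinuousLinearMap.norm_id_le (norm_nonneg _)).trans ?_)
      simpa using hC k).restrictScalars ℝ

theorem multiplier_single (μ : Freq → ℂ) {C : ℝ} (hC : ∀ k, ‖μ k‖ ≤ C) (k : Freq) (v : V) :
    multiplier μ hC (lp.single 2 k v) = toL2 (μ k • mode k v) := by
  have h : μ k • mode k v = mode k (μ k • v) := by
    ext x
    simp [smul_comm (μ k)]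
  rw [h, ← synthL2_single]
  refine congrArg (synthL2 (V := V)) ?_
  ext j
  simp only [lp.single_apply]
  by_cases hj : j = k
  · subst hj
    simp
  · simp [hj]

/-- Finitely supported families of Fourier coefficients. -/
def ofFinsupp (c : Freq →₀ V) : Coeffs V := c.sum fun k v => lp.single 2 k v

/-- The trigonometric polynomial `∑ μ k e^{2πi k·x} c k`. -/
def trigPoly (μ : Freq → ℂ) (c : Freq →₀ V) : C(Torus, V) := c.sum fun k v => μ k • mode k v

theorem synth_ofFinsupp (ν : lp (fun _ : Freq => ℂ) 2) (c : Freq →₀ V) :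
    synth ν (ofFinsupp c) = trigPoly ν c := by
  simp only [ofFinsupp, trigPoly, Finsupp.sum, map_sum, synth_single]

theorem multiplier_ofFinsupp (μ : Freq → ℂ) {C : ℝ} (hC : ∀ k, ‖μ k‖ ≤ C) (c : Freq →₀ V) :
    multiplier μ hC (ofFinsupp c) = toL2 (trigPoly μ c) := by
  simp only [ofFinsupp, trigPoly, Finsupp.sum, map_sum, multiplier_single]

omit [FiniteDimensional ℂ V] in
theorem denseRange_ofFinsupp : DenseRange (ofFinsupp : (Freq →₀ V) → Coeffs V) := fun c => by
  refine mem_closure_of_tendsto (lp.hasSum_single (E := fun _ : Freq => V) (p := 2) (by simp) c)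
    (Filter.Eventually.of_forall fun s => ⟨Finsupp.onFinset s (fun k => if k ∈ s then c k else 0)
      (by simp +contextual), ?_⟩)
  rw [ofFinsupp, Finsupp.onFinset_sum _ (by simp)]
  exact Finset.sum_congr rfl fun k hk => by simp [hk]

end Torus

section Translation

open MeasureTheory UnitAddTorus
open scoped ENNReal lp ComplexConjugate

attribute [local instance] instMeasureSpaceUnitAddCircle isAddHaarMeasure_unitAddCircle
  isProbabilityMeasure_unitAddCircle

variable {X Y Z : Type} [NormedAddCommGroup X] [NormedSpace ℝ X] [NormedAddCommGroup Y]
  [NormedSpace ℝ Y]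

/-- Translation of functions on the torus. -/
def torusShift [TopologicalSpace Z] (y : Torus) (f : C(Torus, Z)) : C(Torus, Z) :=
  ⟨fun x => f (x + y), by fun_prop⟩

@[simp] theorem torusShift_apply [TopologicalSpace Z] (y : Torus) (f : C(Torus, Z)) (x : Torus) :
    torusShift y f x = f (x + y) := rfl

/-- The point of the torus with coordinates `τ.re, τ.im`. -/
def toTorus (τ : ℂ) : Torus := ![(τ.re : UnitAddCircle), (τ.im : UnitAddCircle)]

/-- The two coordinate directions. -/
def direction (j : Fin 2) : ℂ := ![1, I] j

theorem toTorus_zero : toTorus 0 = 0 := by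
  ext j; fin_cases j <;> simp [toTorus]

theorem toTorus_add (σ τ : ℂ) : toTorus (σ + τ) = toTorus σ + toTorus τ := by
  ext j; fin_cases j <;> simp [toTorus]

theorem mFourier_add_apply (k : Freq) (x y : Torus) :
    mFourier k (x + y) = mFourier k x * mFourier k y := by
  simp [mFourier, fourier_apply, AddCircle.toCircle_add, mul_mul_mul_comm]

theorem mFourier_toTorus (k : Freq) (τ : ℂ) :
    mFourier k (toTorus τ) = exp (2 * Real.pi * I * (k 0 * τ.re + k 1 * τ.im)) := by
  simp [mFourier, toTorus, ← Complex.exp_add]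
  ring_nf

/-- `f'` is the partial derivative of `f` in the `j`-th direction, uniformly on the torus. -/
def HasPartial (j : Fin 2) (f f' : C(Torus, X)) : Prop :=
  HasDerivAt (fun r : ℝ => torusShift (toTorus (r * direction j)) f) f' 0

omit [NormedSpace ℝ X] in
theorem torusShift_toTorus_zero (j : Fin 2) (f : C(Torus, X)) :
    torusShift (toTorus ((0 : ℝ) * direction j)) f = f := by
  ext x
  simp [toTorus_zero]

theorem HasPartial.const (j : Fin 2) (a : X) : HasPartial j (.const _ a) 0 :=
  hasDerivAt_const (0 : ℝ) (ContinuousMap.const Torus a)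

theorem HasPartial.add {j : Fin 2} {f f' g g' : C(Torus, X)} (hf : HasPartial j f f')
    (hg : HasPartial j g g') : HasPartial j (f + g) (f' + g') :=
  HasDerivAt.add hf hg

theorem HasPartial.clm_comp {j : Fin 2} {f f' : C(Torus, X)} (hf : HasPartial j f f')
    (A : X →L[ℝ] Y) :
    HasPartial j (A.compLeftContinuous ℝ Torus f) (A.compLeftContinuous ℝ Torus f') :=
  (A.compLeftContinuous ℝ Torus).hasFDerivAt.comp_hasDerivAt _ hf

theorem HasPartial.superp [FiniteDimensional ℝ X] {j : Fin 2} {u u' : C(Torus, X)}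
    (hu : HasPartial j u u') {f : X → Y} (hf : ContDiff ℝ 1 f) :
    HasPartial j (superpose f hf.continuous u)
      (fieldApply (superpose (fderiv ℝ f) (hf.continuous_fderiv (by simp)) u) u') := by
  have h := hasFDerivAt_superpose hf u
  rw [← torusShift_toTorus_zero j u] at h
  have := h.comp_hasDerivAt (0 : ℝ) hu
  rwa [torusShift_toTorus_zero] at this

theorem HasPartial.fieldApp {j : Fin 2} {A A' : C(Torus, X →L[ℝ] Y)} {u u' : C(Torus, X)}
    (hA : HasPartial j A A') (hu : HasPartial j u u') :
    HasPartial j (fieldApply A u) (fieldApply A' u + fieldApply A u') := by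
  have h := (fieldApply (K := Torus) (X := X) (Y := Y)).hasFDerivAt_of_bilinear
    (HasDerivAt.hasFDerivAt hA) (HasDerivAt.hasFDerivAt hu)
  have h2 := h.hasDerivAt
  simp only [torusShift_toTorus_zero] at h2
  refine h2.congr_deriv ?_
  simp [add_comm]

variable {V : Type} [NormedAddCommGroup V] [InnerProductSpace ℂ V]

/-- The multiplier of the partial derivative in the `j`-th direction. -/
def freqMul (j : Fin 2) (k : Freq) : ℂ := 2 * Real.pi * I * k j

theorem hasDerivAt_mFourier (j : Fin 2) (k : Freq) :
    HasDerivAt (fun r : ℝ => mFourier k (toTorus (r * direction j))) (freqMul j k) 0 := by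
  have h : ∀ r : ℝ, mFourier k (toTorus (r * direction j)) = exp (freqMul j k * r) := fun r => by
    rw [mFourier_toTorus]
    fin_cases j <;> simp [direction, freqMul] <;> ring_nf
  simp_rw [h]
  have h2 : HasDerivAt (fun r : ℝ => freqMul j k * (r : ℂ)) (freqMul j k * 1) 0 :=
    (hasDerivAt_id (0 : ℝ)).ofReal_comp.const_mul (freqMul j k)
  simpa using h2.cexp

theorem hasPartial_mode (j : Fin 2) (k : Freq) (v : V) :
    HasPartial j (mode k v) (freqMul j k • mode k v) := by
  have h : ∀ y, torusShift y (mode k v) = mFourier k y • mode k v := fun y => by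
    ext x
    simp [mFourier_add_apply, mul_comm, smul_smul]
  simp only [HasPartial, h]
  exact (hasDerivAt_mFourier j k).smul_const (mode k v)

theorem hasPartial_trigPoly (j : Fin 2) (μ : Freq → ℂ) (c : Freq →₀ V) :
    HasPartial j (trigPoly μ c) (trigPoly (fun k => freqMul j k * μ k) c) := by
  have h : ∀ y, torusShift y (trigPoly μ c)
      = ∑ k ∈ c.support, torusShift y (μ k • mode k (c k)) := fun y => by
    ext x
    simp [trigPoly, Finsupp.sum]
  simp only [HasPartial, h]
  refine HasDerivAt.fun_sum fun k _ => ?_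
  have := HasDerivAt.fun_const_smul (μ k) (hasPartial_mode j k (c k))
  rw [smul_smul, mul_comm] at this
  exact this

variable [FiniteDimensional ℂ V]

theorem coeff_torusShift (k : Freq) (y : Torus) (f : C(Torus, V)) :
    coeff k (torusShift y f) = mFourier k y • coeff k f := by
  rw [coeff_eq_integral, coeff_eq_integral, ← integral_smul,
    ← integral_add_right_eq_self (fun x => mFourier k y • conj (mFourier k x) • f x) y]
  congr! 2 with x
  have : mFourier k y * conj (mFourier k y) = 1 := by
    rw [Complex.mul_conj, Complex.normSq_eq_norm_sq, norm_mFourier_apply]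
    simp
  rw [mFourier_add_apply, map_mul, smul_smul, mul_left_comm, this, mul_one, torusShift_apply]

theorem HasPartial.coeff_eq {j : Fin 2} {f f' : C(Torus, V)} (hf : HasPartial j f f') (k : Freq) :
    coeff k f' = freqMul j k • coeff k f := by
  have h1 := (coeff k).hasFDerivAt.comp_hasDerivAt _ hf
  have h2 := (hasDerivAt_mFourier j k).smul_const (coeff k f)
  refine h1.unique (h2.congr_of_eventuallyEq (Filter.Eventually.of_forall fun r => ?_))
  exact coeff_torusShift k _ f

end Translation

section Nonlinearity

set_option maxSynthPendingDepth 4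

open MeasureTheory UnitAddTorus
open scoped ENNReal lp ComplexConjugate

attribute [local instance] instMeasureSpaceUnitAddCircle isAddHaarMeasure_unitAddCircle
  isProbabilityMeasure_unitAddCircle

/-- Pointwise application of a continuous field of operators to a square integrable function. -/
def fieldApplyL2 {X Y : Type} [NormedAddCommGroup X] [NormedSpace ℝ X] [NormedAddCommGroup Y]
    [NormedSpace ℝ Y] : C(Torus, X →L[ℝ] Y) →L[ℝ] L2Torus X →L[ℝ] L2Torus Y :=
  (ContinuousLinearMap.holderL volume ∞ 2 2 (.id ℝ (X →L[ℝ] Y))) ∘L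
    (ContinuousMap.toLp ∞ volume ℝ : C(Torus, X →L[ℝ] Y) →L[ℝ] Lp (X →L[ℝ] Y) ∞ volume)

theorem fieldApplyL2_toL2 {X Y : Type} [NormedAddCommGroup X] [NormedSpace ℝ X]
    [NormedAddCommGroup Y] [NormedSpace ℝ Y] (A : C(Torus, X →L[ℝ] Y)) (u : C(Torus, X)) :
    fieldApplyL2 A (toL2 u) = toL2 (fieldApply A u) := by
  refine Lp.ext ?_
  filter_upwards [ContinuousLinearMap.coeFn_holder (r := 2) (.id ℝ (X →L[ℝ] Y))
      (ContinuousMap.toLp ∞ volume ℝ A) (toL2 u),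
    ContinuousMap.coeFn_toLp (p := ∞) (𝕜 := ℝ) volume A,
    ContinuousMap.coeFn_toLp (p := 2) (𝕜 := ℝ) volume u,
    ContinuousMap.coeFn_toLp (p := 2) (𝕜 := ℝ) volume (fieldApply A u)] with x h1 h2 h3 h4
  rw [h4]
  refine h1.trans ?_
  rw [h2, h3]
  rfl

variable {W Y V : Type} [NormedAddCommGroup W] [NormedSpace ℝ W] [FiniteDimensional ℝ W]
  [NormedAddCommGroup Y] [NormedSpace ℝ Y] [NormedAddCommGroup V]

section
variable [NormedSpace ℝ V]

/-- The derivative of a field of operators, with the arguments flipped. -/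
def flipDeriv (Q : W → Y →L[ℝ] V) (x : W) : Y →L[ℝ] W →L[ℝ] V := (fderiv ℝ Q x).flip

omit [FiniteDimensional ℝ W] in
theorem contDiff_flipDeriv {Q : W → Y →L[ℝ] V} (hQ : ContDiff ℝ ∞ Q) :
    ContDiff ℝ ∞ (flipDeriv Q) :=
  (ContinuousLinearMap.flipₗᵢ ℝ W Y V).contDiff.comp (hQ.fderiv_right (m := ∞) (by norm_num))

variable {Q : W → Y →L[ℝ] V} (hQ : ContDiff ℝ ∞ Q)

/-- The field of operators `Q ∘ w`. -/
def field₀ (w : C(Torus, W)) : C(Torus, Y →L[ℝ] V) := superpose Q hQ.continuous w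

/-- The field of operators `DQ ∘ w`. -/
def field₁ (w : C(Torus, W)) : C(Torus, W →L[ℝ] Y →L[ℝ] V) :=
  superpose (fderiv ℝ Q) (hQ.fderiv_right (m := ∞) (by norm_num)).continuous w

/-- The field of operators `D²Q ∘ w`. -/
def field₂ (w : C(Torus, W)) : C(Torus, W →L[ℝ] W →L[ℝ] Y →L[ℝ] V) :=
  superpose (fderiv ℝ (fderiv ℝ Q)) ((hQ.fderiv_right (m := ∞) (by norm_num)).fderiv_right (m := ∞)
    (by norm_num)).continuous w

/-- The function `(1 + ∂₁)(1 + ∂₂)(Q(w) y)`, in terms of the partial derivatives of `w` and `y`. -/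
def mixedDeriv (w w₁ w₂ : C(Torus, W)) (y : C(Torus, Y)) (w₁₂ : L2Torus W)
    (y₁ y₂ y₁₂ : L2Torus Y) : L2Torus V :=
  toL2 (fieldApply (field₀ hQ w) y)
  + (toL2 (fieldApply (fieldApply (field₁ hQ w) w₁) y) + fieldApplyL2 (field₀ hQ w) y₁)
  + (toL2 (fieldApply (fieldApply (field₁ hQ w) w₂) y) + fieldApplyL2 (field₀ hQ w) y₂)
  + (toL2 (fieldApply (fieldApply (fieldApply (field₂ hQ w) w₂) w₁) y)
    + fieldApplyL2 (fieldApply (superpose (flipDeriv Q) (contDiff_flipDeriv hQ).continuous w) y) w₁₂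
    + fieldApplyL2 (fieldApply (field₁ hQ w) w₁) y₂
    + (fieldApplyL2 (fieldApply (field₁ hQ w) w₂) y₁ + fieldApplyL2 (field₀ hQ w) y₁₂))

theorem contDiff_mixedDeriv {E : Type*} [NormedAddCommGroup E] [NormedSpace ℝ E]
    {w w₁ w₂ : E → C(Torus, W)} {y : E → C(Torus, Y)} {w₁₂ : E → L2Torus W}
    {y₁ y₂ y₁₂ : E → L2Torus Y} (hw : ContDiff ℝ ∞ w) (hw₁ : ContDiff ℝ ∞ w₁)
    (hw₂ : ContDiff ℝ ∞ w₂) (hy : ContDiff ℝ ∞ y) (hw₁₂ : ContDiff ℝ ∞ w₁₂)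
    (hy₁ : ContDiff ℝ ∞ y₁) (hy₂ : ContDiff ℝ ∞ y₂) (hy₁₂ : ContDiff ℝ ∞ y₁₂) :
    ContDiff ℝ ∞ fun e =>
      mixedDeriv hQ (w e) (w₁ e) (w₂ e) (y e) (w₁₂ e) (y₁ e) (y₂ e) (y₁₂ e) := by
  have h0 : ContDiff ℝ ∞ fun e => field₀ hQ (w e) := (contDiff_superpose hQ).comp hw
  have h1 : ContDiff ℝ ∞ fun e => field₁ hQ (w e) :=
    (contDiff_superpose (hQ.fderiv_right (m := ∞) (by norm_num))).comp hw
  have h2 : ContDiff ℝ ∞ fun e => field₂ hQ (w e) :=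
    (contDiff_superpose ((hQ.fderiv_right (m := ∞) (by norm_num)).fderiv_right (m := ∞)
      (by norm_num))).comp hw
  have hf : ContDiff ℝ ∞ fun e =>
      superpose (flipDeriv Q) (contDiff_flipDeriv hQ).continuous (w e) :=
    (contDiff_superpose (contDiff_flipDeriv hQ)).comp hw
  have happ : ∀ {X Z : Type} [NormedAddCommGroup X] [NormedSpace ℝ X] [NormedAddCommGroup Z]
      [NormedSpace ℝ Z] {A : E → C(Torus, X →L[ℝ] Z)} {u : E → C(Torus, X)},
      ContDiff ℝ ∞ A → ContDiff ℝ ∞ u → ContDiff ℝ ∞ fun e => fieldApply (A e) (u e) :=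
    fun {X Z _ _ _ _ A u} hA hu =>
      ContDiff.clm_apply ((fieldApply (K := Torus) (X := X) (Y := Z)).contDiff.comp hA) hu
  have happ2 : ∀ {X Z : Type} [NormedAddCommGroup X] [NormedSpace ℝ X] [NormedAddCommGroup Z]
      [NormedSpace ℝ Z] {A : E → C(Torus, X →L[ℝ] Z)} {u : E → L2Torus X},
      ContDiff ℝ ∞ A → ContDiff ℝ ∞ u → ContDiff ℝ ∞ fun e => fieldApplyL2 (A e) (u e) :=
    fun {X Z _ _ _ _ A u} hA hu =>
      ContDiff.clm_apply ((fieldApplyL2 (X := X) (Y := Z)).contDiff.comp hA) hu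
  have hto : ∀ {f : E → C(Torus, V)}, ContDiff ℝ ∞ f → ContDiff ℝ ∞ fun e => toL2 (f e) :=
    fun hf => (toL2 (X := V)).contDiff.comp hf
  exact (((hto (happ h0 hy)).add ((hto (happ (happ h1 hw₁) hy)).add (happ2 h0 hy₁))).add
    ((hto (happ (happ h1 hw₂) hy)).add (happ2 h0 hy₂))).add
    (((hto (happ (happ (happ h2 hw₂) hw₁) hy)).add (happ2 (happ hf hy) hw₁₂)).add
      (happ2 (happ h1 hw₁) hy₂) |>.add ((happ2 (happ h1 hw₂) hy₁).add (happ2 h0 hy₁₂)))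

end

variable [InnerProductSpace ℂ V] [FiniteDimensional ℂ V]

theorem analysis_mixedDeriv {Q : W → Y →L[ℝ] V} (hQ : ContDiff ℝ ∞ Q)
    {w w₁ w₂ w₁₂ : C(Torus, W)} {y y₁ y₂ y₁₂ : C(Torus, Y)}
    (hw₁ : HasPartial 0 w w₁) (hw₂ : HasPartial 1 w w₂) (hw₁₂ : HasPartial 1 w₁ w₁₂)
    (hy₁ : HasPartial 0 y y₁) (hy₂ : HasPartial 1 y y₂) (hy₁₂ : HasPartial 1 y₁ y₁₂) (k : Freq) :
    analysis (mixedDeriv hQ w w₁ w₂ y (toL2 w₁₂) (toL2 y₁) (toL2 y₂) (toL2 y₁₂)) k =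
      ((1 + freqMul 0 k) * (1 + freqMul 1 k)) • coeff k (fieldApply (field₀ hQ w) y) := by
  have hQ1 : ContDiff ℝ 1 Q := hQ.of_le (by simp)
  have hDQ : ContDiff ℝ 1 (fderiv ℝ Q) := (hQ.fderiv_right (m := ∞) (by norm_num)).of_le (by simp)
  have h1 := ((hw₁.superp hQ1).fieldApp hy₁)
  have h2 := ((hw₂.superp hQ1).fieldApp hy₂)
  have h12 := (((hw₂.superp hDQ).fieldApp hw₁₂).fieldApp hy₂).add
    ((hw₂.superp hQ1).fieldApp hy₁₂)
  have e1 := h1.coeff_eq k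
  have e2 := h2.coeff_eq k
  have e12 := h12.coeff_eq k
  have hflip : fieldApply (fieldApply (superpose (flipDeriv Q)
      (contDiff_flipDeriv hQ).continuous w) y) w₁₂ =
        fieldApply (fieldApply (field₁ hQ w) w₁₂) y := by
    ext x
    rfl
  simp only [mixedDeriv, fieldApplyL2_toL2, hflip, ← map_add, analysis_toL2]
  simp only [map_add, add_apply] at e1 e2 e12 ⊢
  have r1 : coeff k (fieldApply (fieldApply (field₁ hQ w) w₁) y)
      + coeff k (fieldApply (field₀ hQ w) y₁)
      = freqMul 0 k • coeff k (fieldApply (field₀ hQ w) y) := e1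
  have r2 : coeff k (fieldApply (fieldApply (field₁ hQ w) w₂) y)
      + coeff k (fieldApply (field₀ hQ w) y₂)
      = freqMul 1 k • coeff k (fieldApply (field₀ hQ w) y) := e2
  have r12 : coeff k (fieldApply (fieldApply (fieldApply (field₂ hQ w) w₂) w₁) y)
      + coeff k (fieldApply (fieldApply (field₁ hQ w) w₁₂) y)
      + coeff k (fieldApply (fieldApply (field₁ hQ w) w₁) y₂)
      + (coeff k (fieldApply (fieldApply (field₁ hQ w) w₂) y₁)
        + coeff k (fieldApply (field₀ hQ w) y₁₂))
      = freqMul 1 k • (coeff k (fieldApply (fieldApply (field₁ hQ w) w₁) y)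
        + coeff k (fieldApply (field₀ hQ w) y₁)) := e12
  rw [r1] at r12 ⊢
  rw [r2, r12]
  module

end Nonlinearity

section Symbols

open UnitAddTorus
open scoped ENNReal lp

/-- The symbol of the operator `∂₁ + i ∂₂ + π`. -/
def ellipticSymbol (k : Freq) : ℂ := freqMul 0 k + I * freqMul 1 k + Real.pi

/-- The symbol of the operator `(1 + ∂₁)(1 + ∂₂)`. -/
def weight (k : Freq) : ℂ := (1 + freqMul 0 k) * (1 + freqMul 1 k)

theorem ellipticSymbol_re (k : Freq) : (ellipticSymbol k).re = Real.pi * (1 - 2 * k 1) := by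
  simp [ellipticSymbol, freqMul]
  ring

theorem ellipticSymbol_im (k : Freq) : (ellipticSymbol k).im = 2 * Real.pi * k 0 := by
  simp [ellipticSymbol, freqMul]

theorem norm_freqMul (j : Fin 2) (k : Freq) : ‖freqMul j k‖ = 2 * Real.pi * |(k j : ℝ)| := by
  simp [freqMul, abs_of_pos Real.pi_pos]

theorem sq_norm_one_add_freqMul (j : Fin 2) (k : Freq) :
    ‖1 + freqMul j k‖ ^ 2 = 1 + (2 * Real.pi * k j) ^ 2 := by
  rw [← Complex.normSq_eq_norm_sq, Complex.normSq_apply]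
  simp [freqMul]
  ring

theorem one_le_norm_one_add_freqMul (j : Fin 2) (k : Freq) : 1 ≤ ‖1 + freqMul j k‖ := by
  have := sq_norm_one_add_freqMul j k
  nlinarith [norm_nonneg (1 + freqMul j k), sq_nonneg (2 * Real.pi * k j)]

theorem norm_freqMul_le (j : Fin 2) (k : Freq) : ‖freqMul j k‖ ≤ ‖1 + freqMul j k‖ := by
  refine abs_le_of_sq_le_sq' ?_ (norm_nonneg _) |>.2
  rw [sq_norm_one_add_freqMul, norm_freqMul, mul_pow, mul_pow _ (k j : ℝ), sq_abs]
  linarith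

theorem one_le_norm_ellipticSymbol (k : Freq) : 1 ≤ ‖ellipticSymbol k‖ := by
  refine le_trans ?_ (abs_re_le_norm _)
  rw [ellipticSymbol_re, abs_mul, abs_of_pos Real.pi_pos]
  have : (1 : ℝ) ≤ |1 - 2 * (k 1 : ℝ)| := by
    have h : (1 : ℤ) ≤ |1 - 2 * k 1| := by
      rw [le_abs]
      lia
    exact_mod_cast h
  nlinarith [Real.pi_gt_three]

theorem norm_freqMul_zero_le (k : Freq) : ‖freqMul 0 k‖ ≤ ‖ellipticSymbol k‖ := by
  refine le_trans (le_of_eq ?_) (abs_im_le_norm _)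
  rw [ellipticSymbol_im, norm_freqMul, abs_mul, abs_of_pos (mul_pos two_pos Real.pi_pos)]

theorem norm_freqMul_one_le (k : Freq) : ‖freqMul 1 k‖ ≤ 2 * ‖ellipticSymbol k‖ := by
  refine le_trans ?_ (mul_le_mul_of_nonneg_left (abs_re_le_norm _) two_pos.le)
  rw [ellipticSymbol_re, norm_freqMul, abs_mul, abs_of_pos Real.pi_pos]
  have : |(k 1 : ℝ)| ≤ |1 - 2 * (k 1 : ℝ)| := by
    have h : |k 1| ≤ |1 - 2 * k 1| := by
      rcases le_total (k 1) 0 with h | h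
      · rw [abs_of_nonpos h]
        exact le_abs.2 (Or.inl (by lia))
      · rw [abs_of_nonneg h, le_abs]
        lia
    exact_mod_cast h
  nlinarith [Real.pi_pos]

theorem weight_ne_zero (k : Freq) : weight k ≠ 0 := by
  have h : ∀ j, 1 + freqMul j k ≠ 0 := fun j =>
    norm_pos_iff.1 (one_pos.trans_le (one_le_norm_one_add_freqMul j k))
  exact mul_ne_zero (h 0) (h 1)

theorem ellipticSymbol_ne_zero (k : Freq) : ellipticSymbol k ≠ 0 :=
  norm_pos_iff.1 (one_pos.trans_le (one_le_norm_ellipticSymbol k))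

theorem memℓp_inv_weight : Memℓp (fun k : Freq => (weight k)⁻¹) 2 := by
  refine memℓp_gen ?_
  have h1 : Summable fun m : ℤ => (1 + (2 * Real.pi * m) ^ 2)⁻¹ := by
    refine Summable.of_norm_bounded_eventually (Real.summable_one_div_int_pow.2 one_lt_two) ?_
    filter_upwards [(Set.finite_singleton (0 : ℤ)).compl_mem_cofinite] with m hm
    have hm2 : 0 < (m : ℝ) ^ 2 := by
      have : (m : ℝ) ≠ 0 := by exact_mod_cast hm
      positivity
    rw [Real.norm_of_nonneg (by positivity), one_div]
    refine inv_anti₀ hm2 ?_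
    have h4 : 1 ≤ (2 * Real.pi) ^ 2 := by nlinarith [Real.pi_gt_three]
    rw [mul_pow]
    linarith [mul_le_mul_of_nonneg_right h4 hm2.le]
  have h2 := h1.mul_of_nonneg h1 (fun _ => by positivity) fun _ => by positivity
  refine ((finTwoArrowEquiv ℤ).summable_iff.2 h2).congr fun k => ?_
  simp only [Function.comp_apply, finTwoArrowEquiv_apply, weight, norm_inv, norm_mul,
    ENNReal.toReal_ofNat, Real.rpow_ofNat, inv_pow, mul_pow, sq_norm_one_add_freqMul]
  exact (mul_inv _ _).symm

/-- The square summable family `a k / weight k`, for bounded `a`. -/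
def weighted (a : Freq → ℂ) (ha : ∀ k, ‖a k‖ ≤ 2) : lp (fun _ : Freq => ℂ) 2 :=
  ⟨fun k => a k * (weight k)⁻¹, by
    refine (memℓp_inv_weight.const_mul (2 : ℂ)).mono' fun k => ?_
    simpa using mul_le_mul_of_nonneg_right (ha k) (norm_nonneg (weight k)⁻¹)⟩

@[simp] theorem weighted_apply (a : Freq → ℂ) (ha : ∀ k, ‖a k‖ ≤ 2) (k : Freq) :
    weighted a ha k = a k * (weight k)⁻¹ := rfl

theorem norm_div_ellipticSymbol_le {z : ℂ} {k : Freq} (h : ‖z‖ ≤ 2 * ‖ellipticSymbol k‖) :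
    ‖z / ellipticSymbol k‖ ≤ 2 := by
  rw [norm_div]
  exact div_le_of_le_mul₀ (norm_nonneg _) two_pos.le h

theorem norm_one_div_ellipticSymbol_le (k : Freq) : ‖1 / ellipticSymbol k‖ ≤ 2 :=
  norm_div_ellipticSymbol_le (by linarith [norm_one (α := ℂ), one_le_norm_ellipticSymbol k])

theorem norm_freqMul_div_ellipticSymbol_le (j : Fin 2) (k : Freq) :
    ‖freqMul j k / ellipticSymbol k‖ ≤ 2 := by
  refine norm_div_ellipticSymbol_le ?_
  fin_cases j
  · exact (norm_freqMul_zero_le k).trans (by linarith [norm_nonneg (ellipticSymbol k)])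
  · exact norm_freqMul_one_le k

theorem norm_freqMul_mul_inv_le (j : Fin 2) (k : Freq) :
    ‖freqMul j k * (1 + freqMul j k)⁻¹‖ ≤ 1 := by
  rw [norm_mul, norm_inv]
  exact mul_inv_le_one_of_le₀ (norm_freqMul_le j k) (norm_nonneg _)

/-- The Fourier multiplier of the solution operator of `∂₁ v + i ∂₂ v + π v = F`. -/
def solSymbol : lp (fun _ : Freq => ℂ) 2 :=
  weighted (fun k => 1 / ellipticSymbol k) norm_one_div_ellipticSymbol_le

/-- The Fourier multiplier of the partial derivative of the solution operator. -/
def solSymbolDeriv (j : Fin 2) : lp (fun _ : Freq => ℂ) 2 :=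
  weighted (fun k => freqMul j k / ellipticSymbol k) (norm_freqMul_div_ellipticSymbol_le j)

/-- The Fourier multiplier of the inverse of `(1 + ∂₁)(1 + ∂₂)`. -/
def weightSymbol : lp (fun _ : Freq => ℂ) 2 := weighted (fun _ => 1) fun _ => by simp

theorem solSymbolDeriv_apply (j : Fin 2) (k : Freq) :
    solSymbolDeriv j k = freqMul j k * solSymbol k := by
  simp only [solSymbolDeriv, solSymbol, weighted_apply]
  ring

theorem solSymbolDeriv_add (k : Freq) :
    solSymbolDeriv 0 k + I * solSymbolDeriv 1 k + Real.pi * solSymbol k = weightSymbol k := by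
  have := ellipticSymbol_ne_zero k
  simp only [solSymbolDeriv, solSymbol, weightSymbol, weighted_apply]
  field_simp
  rw [ellipticSymbol]

theorem norm_freqMul_mul_solSymbolDeriv_le (i j : Fin 2) (k : Freq) :
    ‖freqMul i k * solSymbolDeriv j k‖ ≤ 2 := by
  have h : ∀ i : Fin 2, ‖freqMul i k * (weight k)⁻¹‖ ≤ 1 := fun i => by
    have h1 : ∀ j, ‖(1 + freqMul j k)⁻¹‖ ≤ 1 := fun j => by
      rw [norm_inv]
      exact inv_le_one_of_one_le₀ (one_le_norm_one_add_freqMul j k)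
    rw [weight, mul_inv]
    fin_cases i
    · rw [← mul_assoc, norm_mul]
      exact mul_le_one₀ (norm_freqMul_mul_inv_le 0 k) (norm_nonneg _) (h1 1)
    · rw [mul_left_comm, norm_mul]
      exact mul_le_one₀ (h1 0) (norm_nonneg _) (norm_freqMul_mul_inv_le 1 k)
  rw [solSymbolDeriv, weighted_apply, mul_left_comm, norm_mul]
  exact (mul_le_mul (norm_freqMul_div_ellipticSymbol_le j k) (h i) (norm_nonneg _)
    two_pos.le).trans_eq (mul_one 2)

theorem norm_freqMul_mul_freqMul_mul_solSymbolDeriv_le (j : Fin 2) (k : Freq) :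
    ‖freqMul 1 k * (freqMul 0 k * solSymbolDeriv j k)‖ ≤ 2 := by
  have h : freqMul 1 k * (freqMul 0 k * solSymbolDeriv j k) = freqMul j k / ellipticSymbol k *
      ((freqMul 0 k * (1 + freqMul 0 k)⁻¹) * (freqMul 1 k * (1 + freqMul 1 k)⁻¹)) := by
    simp only [solSymbolDeriv, weighted_apply, weight, mul_inv]
    ring
  rw [h, norm_mul]
  refine (mul_le_mul (norm_freqMul_div_ellipticSymbol_le j k) ?_ (norm_nonneg _)
    two_pos.le).trans_eq (mul_one 2)
  rw [norm_mul]
  exact mul_le_one₀ (norm_freqMul_mul_inv_le 0 k) (norm_nonneg _) (norm_freqMul_mul_inv_le 1 k)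

end Symbols

section Equation

set_option maxSynthPendingDepth 4

open MeasureTheory UnitAddTorus
open scoped ENNReal lp

attribute [local instance] instMeasureSpaceUnitAddCircle isAddHaarMeasure_unitAddCircle
  isProbabilityMeasure_unitAddCircle

variable {W Y V Θ : Type} [NormedAddCommGroup W] [NormedSpace ℝ W]
  [NormedAddCommGroup V] [InnerProductSpace ℂ V] [FiniteDimensional ℂ V]
  [NormedAddCommGroup Θ] [NormedSpace ℝ Θ]

/-- Pointwise application of a fixed operator to a square integrable function. -/
def mapL2 (A : V →L[ℝ] W) : L2Torus V →L[ℝ] L2Torus W := fieldApplyL2 (.const _ A)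

omit [FiniteDimensional ℂ V] in
theorem mapL2_toL2 (A : V →L[ℝ] W) (f : C(Torus, V)) :
    mapL2 A (toL2 f) = toL2 (A.compLeftContinuous ℝ Torus f) :=
  fieldApplyL2_toL2 _ f

/-- The constant functions on the torus. -/
def constField {X : Type} [NormedAddCommGroup X] [NormedSpace ℝ X] : X →L[ℝ] C(Torus, X) :=
  LinearMap.mkContinuous
    { toFun := ContinuousMap.const Torus
      map_add' _ _ := rfl
      map_smul' _ _ := rfl } 1 fun v => by
    rw [one_mul]
    exact (ContinuousMap.norm_le _ (norm_nonneg v)).2 fun _ => le_rfl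

@[simp] theorem constField_apply {X : Type} [NormedAddCommGroup X] [NormedSpace ℝ X] (a : X)
    (x : Torus) : constField a x = a := rfl

/-- The `j`-th coordinate function of the torus, as a subset of `ℂ²`, translated by `τ`. -/
def torusCoord (j : Fin 2) (τ : ℂ) : C(Torus, ℂ) :=
  mode (Pi.single j 1) (mFourier (Pi.single j 1) (toTorus τ))

theorem torusCoord_apply (j : Fin 2) (τ : ℂ) (x : Torus) :
    torusCoord j τ x = mFourier (Pi.single j 1) (x + toTorus τ) := by
  rw [torusCoord, mode_apply, mFourier_add_apply, smul_eq_mul]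

theorem contDiff_torusCoord (j : Fin 2) : ContDiff ℝ ∞ (torusCoord j) := by
  have h : torusCoord j = fun τ => mFourier (Pi.single j 1) (toTorus τ) •
      mode (Pi.single j 1) (1 : ℂ) := by
    ext τ x
    simp [torusCoord, mul_comm]
  rw [h]
  have hre : ContDiff ℝ ∞ fun τ : ℂ => (τ.re : ℂ) := ofRealCLM.contDiff.comp reCLM.contDiff
  have him : ContDiff ℝ ∞ fun τ : ℂ => (τ.im : ℂ) := ofRealCLM.contDiff.comp imCLM.contDiff
  have h2 : ContDiff ℝ ∞ fun τ => mFourier (Pi.single j 1) (toTorus τ) := by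
    simp_rw [mFourier_toTorus]
    exact (contDiff_const.mul ((contDiff_const.mul hre).add (contDiff_const.mul him))).cexp
  exact h2.smul (contDiff_const (c := mode (Pi.single j 1) (1 : ℂ)))

/-- The inclusion of the `j`-th coordinate. -/
def coordIncl (V Θ : Type) [NormedAddCommGroup V] [NormedSpace ℝ V] [NormedAddCommGroup Θ]
    [NormedSpace ℝ Θ] : Fin 2 → (ℂ →L[ℝ] ℂ × ℂ × V × Θ) :=
  ![.inl ℝ _ _, .inr ℝ _ _ ∘L .inl ℝ _ _]

/-- The inclusion of the values of the unknown function. -/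
def valIncl (V Θ : Type) [NormedAddCommGroup V] [NormedSpace ℝ V] [NormedAddCommGroup Θ]
    [NormedSpace ℝ Θ] : V →L[ℝ] ℂ × ℂ × V × Θ :=
  .inr ℝ _ _ ∘L .inr ℝ _ _ ∘L .inl ℝ _ _

/-- The coordinate functions of the torus, multiplied by `a 0` and `a 1`. -/
def coordField (V Θ : Type) [NormedAddCommGroup V] [NormedSpace ℝ V] [NormedAddCommGroup Θ]
    [NormedSpace ℝ Θ] (a : Fin 2 → ℂ) (τ : ℂ) : C(Torus, ℂ × ℂ × V × Θ) :=
  (coordIncl V Θ 0).compLeftContinuous ℝ Torus (a 0 • torusCoord 0 τ) +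
    (coordIncl V Θ 1).compLeftContinuous ℝ Torus (a 1 • torusCoord 1 τ)

theorem hasPartial_coordField {V : Type} [NormedAddCommGroup V] [NormedSpace ℝ V] (j : Fin 2)
    (a : Fin 2 → ℂ) (τ : ℂ) :
    HasPartial j (coordField V Θ a τ)
      (coordField V Θ (fun i => freqMul j (Pi.single i 1) * a i) τ) := by
  have h : ∀ i, HasPartial j (a i • torusCoord i τ)
      ((freqMul j (Pi.single i 1) * a i) • torusCoord i τ) := fun i => by
    have : ∀ b : ℂ, b • torusCoord i τ
        = mode (Pi.single i 1) (b * mFourier (Pi.single i 1) (toTorus τ)) := fun b => by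
      ext x
      simp [torusCoord]
      ring
    rw [mul_smul, this]
    exact hasPartial_mode j _ _
  exact ((h 0).clm_comp _).add ((h 1).clm_comp _)

theorem contDiff_coordField {V : Type} [NormedAddCommGroup V] [NormedSpace ℝ V]
    (a : Fin 2 → ℂ) : ContDiff ℝ ∞ (coordField V Θ a) :=
  ((ContinuousLinearMap.contDiff _).comp ((contDiff_torusCoord 0).const_smul (a 0))).add
    ((ContinuousLinearMap.contDiff _).comp ((contDiff_torusCoord 1).const_smul (a 1)))

/-- The arguments of the nonlinearity, for the unknown function with coefficients `c`. -/
def argField (P : ℂ × Θ) (c : Coeffs V) : C(Torus, ℂ × ℂ × V × Θ) :=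
  coordField V Θ (fun _ => 1) P.1 + (valIncl V Θ).compLeftContinuous ℝ Torus (synth solSymbol c) +
    constField (0, 0, 0, P.2)

/-- The partial derivatives of `argField`. -/
def argFieldDeriv (j : Fin 2) (P : ℂ × Θ) (c : Coeffs V) : C(Torus, ℂ × ℂ × V × Θ) :=
  coordField V Θ (fun i => freqMul j (Pi.single i 1) * 1) P.1 +
    (valIncl V Θ).compLeftContinuous ℝ Torus (synth (solSymbolDeriv j) c)

/-- The mixed second derivative of `argField`. -/
def argFieldMixed (P : ℂ × Θ) (c : Coeffs V) : L2Torus (ℂ × ℂ × V × Θ) :=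
  toL2 (coordField V Θ (fun i => freqMul 1 (Pi.single i 1) * (freqMul 0 (Pi.single i 1) * 1)) P.1) +
    mapL2 (valIncl V Θ) (multiplier _ (norm_freqMul_mul_solSymbolDeriv_le 1 0) c)

/-- The linear argument of the nonlinearity. -/
def linField (c : Coeffs V) : C(Torus, V × ℝ) :=
  (ContinuousLinearMap.inl ℝ V ℝ).compLeftContinuous ℝ Torus (synth (solSymbolDeriv 1) c) +
    constField (0, 1)

/-- The partial derivatives of `linField`. -/
def linFieldDeriv (j : Fin 2) (c : Coeffs V) : L2Torus (V × ℝ) :=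
  mapL2 (.inl ℝ V ℝ) (multiplier _ (norm_freqMul_mul_solSymbolDeriv_le j 1) c)

/-- The mixed second derivative of `linField`. -/
def linFieldMixed (c : Coeffs V) : L2Torus (V × ℝ) :=
  mapL2 (.inl ℝ V ℝ) (multiplier _ (norm_freqMul_mul_freqMul_mul_solSymbolDeriv_le 1) c)

theorem synth_solSymbolDeriv_ofFinsupp (j : Fin 2) (c : Freq →₀ V) :
    synth (solSymbolDeriv j) (ofFinsupp c) = trigPoly (fun k => freqMul j k * solSymbol k) c := by
  rw [synth_ofFinsupp]
  congr 1
  ext k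
  exact solSymbolDeriv_apply j k

omit [FiniteDimensional ℂ V] in
theorem contDiff_compLeft {X Z : Type} [NormedAddCommGroup X] [NormedSpace ℝ X]
    [NormedAddCommGroup Z] [NormedSpace ℝ Z] {F : Type} [NormedAddCommGroup F] [NormedSpace ℝ F]
    {f : F → X} (A : X →L[ℝ] Z) (hf : ContDiff ℝ ∞ f) : ContDiff ℝ ∞ fun e => A (f e) :=
  A.contDiff.comp hf

theorem contDiff_argField :
    ContDiff ℝ ∞ fun p : (ℂ × Θ) × Coeffs V => argField p.1 p.2 := by
  have hθ : ContDiff ℝ ∞ fun p : (ℂ × Θ) × Coeffs V => ((0, 0, 0, p.1.2) : ℂ × ℂ × V × Θ) := by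
    fun_prop
  refine (((contDiff_coordField (V := V) (Θ := Θ) _).comp (contDiff_fst.comp contDiff_fst)).add
    (contDiff_compLeft ((valIncl V Θ).compLeftContinuous ℝ Torus ∘L synth solSymbol)
      contDiff_snd)).add (contDiff_compLeft constField hθ)

theorem contDiff_argFieldDeriv (j : Fin 2) :
    ContDiff ℝ ∞ fun p : (ℂ × Θ) × Coeffs V => argFieldDeriv j p.1 p.2 :=
  ((contDiff_coordField (V := V) (Θ := Θ) _).comp (contDiff_fst.comp contDiff_fst)).add
    (contDiff_compLeft ((valIncl V Θ).compLeftContinuous ℝ Torus ∘L synth (solSymbolDeriv j))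
      contDiff_snd)

theorem contDiff_argFieldMixed :
    ContDiff ℝ ∞ fun p : (ℂ × Θ) × Coeffs V => argFieldMixed p.1 p.2 :=
  (contDiff_compLeft (toL2 (X := ℂ × ℂ × V × Θ))
    ((contDiff_coordField (V := V) (Θ := Θ) _).comp (contDiff_fst.comp contDiff_fst))).add
    (contDiff_compLeft (mapL2 (valIncl V Θ) ∘L
      multiplier _ (norm_freqMul_mul_solSymbolDeriv_le 1 0)) contDiff_snd)

theorem contDiff_linField :
    ContDiff ℝ ∞ fun p : (ℂ × Θ) × Coeffs V => linField p.2 :=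
  (contDiff_compLeft ((ContinuousLinearMap.inl ℝ V ℝ).compLeftContinuous ℝ Torus ∘L
    synth (solSymbolDeriv 1)) contDiff_snd).add contDiff_const

theorem contDiff_linFieldDeriv (j : Fin 2) :
    ContDiff ℝ ∞ fun p : (ℂ × Θ) × Coeffs V => linFieldDeriv j p.2 :=
  contDiff_compLeft (mapL2 (.inl ℝ V ℝ) ∘L
    multiplier _ (norm_freqMul_mul_solSymbolDeriv_le j 1)) contDiff_snd

theorem contDiff_linFieldMixed :
    ContDiff ℝ ∞ fun p : (ℂ × Θ) × Coeffs V => linFieldMixed p.2 :=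
  contDiff_compLeft (mapL2 (.inl ℝ V ℝ) ∘L
    multiplier _ (norm_freqMul_mul_freqMul_mul_solSymbolDeriv_le 1)) contDiff_snd

variable [FiniteDimensional ℝ Θ] {Q : ℂ × ℂ × V × Θ → V × ℝ →L[ℝ] V} (hQ : ContDiff ℝ ∞ Q)

/-- The Fourier coefficients of `(1 + ∂₁)(1 + ∂₂) (Q(·, v)(∂₂ v, 1))`. -/
def rhsCoeffs (P : ℂ × Θ) (c : Coeffs V) : Coeffs V :=
  analysis (mixedDeriv hQ (argField P c) (argFieldDeriv 0 P c) (argFieldDeriv 1 P c)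
    (linField c) (argFieldMixed P c) (linFieldDeriv 0 c) (linFieldDeriv 1 c) (linFieldMixed c))

omit [FiniteDimensional ℂ V] [FiniteDimensional ℝ Θ] in
theorem continuous_section {F G : Type} [NormedAddCommGroup F] [NormedSpace ℝ F]
    [NormedAddCommGroup G] [NormedSpace ℝ G] {f : (ℂ × Θ) → F → G}
    (hf : ContDiff ℝ ∞ fun p : (ℂ × Θ) × F => f p.1 p.2) (P : ℂ × Θ) : Continuous (f P) :=
  hf.continuous.comp (Continuous.prodMk_right P)

theorem contDiff_rhsCoeffs :
    ContDiff ℝ ∞ fun p : (ℂ × Θ) × Coeffs V => rhsCoeffs hQ p.1 p.2 :=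
  (analysis (V := V)).contDiff.comp
    (contDiff_mixedDeriv hQ contDiff_argField (contDiff_argFieldDeriv 0) (contDiff_argFieldDeriv 1)
      contDiff_linField contDiff_argFieldMixed (contDiff_linFieldDeriv 0)
      (contDiff_linFieldDeriv 1) contDiff_linFieldMixed)

/-- The function `Q(·, v)(∂₂ v, 1)`. -/
def rhsField (P : ℂ × Θ) (c : Coeffs V) : C(Torus, V) :=
  fieldApply (field₀ hQ (argField P c)) (linField c)

theorem continuous_rhsCoeffs_apply (P : ℂ × Θ) (k : Freq) :
    Continuous fun c : Coeffs V => rhsCoeffs hQ P c k := by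
  have h1 : Continuous fun c : Coeffs V => rhsCoeffs hQ P c :=
    continuous_section (contDiff_rhsCoeffs hQ) P
  have h2 : Continuous fun c : Coeffs V => c k := (lp.evalCLM ℝ (fun _ : Freq => V) 2 k).continuous
  exact h2.comp h1

theorem continuous_rhsField (P : ℂ × Θ) : Continuous fun c : Coeffs V => rhsField hQ P c := by
  have h0 : Continuous fun c : Coeffs V => argField P c :=
    continuous_section (G := C(Torus, ℂ × ℂ × V × Θ)) contDiff_argField P
  have h1 : Continuous fun c : Coeffs V => field₀ hQ (argField P c) :=
    (contDiff_superpose hQ).continuous.comp h0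
  have h2 : Continuous fun c : Coeffs V => linField c :=
    continuous_section (f := fun (_ : ℂ × Θ) (c : Coeffs V) => linField c) contDiff_linField P
  have h3 : Continuous fun c : Coeffs V => fieldApply (field₀ hQ (argField P c)) :=
    (fieldApply (K := Torus) (X := V × ℝ) (Y := V)).continuous.comp h1
  exact h3.clm_apply h2

theorem rhsCoeffs_apply (P : ℂ × Θ) (c : Coeffs V) (k : Freq) :
    rhsCoeffs hQ P c k = weight k • coeff k (rhsField hQ P c) := by
  have hclosed : IsClosed {c | rhsCoeffs hQ P c k = weight k • coeff k (rhsField hQ P c)} :=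
    isClosed_eq (continuous_rhsCoeffs_apply hQ P k)
      (((coeff k).continuous.comp (continuous_rhsField hQ P)).const_smul (weight k))
  refine denseRange_ofFinsupp.induction_on
    (p := fun c => rhsCoeffs hQ P c k = weight k • coeff k (rhsField hQ P c)) c hclosed fun c => ?_
  have hv : ∀ j, HasPartial j (synth solSymbol (ofFinsupp c))
      (synth (solSymbolDeriv j) (ofFinsupp c)) := fun j => by
    rw [synth_ofFinsupp, synth_solSymbolDeriv_ofFinsupp]
    exact hasPartial_trigPoly j _ c
  have hv' : ∀ i j, HasPartial i (synth (solSymbolDeriv j) (ofFinsupp c))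
      (trigPoly (fun k => freqMul i k * solSymbolDeriv j k) c) := fun i j => by
    rw [synth_ofFinsupp]
    exact hasPartial_trigPoly i _ c
  have hw : ∀ j, HasPartial j (argField P (ofFinsupp c)) (argFieldDeriv j P (ofFinsupp c)) :=
    fun j => by
      have := ((hasPartial_coordField j (fun _ => 1) P.1).add ((hv j).clm_comp (valIncl V Θ))).add
        (HasPartial.const j ((0, 0, 0, P.2) : ℂ × ℂ × V × Θ))
      rwa [add_zero] at this
  have hw₁₂ := (hasPartial_coordField (Θ := Θ) 1 (fun i => freqMul 0 (Pi.single i 1) * 1) P.1).add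
    ((hv' 1 0).clm_comp (valIncl V Θ))
  have hy : ∀ j, HasPartial j (linField (ofFinsupp c)) _ := fun j =>
    ((hv' j 1).clm_comp (.inl ℝ V ℝ)).add (HasPartial.const j ((0, 1) : V × ℝ))
  have hy₁₂ := (hasPartial_trigPoly 1 (fun k => freqMul 0 k * solSymbolDeriv 1 k) c).clm_comp
    (.inl ℝ V ℝ)
  simp only [add_zero] at hy
  have key := analysis_mixedDeriv hQ (hw 0) (hw 1) hw₁₂ (hy 0) (hy 1) hy₁₂ k
  rw [rhsCoeffs, argFieldMixed, linFieldDeriv, linFieldDeriv, linFieldMixed]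
  simp only [multiplier_ofFinsupp, mapL2_toL2, ← map_add]
  exact key

end Equation

section Family

set_option maxSynthPendingDepth 4

open UnitAddTorus Filter
open scoped lp

variable {V Θ : Type} [NormedAddCommGroup V] [InnerProductSpace ℂ V] [FiniteDimensional ℂ V]
  [NormedAddCommGroup Θ] [NormedSpace ℝ Θ] [FiniteDimensional ℝ Θ]
  {Q : ℂ × ℂ × V × Θ → V × ℝ →L[ℝ] V} (hQ : ContDiff ℝ ∞ Q)

theorem eq_rhsCoeffs_iff (P : ℂ × Θ) (c : Coeffs V) :
    c = rhsCoeffs hQ P c ↔ rhsField hQ P c = synth weightSymbol c := by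
  have h : ∀ k, weightSymbol k = (weight k)⁻¹ := fun k => by simp [weightSymbol]
  constructor
  · intro hc
    refine eq_of_coeff_eq fun k => ?_
    have hk : c k = weight k • coeff k (rhsField hQ P c) :=
      (congrArg (fun c : Coeffs V => c k) hc).trans (rhsCoeffs_apply hQ P c k)
    rw [coeff_synth, hk, h, inv_smul_smul₀ (weight_ne_zero k)]
  · intro hc
    refine lp.ext (funext fun k => ?_)
    rw [rhsCoeffs_apply, hc, coeff_synth, h, smul_inv_smul₀ (weight_ne_zero k)]

omit [FiniteDimensional ℝ Θ] in
theorem rhsField_apply (P : ℂ × Θ) (c : Coeffs V) (x : Torus) :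
    rhsField hQ P c x = Q (mFourier (Pi.single 0 1) (x + toTorus P.1),
      mFourier (Pi.single 1 1) (x + toTorus P.1), synth solSymbol c x, P.2)
      (synth (solSymbolDeriv 1) c x, 1) := by
  have h1 : argField P c x = (mFourier (Pi.single 0 1) (x + toTorus P.1),
      mFourier (Pi.single 1 1) (x + toTorus P.1), synth solSymbol c x, P.2) := by
    simp [argField, coordField, coordIncl, valIncl, torusCoord_apply]
  have h2 : linField c x = (synth (solSymbolDeriv 1) c x, 1) := by
    simp [linField]
  rw [← h1, ← h2]
  rfl

/-- The Fourier coefficients of a translated function. -/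
def shiftCoeffs (τ : ℂ) : Coeffs V →L[ℂ] Coeffs V :=
  lp.mapCLM 2 (fun k => mFourier k (toTorus τ) • ContinuousLinearMap.id ℂ V) zero_le_one fun k => by
    refine (norm_smul_le _ _).trans ?_
    rw [norm_mFourier_apply, one_mul]
    exact ContinuousLinearMap.norm_id_le

theorem shiftCoeffs_apply (τ : ℂ) (c : Coeffs V) (k : Freq) :
    shiftCoeffs τ c k = mFourier k (toTorus τ) • c k := rfl

theorem norm_shiftCoeffs_le (τ : ℂ) (c : Coeffs V) : ‖shiftCoeffs τ c‖ ≤ ‖c‖ :=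
  (ContinuousLinearMap.le_of_opNorm_le _ (lp.norm_mapCLM_le 2 _ zero_le_one _) c).trans_eq
    (one_mul _)

theorem synth_shiftCoeffs (ν : lp (fun _ : Freq => ℂ) 2) (τ : ℂ) (c : Coeffs V) :
    synth ν (shiftCoeffs τ c) = torusShift (toTorus τ) (synth ν c) :=
  eq_of_coeff_eq fun k => by
    rw [coeff_synth, coeff_torusShift, coeff_synth, shiftCoeffs_apply, smul_comm]

theorem shiftCoeffs_eq_rhsCoeffs {τ : ℂ} {θ : Θ} {c : Coeffs V} (h : c = rhsCoeffs hQ (0, θ) c) :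
    shiftCoeffs τ c = rhsCoeffs hQ (τ, θ) (shiftCoeffs τ c) := by
  rw [eq_rhsCoeffs_iff] at h ⊢
  ext x
  have := DFunLike.congr_fun h (x + toTorus τ)
  simpa only [rhsField_apply, synth_shiftCoeffs, torusShift_apply, toTorus_zero, add_zero]
    using this

theorem eq_rhsCoeffs_zero {P : ℂ × Θ} (h : ∀ ζ ζ' x, Q (ζ, ζ', x, P.2) = 0) (c : Coeffs V) :
    rhsCoeffs hQ P c = 0 := by
  refine lp.ext (funext fun k => ?_)
  have h0 : rhsField hQ P c = 0 := by
    ext x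
    rw [rhsField_apply, h]
    rfl
  rw [rhsCoeffs_apply, h0, map_zero, smul_zero]
  rfl

theorem synth_solSymbolDeriv_add (c : Coeffs V) :
    synth (solSymbolDeriv 0) c + I • synth (solSymbolDeriv 1) c + Real.pi • synth solSymbol c =
      synth weightSymbol c :=
  eq_of_coeff_eq fun k => by
    rw [map_add, map_add, coeff_smul, map_smul, coeff_synth, coeff_synth, coeff_synth, coeff_synth,
      ← solSymbolDeriv_add, ← coe_smul Real.pi, smul_smul, smul_smul, add_smul, add_smul]

/-- Solutions `v` of `∂ₛ v + i ∂ₜ v + π v = Q(e^{2πis}, e^{2πit}, v, θ)(∂ₜ v, 1)` depending smoothly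
on a parameter `θ`, near a parameter for which the right-hand side vanishes identically. -/
theorem exists_periodic_family (hQ : ContDiff ℝ ∞ Q) {Z : Set Θ}
    (hZ : ∀ θ ∈ Z, ∀ ζ ζ' x, Q (ζ, ζ', x, θ) = 0) {θ₀ : Θ} (hθ₀ : θ₀ ∈ Z) :
    ∃ v : ℂ × Θ → V, (∀ᶠ P in 𝓝 (0, θ₀), ContDiffAt ℝ ∞ v P) ∧
      (∀ᶠ P in 𝓝 (0, θ₀), fderiv ℝ v P (1, 0) + I • fderiv ℝ v P (I, 0) + Real.pi • v P =
        Q (exp (2 * Real.pi * I * P.1.re), exp (2 * Real.pi * I * P.1.im), v P, P.2)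
          (fderiv ℝ v P (I, 0), 1)) ∧
      ∀ᶠ P in 𝓝 (0, θ₀), P.2 ∈ Z → v P = 0 := by
  have hsm : ContDiff ℝ ∞ fun p : (ℂ × Θ) × Coeffs V => p.2 - rhsCoeffs hQ p.1 p.2 :=
    contDiff_snd.sub (contDiff_rhsCoeffs hQ)
  obtain ⟨Ψ, hΨ₀, hΨs, hΨ⟩ := exists_smooth_solution (e₀ := ((0, θ₀) : ℂ × Θ))
    (x₀ := (0 : Coeffs V)) (.of_forall fun p => hsm.contDiffAt)
    (.of_forall fun c => by
      rw [eq_rhsCoeffs_zero hQ (P := (0, θ₀)) (hZ θ₀ hθ₀)])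
  simp only [sub_eq_zero] at hΨ
  have hΨc : Tendsto Ψ (𝓝 (0, θ₀)) (𝓝 0) := by
    have := hΨs.self_of_nhds.continuousAt
    rwa [ContinuousAt, hΨ₀] at this
  -- the solution is a fixed point
  have hfix : ∀ᶠ P in 𝓝 ((0, θ₀) : ℂ × Θ), Ψ P = rhsCoeffs hQ P (Ψ P) := by
    filter_upwards [(tendsto_id.prodMk_nhds hΨc).eventually hΨ] with P hP
    exact hP.2 rfl
  have hproj : Tendsto (fun P : ℂ × Θ => ((0, P.2) : ℂ × Θ)) (𝓝 (0, θ₀)) (𝓝 (0, θ₀)) :=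
    Continuous.tendsto' (by fun_prop) _ _ rfl
  have hshift : ∀ᶠ P in 𝓝 ((0, θ₀) : ℂ × Θ), Ψ P = shiftCoeffs P.1 (Ψ (0, P.2)) := by
    have hlim : Tendsto (fun P : ℂ × Θ => shiftCoeffs P.1 (Ψ (0, P.2))) (𝓝 (0, θ₀)) (𝓝 0) :=
      squeeze_zero_norm (fun P => norm_shiftCoeffs_le P.1 _)
        (tendsto_zero_iff_norm_tendsto_zero.1 (hΨc.comp hproj))
    filter_upwards [(tendsto_id.prodMk_nhds hlim).eventually hΨ, hproj.eventually hfix] with P h1 h2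
    exact h1.1 (shiftCoeffs_eq_rhsCoeffs hQ h2)
  have hderiv : ∀ᶠ P in 𝓝 ((0, θ₀) : ℂ × Θ), ∀ (j : Fin 2) (k : Freq),
      fderiv ℝ Ψ P (direction j, 0) k = freqMul j k • Ψ P k := by
    filter_upwards [hshift.eventually_nhds, hΨs] with P h1 h2 j k
    have h3 : HasDerivAt (fun r : ℝ => Ψ (P + r • ((direction j, 0) : ℂ × Θ)))
        (fderiv ℝ Ψ P (direction j, 0)) 0 :=
      (h2.differentiableAt (by simp)).hasFDerivAt.hasLineDerivAt _
    have h4 : HasDerivAt (fun r : ℝ => Ψ (P + r • ((direction j, 0) : ℂ × Θ)) k)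
        (fderiv ℝ Ψ P (direction j, 0) k) 0 :=
      (lp.evalCLM ℝ (fun _ : Freq => V) 2 k).hasFDerivAt.comp_hasDerivAt _ h3
    refine h4.unique (((hasDerivAt_mFourier j k).smul_const (Ψ P k)).congr_of_eventuallyEq ?_)
    have h5 : Tendsto (fun r : ℝ => P + r • ((direction j, 0) : ℂ × Θ)) (𝓝 0) (𝓝 P) :=
      Continuous.tendsto' (by fun_prop) _ _ (by simp)
    filter_upwards [h5.eventually h1] with r hr
    rw [hr, h1.self_of_nhds, shiftCoeffs_apply, shiftCoeffs_apply, smul_smul,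
      ← mFourier_add_apply, ← toTorus_add, add_comm]
    simp
  set L : Coeffs V →L[ℝ] V := ContinuousMap.evalCLM ℝ (0 : Torus) ∘L synth solSymbol with hL
  have hLderiv : ∀ᶠ P in 𝓝 ((0, θ₀) : ℂ × Θ), ∀ j : Fin 2,
      fderiv ℝ (fun P => L (Ψ P)) P (direction j, 0) = synth (solSymbolDeriv j) (Ψ P) 0 := by
    filter_upwards [hderiv, hΨs] with P h1 h2 j
    have h3 := L.hasFDerivAt.comp P (h2.differentiableAt (by simp)).hasFDerivAt
    have h4 : synth solSymbol (fderiv ℝ Ψ P (direction j, 0)) = synth (solSymbolDeriv j) (Ψ P) :=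
      eq_of_coeff_eq fun k => by
        rw [coeff_synth, coeff_synth, h1, solSymbolDeriv_apply, smul_smul, mul_comm]
    rw [← h4]
    exact DFunLike.congr_fun h3.fderiv _
  refine ⟨fun P => L (Ψ P), ?_, ?_, ?_⟩
  · filter_upwards [hΨs] with P h
    exact L.contDiff.contDiffAt.comp P h
  · filter_upwards [hLderiv, hfix] with P h1 h2
    have h10 : fderiv ℝ (fun P => L (Ψ P)) P (1, 0) = synth (solSymbolDeriv 0) (Ψ P) 0 := h1 0
    have h11 : fderiv ℝ (fun P => L (Ψ P)) P (I, 0) = synth (solSymbolDeriv 1) (Ψ P) 0 := h1 1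
    have h3 := DFunLike.congr_fun (synth_solSymbolDeriv_add (Ψ P)) 0
    rw [← (eq_rhsCoeffs_iff hQ P (Ψ P)).1 h2, rhsField_apply, zero_add, mFourier_toTorus,
      mFourier_toTorus] at h3
    have h4 : L (Ψ P) = synth solSymbol (Ψ P) 0 := rfl
    rw [h10, h11, h4]
    simpa using h3
  · filter_upwards [hfix] with P h hP
    rw [h, eq_rhsCoeffs_zero hQ (hZ _ hP), map_zero]

end Family

section Trivialization

/-- A complex structure on a finite-dimensional real vector space is linearly conjugate to the
standard one. -/
theorem exists_equiv_euclideanSpace {E : Type*} [NormedAddCommGroup E] [NormedSpace ℝ E]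
    [FiniteDimensional ℝ E] (j : E →L[ℝ] E) (hj : ∀ v, j (j v) = -v) :
    ∃ (d : ℕ) (Φ : E ≃L[ℝ] EuclideanSpace ℂ (Fin d)), ∀ v, Φ (j v) = I • Φ v := by
  let φ : ℂ →ₐ[ℝ] Module.End ℝ E := Complex.lift ⟨(j : E →ₗ[ℝ] E), by
    ext v
    simp [hj]⟩
  let : Module ℂ E := Module.compHom E φ.toRingHom
  have hsmul : ∀ (z : ℂ) (v : E), z • v = φ z v := fun _ _ => rfl
  have : IsScalarTower ℝ ℂ E := ⟨fun r z v => by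
    rw [hsmul, hsmul, map_smul, LinearMap.smul_apply]⟩
  have : FiniteDimensional ℂ E := Module.Finite.of_restrictScalars_finite ℝ ℂ E
  let e : E ≃ₗ[ℂ] EuclideanSpace ℂ (Fin (Module.finrank ℂ E)) :=
    (Module.finBasis ℂ E).equivFun.trans (WithLp.linearEquiv 2 ℂ _).symm
  refine ⟨_, (e.restrictScalars ℝ).toContinuousLinearEquiv, fun v => ?_⟩
  have h : j v = I • v := by
    rw [hsmul]
    simp [φ]
  rw [h]
  exact e.map_smul I v

end Trivialization

section Cutoff

/-- A globally smooth function which is an inverse of `s ↦ e^{2πis}` near `0`. -/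
theorem exists_smooth_angle : ∃ σ : ℂ → ℝ, ContDiff ℝ ∞ σ ∧
    ∀ᶠ s : ℝ in 𝓝 0, σ (exp (2 * Real.pi * I * s)) = s := by
  let χ : ContDiffBump (1 : ℂ) := ⟨1 / 4, 1 / 2, by norm_num, by norm_num⟩
  refine ⟨fun ζ => χ ζ * ((log ζ).im / (2 * Real.pi)), ?_, ?_⟩
  · refine contDiff_iff_contDiffAt.2 fun ζ => ?_
    by_cases hζ : ζ ∈ closedBall (1 : ℂ) (1 / 2)
    · have hslit : ζ ∈ slitPlane := by
        refine mem_slitPlane_iff.2 (Or.inl ?_)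
        have := (abs_re_le_norm (ζ - 1)).trans (mem_closedBall_iff_norm.1 hζ)
        rw [sub_re, one_re, abs_le] at this
        linarith
      have hlog : ContDiffAt ℝ ∞ log ζ := (contDiffAt_log hslit).restrict_scalars ℝ
      exact χ.contDiffAt.mul ((imCLM.contDiff.contDiffAt.comp ζ hlog).div_const _)
    · have hopen := isClosed_closedBall.isOpen_compl.mem_nhds hζ
      refine (contDiffAt_const (c := (0 : ℝ))).congr_of_eventuallyEq ?_
      filter_upwards [hopen] with y hy
      rw [χ.zero_of_le_dist (not_le.1 fun h => hy (mem_closedBall.2 h)).le, zero_mul]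
  · have h1 : Filter.Tendsto (fun s : ℝ => exp (2 * Real.pi * I * s)) (𝓝 0) (𝓝 1) :=
      Continuous.tendsto' (by fun_prop) _ _ (by simp)
    filter_upwards [h1.eventually χ.eventuallyEq_one,
      Ioo_mem_nhds (a := (-1 / 2 : ℝ)) (b := 1 / 2)
      (by norm_num) (by norm_num)] with s h2 h3
    have h4 : 2 * Real.pi * I * (s : ℂ) = ((2 * Real.pi * s : ℝ) : ℂ) * I := by
      push_cast
      ring
    have h5 : (log (exp (2 * Real.pi * I * s))).im = 2 * Real.pi * s := by
      rw [h4, log_exp] <;> simp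
      · nlinarith [Real.pi_pos, h3.1]
      · nlinarith [Real.pi_pos, h3.2]
    rw [h2, h5]
    simp [Real.pi_ne_zero]

end Cutoff

section LocalCurve

set_option maxSynthPendingDepth 4

open Filter

variable {V : Type} [NormedAddCommGroup V] [InnerProductSpace ℂ V] [FiniteDimensional ℂ V]

/-- The curve `z ↦ a + z b + e^{π s} v(z)`, where `s` is the real part of `z`. -/
def ansatz (a b : V) (v : ℂ → V) (z : ℂ) : V := a + z • b + Real.exp (Real.pi * z.re) • v z

omit [FiniteDimensional ℂ V] in
theorem contDiffAt_ansatz (a b : V) {v : ℂ → V} {z : ℂ} (hv : ContDiffAt ℝ ∞ v z) :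
    ContDiffAt ℝ ∞ (ansatz a b v) z := by
  have hre : ContDiff ℝ ∞ fun z : ℂ => z.re := reCLM.contDiff
  exact (contDiffAt_const.add (contDiffAt_id.smul contDiffAt_const)).add
    ((contDiff_const.mul hre).exp.contDiffAt.smul hv)

omit [FiniteDimensional ℂ V] in
theorem fderiv_ansatz (a b : V) {v : ℂ → V} {z : ℂ} (hv : DifferentiableAt ℝ v z) (w : ℂ) :
    fderiv ℝ (ansatz a b v) z w = w • b + Real.exp (Real.pi * z.re) • fderiv ℝ v z w +
      (Real.exp (Real.pi * z.re) * (Real.pi * w.re)) • v z := by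
  have h1 : HasFDerivAt (fun z : ℂ => Real.exp (Real.pi * z.re))
      (Real.exp (Real.pi * z.re) • (Real.pi • reCLM)) z :=
    (reCLM.hasFDerivAt.const_mul Real.pi).exp
  have h2 : HasFDerivAt (fun z : ℂ => z • b)
      (((ContinuousLinearMap.toSpanSingleton ℂ b).restrictScalars ℝ : ℂ →L[ℝ] V)) z :=
    ((ContinuousLinearMap.toSpanSingleton ℂ b).restrictScalars ℝ : ℂ →L[ℝ] V).hasFDerivAt
  have h3 := (h2.const_add a).add (h1.smul hv.hasFDerivAt)
  change fderiv ℝ ((fun x => a + x • b) + (fun z : ℂ => Real.exp (Real.pi * z.re)) • v) z w = _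
  rw [h3.fderiv]
  simp [add_assoc, mul_smul]

/-- The nonlinearity of the equation satisfied by `v`, if `δ • ansatz a b v` solves
`∂ₛ U + i ∂ₜ U = - q(U) ∂ₜ U`. -/
def rescaledField (σ : ℂ → ℝ) (q : V → V →L[ℝ] V) (P : ℂ × ℂ × V × ℝ × V × V) : V × ℝ →L[ℝ] V :=
  let s := σ P.1
  let t := σ P.2.1
  let a := P.2.2.2.2.1
  let b := P.2.2.2.2.2
  let U := a + ((s : ℂ) + t * I) • b + Real.exp (Real.pi * s) • P.2.2.1
  Real.exp (-(Real.pi * s)) • -(q (P.2.2.2.1 • U) ∘L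
    (Real.exp (Real.pi * s) • .fst ℝ V ℝ + (ContinuousLinearMap.snd ℝ V ℝ).smulRight (I • b)))

omit [FiniteDimensional ℂ V] in
theorem contDiff_rescaledField {σ : ℂ → ℝ} (hσ : ContDiff ℝ ∞ σ) {q : V → V →L[ℝ] V}
    (hq : ContDiff ℝ ∞ q) : ContDiff ℝ ∞ (rescaledField σ q) := by
  have hs : ContDiff ℝ ∞ fun P : ℂ × ℂ × V × ℝ × V × V => σ P.1 := hσ.comp contDiff_fst
  have ht : ContDiff ℝ ∞ fun P : ℂ × ℂ × V × ℝ × V × V => σ P.2.1 :=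
    hσ.comp (contDiff_fst.comp contDiff_snd)
  have hsc : ContDiff ℝ ∞ fun P : ℂ × ℂ × V × ℝ × V × V => ((σ P.1 : ℝ) : ℂ) :=
    ofRealCLM.contDiff.comp hs
  have htc : ContDiff ℝ ∞ fun P : ℂ × ℂ × V × ℝ × V × V => ((σ P.2.1 : ℝ) : ℂ) :=
    ofRealCLM.contDiff.comp ht
  have hb : ContDiff ℝ ∞ fun P : ℂ × ℂ × V × ℝ × V × V => P.2.2.2.2.2 := by fun_prop
  have ha : ContDiff ℝ ∞ fun P : ℂ × ℂ × V × ℝ × V × V => P.2.2.2.2.1 := by fun_prop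
  have hδ : ContDiff ℝ ∞ fun P : ℂ × ℂ × V × ℝ × V × V => P.2.2.2.1 := by fun_prop
  have hx : ContDiff ℝ ∞ fun P : ℂ × ℂ × V × ℝ × V × V => P.2.2.1 := by fun_prop
  have he : ContDiff ℝ ∞ fun P : ℂ × ℂ × V × ℝ × V × V => Real.exp (Real.pi * σ P.1) :=
    (contDiff_const.mul hs).exp
  have hU := hδ.smul ((ha.add ((hsc.add (htc.mul (contDiff_const (c := I)))).smul hb)).add
    (he.smul hx))
  have hL : ContDiff ℝ ∞ fun P : ℂ × ℂ × V × ℝ × V × V => Real.exp (Real.pi * σ P.1) •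
      ContinuousLinearMap.fst ℝ V ℝ +
        (ContinuousLinearMap.snd ℝ V ℝ).smulRight (I • P.2.2.2.2.2) :=
    (he.smul contDiff_const).add (contDiff_const.smulRight (contDiff_const.smul hb))
  exact (contDiff_const.mul hs).neg.exp.smul ((hq.comp hU).clm_comp hL).neg

/-- Solutions of `∂ₛ U + i ∂ₜ U = - q(δ U) ∂ₜ U` for some small `δ`, with prescribed derivative. -/
theorem exists_rescaled_curve {q : V → V →L[ℝ] V} (hq : ContDiff ℝ ∞ q) (hq0 : q 0 = 0) (X : V) :
    ∃ δ > 0, ∃ r > 0, ∃ U : ℂ → V, ContDiffOn ℝ ∞ U (ball 0 r) ∧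
      (∀ z ∈ ball 0 r, fderiv ℝ U z 1 + I • fderiv ℝ U z I = -q ((δ : ℝ) • U z) (fderiv ℝ U z I)) ∧
      U 0 = 0 ∧ fderiv ℝ U 0 1 = X := by
  obtain ⟨σ, hσ, hσ0⟩ := exists_smooth_angle
  obtain ⟨v, hv, heq, hv0⟩ := exists_periodic_family (contDiff_rescaledField hσ hq)
    (Z := {θ : ℝ × V × V | θ.1 = 0}) (θ₀ := (0, 0, X))
    (fun θ (hθ : θ.1 = 0) ζ ζ' x => by
      ext y <;> simp [rescaledField, hθ, hq0]) rfl
  -- adjust the parameters in order to meet the initial conditions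
  let g : ℝ × V × V → V × V := fun θ =>
    (θ.2.1 + v (0, θ), θ.2.2 + (Real.pi • v (0, θ) + fderiv ℝ v (0, θ) (1, 0)) - X)
  have hincl : Tendsto (fun θ : ℝ × V × V => ((0, θ) : ℂ × ℝ × V × V)) (𝓝 (0, 0, X))
      (𝓝 (0, 0, 0, X)) := Continuous.tendsto' (by fun_prop) _ _ rfl
  have hg : ∀ᶠ θ in 𝓝 ((0, 0, X) : ℝ × V × V), ContDiffAt ℝ ∞ g θ := by
    filter_upwards [hincl.eventually hv] with θ h
    have hi : ContDiffAt ℝ ∞ (fun θ : ℝ × V × V => ((0, θ) : ℂ × ℝ × V × V)) θ := by fun_prop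
    have h1 : ContDiffAt ℝ ∞ (fun θ => v (0, θ)) θ := h.comp θ hi
    have h2 : ContDiffAt ℝ ∞ (fun θ => fderiv ℝ v (0, θ)) θ :=
      (h.fderiv_right (m := ∞) (by norm_num)).comp θ hi
    have h3 : ContDiffAt ℝ ∞ (fun θ : ℝ × V × V => θ.2.1) θ := by fun_prop
    have h4 : ContDiffAt ℝ ∞ (fun θ : ℝ × V × V => θ.2.2) θ := by fun_prop
    exact (h3.add h1).prodMk ((h4.add ((h1.const_smul Real.pi).add
      (h2.clm_apply contDiffAt_const))).sub contDiffAt_const)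
  have hbase : ∀ᶠ x in 𝓝 ((0, X) : V × V), g (0, x) = x - (0, X) := by
    have hi : Tendsto (fun x : V × V => ((0, 0, x) : ℂ × ℝ × V × V)) (𝓝 (0, X))
        (𝓝 (0, 0, 0, X)) := Continuous.tendsto' (by fun_prop) _ _ rfl
    filter_upwards [hi.eventually hv0.eventually_nhds, hi.eventually hv] with x h1 h2
    have h3 : HasDerivAt (fun r : ℝ => v ((0, 0, x) + r • (1, 0)))
        (fderiv ℝ v (0, 0, x) (1, 0)) 0 :=
      (h2.differentiableAt (by simp)).hasFDerivAt.hasLineDerivAt _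
    have h4 : fderiv ℝ v (0, 0, x) (1, 0) = 0 := by
      refine h3.unique ((hasDerivAt_const 0 0).congr_of_eventuallyEq ?_)
      have h5 : Tendsto (fun r : ℝ => ((0, 0, x) : ℂ × ℝ × V × V) + r • (1, 0)) (𝓝 0)
          (𝓝 (0, 0, x)) := Continuous.tendsto' (by fun_prop) _ _ (by simp)
      filter_upwards [h5.eventually h1] with r hr
      exact hr (by simp)
    simp [g, h4, h1.self_of_nhds rfl, Prod.ext_iff]
  obtain ⟨ψ, hψ0, hψs, hψ⟩ := exists_smooth_solution hg hbase
  have hψc : Tendsto (fun δ => ((δ, ψ δ) : ℝ × V × V)) (𝓝 0) (𝓝 (0, 0, X)) := by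
    refine tendsto_id.prodMk_nhds ?_
    have := hψs.self_of_nhds.continuousAt
    rwa [ContinuousAt, hψ0] at this
  have hgood := (hincl.comp hψc).eventually (hv.and heq).eventually_nhds
  obtain ⟨δ, ⟨hδgood, hδψ⟩, hδ⟩ := (((hgood.and (hψc.eventually hψ)).filter_mono
    nhdsWithin_le_nhds).and (self_mem_nhdsWithin (s := Set.Ioi (0 : ℝ)))).exists
  set θ : ℝ × V × V := (δ, ψ δ)
  have hgθ : (θ.2.1 + v (0, θ), θ.2.2 + (Real.pi • v (0, θ) + fderiv ℝ v (0, θ) (1, 0)) - X) =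
    (0 : V × V) := hδψ.2 rfl
  rw [Prod.mk_eq_zero] at hgθ
  have hd {z : ℂ} (h : ContDiffAt ℝ ∞ v (z, θ)) (w : ℂ) :
      fderiv ℝ (fun z => v (z, θ)) z w = fderiv ℝ v (z, θ) (w, 0) := by
    have h1 := (h.differentiableAt (by simp)).hasFDerivAt.comp z
      (hasFDerivAt_prodMk_left (𝕜 := ℝ) z θ)
    rw [show (fun z => v (z, θ)) = v ∘ fun z => (z, θ) from rfl, h1.fderiv]
    simp
  have hs {z : ℂ} (h : ContDiffAt ℝ ∞ v (z, θ)) : ContDiffAt ℝ ∞ (fun z => v (z, θ)) z :=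
    h.comp (f := fun z => (z, θ)) z (by fun_prop)
  have hslice : Tendsto (fun z : ℂ => (z, θ)) (𝓝 0) (𝓝 (0, θ)) :=
    Continuous.tendsto' (by fun_prop) _ _ rfl
  have hre : Tendsto (fun z : ℂ => z.re) (𝓝 0) (𝓝 0) := continuous_re.tendsto' _ _ rfl
  have him : Tendsto (fun z : ℂ => z.im) (𝓝 0) (𝓝 0) := continuous_im.tendsto' _ _ rfl
  obtain ⟨r, hr, hball⟩ := Metric.eventually_nhds_iff_ball.1
    ((hslice.eventually hδgood).and ((hre.eventually hσ0).and (him.eventually hσ0)))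
  have hd0 := (hball 0 (mem_ball_self hr)).1.1
  refine ⟨δ, hδ, r, hr, ansatz θ.2.1 θ.2.2 fun z => v (z, θ), fun z hz =>
    (contDiffAt_ansatz _ _ (hs (hball z hz).1.1)).contDiffWithinAt, fun z hz => ?_, ?_, ?_⟩
  · obtain ⟨⟨h1, h2⟩, h3, h4⟩ := hball z hz
    have h5 := (hs h1).differentiableAt (by simp)
    rw [fderiv_ansatz _ _ h5, fderiv_ansatz _ _ h5, hd h1, hd h1]
    dsimp only [rescaledField] at h2
    rw [h3, h4, re_add_im, show θ.2.1 + z • θ.2.2 + Real.exp (Real.pi * z.re) • v (z, θ) =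
      ansatz θ.2.1 θ.2.2 (fun z => v (z, θ)) z from rfl] at h2
    have h6 := congrArg (Real.exp (Real.pi * z.re) • ·) h2
    simp only [smul_apply, smul_smul, ← Real.exp_add, add_neg_cancel,
      Real.exp_zero, one_smul] at h6
    have h7 : ∀ y : V, I • I • y = -y := fun y => by rw [smul_smul, I_mul_I, neg_one_smul]
    have h8 : Real.exp (Real.pi * z.re) • fderiv ℝ v (z, θ) (I, 0) + I • θ.2.2 =
      I • θ.2.2 + Real.exp (Real.pi * z.re) • fderiv ℝ v (z, θ) (I, 0) +
        (Real.exp (Real.pi * z.re) * (Real.pi * I.re)) • v (z, θ) := by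
      simp [add_comm]
    rw [← h8]
    convert h6 using 1
    · simp only [smul_add, h7, one_re, one_smul, mul_one, mul_smul,
        smul_comm I (Real.exp (Real.pi * z.re))]
      abel
    · simp [θ]
  · simpa [ansatz] using hgθ.1
  · rw [fderiv_ansatz _ _ ((hs hd0).differentiableAt (by simp)), hd hd0]
    have := sub_eq_zero.1 hgθ.2
    rw [← this]
    simp only [one_smul, zero_re, mul_zero, Real.exp_zero, one_re, mul_one, one_mul]
    abel

end LocalCurve

section Rescaling

variable {V E : Type*} [NormedAddCommGroup V] [NormedSpace ℝ V] [NormedAddCommGroup E]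
  [NormedSpace ℝ E]

/-- Smoothness and derivative of the rescaled map `z ↦ p + Ψ(δ U(z / δ))`. -/
theorem smooth_rescale (p : E) (Ψ : V →L[ℝ] E) {U : ℂ → V} {r δ : ℝ} (hδ : 0 < δ)
    (hU : ContDiffOn ℝ ∞ U (ball 0 r)) :
    ContDiffOn ℝ ∞ (fun z => p + Ψ (δ • U (δ⁻¹ • z))) (ball 0 (δ * r)) ∧
      ∀ z ∈ ball (0 : ℂ) (δ * r), δ⁻¹ • z ∈ ball (0 : ℂ) r ∧
        ∀ w, fderiv ℝ (fun z => p + Ψ (δ • U (δ⁻¹ • z))) z w =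
          Ψ (fderiv ℝ U (δ⁻¹ • z) w) := by
  have hmem {z : ℂ} (hz : z ∈ ball (0 : ℂ) (δ * r)) : δ⁻¹ • z ∈ ball (0 : ℂ) r := by
    rw [mem_ball_zero_iff] at hz ⊢
    rw [norm_smul, norm_inv, Real.norm_of_nonneg hδ.le, inv_mul_lt_iff₀ hδ]
    exact hz
  have hscale : ContDiff ℝ ∞ fun z : ℂ => δ⁻¹ • z := contDiff_const_smul δ⁻¹
  have hcomp : ContDiffOn ℝ ∞ (fun z => U (δ⁻¹ • z)) (ball 0 (δ * r)) :=
    hU.comp hscale.contDiffOn fun z hz => hmem hz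
  refine ⟨contDiffOn_const.add (Ψ.contDiff.comp_contDiffOn (contDiffOn_const.smul hcomp)),
    fun z hz => ⟨hmem hz, fun w => ?_⟩⟩
  have h1 : HasFDerivAt U (fderiv ℝ U (δ⁻¹ • z)) (δ⁻¹ • z) :=
    ((hU.contDiffAt (isOpen_ball.mem_nhds (hmem hz))).differentiableAt (by simp)).hasFDerivAt
  have h2 : HasFDerivAt (fun z : ℂ => δ⁻¹ • z) (δ⁻¹ • .id ℝ ℂ) z :=
    (hasFDerivAt_id z).const_smul δ⁻¹
  have h3 : HasFDerivAt (fun z => p + Ψ (δ • U (δ⁻¹ • z)))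
      (Ψ ∘L (δ • (fderiv ℝ U (δ⁻¹ • z) ∘L (δ⁻¹ • .id ℝ ℂ)))) z :=
    (Ψ.hasFDerivAt.comp z ((h1.comp z h2).const_smul δ)).const_add p
  rw [h3.fderiv]
  simp [hδ.ne']

end Rescaling

end

/-- **Local existence of pseudoholomorphic curves.**  Let `J` be an almost complex
structure on `ℂⁿ`.  For every `p ∈ ℂⁿ` and `X ∈ ℂⁿ` there exist `ε > 0` and a smooth
`J`-holomorphic map `u : B_ε → ℂⁿ` with `u(0) = p` and `∂ₛu(0) = X`. -/
theorem local_existence_pseudoholomorphic (n : ℕ)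
    (J : EuclideanSpace ℂ (Fin n) →
      (EuclideanSpace ℂ (Fin n) →L[ℝ] EuclideanSpace ℂ (Fin n)))
    (hJsmooth : ContDiff ℝ (⊤ : ℕ∞) J)
    (hJsq : ∀ x v, J x (J x v) = -v)
    (p X : EuclideanSpace ℂ (Fin n)) :
    ∃ ε : ℝ, 0 < ε ∧ ∃ u : ℂ → EuclideanSpace ℂ (Fin n),
      ContDiffOn ℝ (⊤ : ℕ∞) u (ball 0 ε) ∧
      (∀ z ∈ ball (0 : ℂ) ε,
        fderiv ℝ u z 1 + J (u z) (fderiv ℝ u z Complex.I) = 0) ∧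
      u 0 = p ∧ fderiv ℝ u 0 1 = X := by
  obtain ⟨d, Φ, hΦ⟩ := exists_equiv_euclideanSpace (J p) (hJsq p)
  let Φ' : EuclideanSpace ℂ (Fin n) →L[ℝ] EuclideanSpace ℂ (Fin d) := Φ
  let Ψ : EuclideanSpace ℂ (Fin d) →L[ℝ] EuclideanSpace ℂ (Fin n) := Φ.symm
  let q (x : EuclideanSpace ℂ (Fin d)) : EuclideanSpace ℂ (Fin d) →L[ℝ] EuclideanSpace ℂ (Fin d) :=
    Φ' ∘L (J (p + Ψ x) ∘L Ψ) - I • .id ℝ _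
  have hq : ContDiff ℝ (⊤ : ℕ∞) q := by
    have h1 : ContDiff ℝ (⊤ : ℕ∞) fun x => J (p + Ψ x) :=
      hJsmooth.comp (contDiff_const.add Ψ.contDiff)
    exact (contDiff_const.clm_comp (h1.clm_comp contDiff_const)).sub contDiff_const
  have hqJ (x y) : q x y = Φ (J (p + Ψ x) (Ψ y)) - I • y := rfl
  have hq0 : q 0 = 0 := by
    ext1 y
    rw [hqJ, map_zero, add_zero, hΦ, show Φ (Ψ y) = y from Φ.apply_symm_apply y, sub_self]
    rfl
  obtain ⟨δ, hδ, r, hr, U, hU, heq, hU0, hUX⟩ := exists_rescaled_curve hq hq0 (Φ X)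
  obtain ⟨hu, hder⟩ := smooth_rescale p Ψ hδ hU
  refine ⟨δ * r, mul_pos hδ hr, fun z => p + Ψ (δ • U (δ⁻¹ • z)), hu, fun z hz => ?_, ?_, ?_⟩
  · obtain ⟨hmem, hz⟩ := hder z hz
    have h1 := heq _ hmem
    rw [hqJ, neg_sub, eq_sub_iff_add_eq, add_right_comm, add_eq_right] at h1
    rw [hz, hz]
    apply Φ.injective
    rw [map_add, map_zero, show Φ (Ψ _) = _ from Φ.apply_symm_apply _]
    exact h1
  · simp only [smul_zero, hU0, map_zero, add_zero]
  · rw [(hder 0 (mem_ball_self (mul_pos hδ hr))).2, smul_zero, hUX]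
    exact Φ.symm_apply_apply X
end

section
/- Elliptic regularity for pseudoholomorphic curves: Let J be an almost complex structure on ℂⁿ and U ⊆ ℂ an open set. Every map u : U → ℂⁿ of class C¹ satisfying the nonlinear Cauchy–Riemann equation ∂ₛu(z) + J(u(z)) ∂ₜu(z) = 0 for all z ∈ U is smooth, i.e. of class C^∞ on U. -/
open Metric Complex

/-- The Cauchy–Riemann operator `∂ₛ + i ∂ₜ`. -/
noncomputable def cauchyRiemannOp (g : ℂ → ℂ) (z : ℂ) : ℂ :=
  fderiv ℝ g z 1 + I * fderiv ℝ g z I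

open MeasureTheory Set in
theorem cauchy_pompeiu_zero {g : ℂ → ℂ} (hg : ContDiff ℝ 1 g) (hc : HasCompactSupport g) :
    ∫ w, cauchyRiemannOp g w / w = -(2 * Real.pi) * g 0 := by
  unfold cauchyRiemannOp
  obtain ⟨M, hM⟩ : ∃ M, ∀ w, M < ‖w‖ → fderiv ℝ g w = 0 := by
    obtain ⟨M, hM⟩ := (hc.fderiv (𝕜 := ℝ)).isCompact.isBounded.exists_norm_le
    refine ⟨M, fun w hw => ?_⟩
    by_contra h
    exact absurd (hM w (subset_tsupport _ h)) (not_le.2 hw)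
  have hd : ∀ w, HasFDerivAt g (fderiv ℝ g w) w :=
    fun w => (hg.differentiable one_ne_zero w).hasFDerivAt
  have hcont : Continuous (fderiv ℝ g) := hg.continuous_fderiv one_ne_zero
  set e : ℝ → ℂ := fun θ => Real.cos θ + Real.sin θ * I with he
  have hecont : Continuous e := by fun_prop
  have hnorm : ∀ θ, ‖e θ‖ = 1 := by
    intro θ
    simp only [he, Complex.ofReal_cos, Complex.ofReal_sin, ← Complex.exp_mul_I]
    exact Complex.norm_exp_ofReal_mul_I θ
  have hint : ∀ f : ℝ → ℂ, Continuous f → IntegrableOn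
      (fun p : ℝ × ℝ => fderiv ℝ g (p.1 * e p.2) (f p.2)) (Ioi 0 ×ˢ Ioo (-Real.pi) Real.pi)
      (volume.prod volume) := by
    intro f hf
    have hcts : Continuous (fun p : ℝ × ℝ => fderiv ℝ g (p.1 * e p.2) (f p.2)) := by
      have h1 : Continuous (fun p : ℝ × ℝ => fderiv ℝ g (p.1 * e p.2)) :=
        hcont.comp (by fun_prop)
      exact h1.clm_apply (by fun_prop)
    have hK : IntegrableOn (fun p : ℝ × ℝ => fderiv ℝ g (p.1 * e p.2) (f p.2))
        (Icc 0 M ×ˢ Icc (-Real.pi) Real.pi) (volume.prod volume) :=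
      hcts.continuousOn.integrableOn_compact (isCompact_Icc.prod isCompact_Icc)
    refine IntegrableOn.of_forall_sdiff_eq_zero hK
      (measurableSet_Ioi.prod measurableSet_Ioo) ?_
    rintro ⟨r, θ⟩ ⟨⟨hr, hθ⟩, hn⟩
    have hr' : (0 : ℝ) < r := hr
    have : M < r := by
      by_contra hle
      exact hn ⟨⟨hr'.le, not_lt.1 hle⟩, Ioo_subset_Icc_self hθ⟩
    rw [hM _ (by rw [norm_mul, hnorm, Complex.norm_real, mul_one]; exact this.trans_le (le_abs_self r))]
    simp
  have hA := hint e hecont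
  have hB := hint (fun θ => I * e θ) (by fun_prop)
  have hpolar : ∫ w, (fderiv ℝ g w 1 + I * fderiv ℝ g w I) / w =
      ∫ p in Ioi (0 : ℝ) ×ˢ Ioo (-Real.pi) Real.pi,
        (fderiv ℝ g (p.1 * e p.2) (e p.2) + I * fderiv ℝ g (p.1 * e p.2) (I * e p.2)) := by
    rw [← Complex.integral_comp_polarCoord_symm]
    refine setIntegral_congr_fun (measurableSet_Ioi.prod measurableSet_Ioo) ?_
    rintro ⟨r, θ⟩ ⟨hr, hθ⟩
    have hr' : (r : ℂ) ≠ 0 := by exact_mod_cast (ne_of_gt hr)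
    have hlin : ∀ (L : ℂ →L[ℝ] ℂ) (x y : ℝ), L (x + y * I) = x * L 1 + y * L I := by
      intro L x y
      have : (x + y * I : ℂ) = x • (1 : ℂ) + y • I := by simp
      rw [this, map_add, map_smul, map_smul]; simp
    have hIe : I * e θ = ((-Real.sin θ : ℝ) : ℂ) + (Real.cos θ : ℝ) * I := by
      simp only [he]; push_cast; linear_combination (Complex.sin θ) * I_mul_I
    have he0 : e θ ≠ 0 := by rw [← norm_ne_zero_iff, hnorm]; exact one_ne_zero
    have hcs : (Real.cos θ : ℂ) ^ 2 + (Real.sin θ : ℂ) ^ 2 = 1 := by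
      push_cast; exact Complex.cos_sq_add_sin_sq _
    simp only [Complex.polarCoord_symm_apply]
    change r • ((fderiv ℝ g (r * e θ) 1 + I * fderiv ℝ g (r * e θ) I) / (r * e θ)) = _
    rw [hIe, hlin _ (-Real.sin θ)]
    conv_rhs => rw [show fderiv ℝ g (r * e θ) (e θ) = _ from hlin _ _ _]
    set L := fderiv ℝ g (r * e θ)
    rw [Complex.real_smul]
    field_simp
    simp only [he]
    push_cast at hcs ⊢
    linear_combination (-(L 1) - I * L I) * hcs + (-(Complex.cos θ * Complex.sin θ * L I) + Complex.sin θ^2 * L 1) * I_sq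
  have hprod : (volume : Measure (ℝ × ℝ)) = volume.prod volume := rfl
  have h1 : ∫ p in Ioi (0 : ℝ) ×ˢ Ioo (-Real.pi) Real.pi, fderiv ℝ g (p.1 * e p.2) (e p.2) =
      -(2 * Real.pi) * g 0 := by
    rw [hprod, ← Measure.prod_restrict, integral_prod_symm]
    swap
    · rw [Measure.prod_restrict]; exact hA
    have : ∀ θ, ∫ r in Ioi (0 : ℝ), fderiv ℝ g (r * e θ) (e θ) = - g 0 := by
      intro θ
      have hder : ∀ r : ℝ, HasDerivAt (fun r : ℝ => g (r * e θ)) (fderiv ℝ g (r * e θ) (e θ)) r := by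
        intro r
        have h0 : HasDerivAt (fun r : ℝ => (r : ℂ) * e θ) (e θ) r := by
          simpa using (Complex.ofRealCLM.hasDerivAt (x := r)).mul_const (e θ)
        exact (hd _).comp_hasDerivAt r h0
      have hcd : ContDiff ℝ 1 (fun r : ℝ => g (r * e θ)) := by
        apply hg.comp
        exact Complex.ofRealCLM.contDiff.mul contDiff_const
      have hcs : HasCompactSupport (fun r : ℝ => g (r * e θ)) := by
        refine hc.comp_isClosedEmbedding (g := fun r : ℝ => (r : ℂ) * e θ) ?_
        refine Isometry.isClosedEmbedding (Isometry.of_dist_eq fun a b => ?_)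
        rw [dist_eq_norm, dist_eq_norm, ← sub_mul, norm_mul, hnorm, mul_one, ← Complex.ofReal_sub,
          Complex.norm_real]
      have := hcs.integral_Ioi_deriv_eq hcd 0
      simp only [fun r => (hder r).deriv] at this
      simpa using this
    simp only [this]
    rw [setIntegral_const, Measure.real, Real.volume_Ioo, ENNReal.toReal_ofReal (by linarith [Real.pi_pos])]
    rw [Complex.real_smul]; push_cast; ring
  have h2 : ∫ p in Ioi (0 : ℝ) ×ˢ Ioo (-Real.pi) Real.pi, fderiv ℝ g (p.1 * e p.2) (I * e p.2) = 0 := by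
    rw [hprod, ← Measure.prod_restrict, integral_prod]
    swap
    · rw [Measure.prod_restrict]; exact hB
    have : ∀ r ∈ Ioi (0:ℝ), ∫ θ in Ioo (-Real.pi) Real.pi, fderiv ℝ g (r * e θ) (I * e θ) = 0 := by
      intro r hr
      have hr' : (r : ℂ) ≠ 0 := by exact_mod_cast (ne_of_gt hr)
      have hde : ∀ θ, HasDerivAt e (I * e θ) θ := by
        intro θ
        have h1 := (Real.hasDerivAt_cos θ).ofReal_comp
        have h2 := ((Real.hasDerivAt_sin θ).ofReal_comp).mul_const I
        refine (h1.add h2).congr_deriv ?_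
        simp only [he]; push_cast; linear_combination -(Complex.sin θ) * I_mul_I
      have hder : ∀ θ : ℝ, HasDerivAt (fun θ : ℝ => (r : ℂ)⁻¹ * g (r * e θ))
          (fderiv ℝ g (r * e θ) (I * e θ)) θ := by
        intro θ
        refine (((hd (r * e θ)).comp_hasDerivAt θ
          ((hde θ).const_mul (r : ℂ))).const_mul (r : ℂ)⁻¹).congr_deriv ?_
        rw [← Complex.real_smul (x := r) (z := I * e θ), map_smul, Complex.real_smul]
        field_simp
      rw [← integral_Ioc_eq_integral_Ioo, ← intervalIntegral.integral_of_le (by linarith [Real.pi_pos]),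
        intervalIntegral.integral_eq_sub_of_hasDerivAt (fun θ _ => hder θ)]
      · simp [he]
      · apply Continuous.intervalIntegrable
        exact (hcont.comp (by fun_prop)).clm_apply (by fun_prop)
    rw [setIntegral_congr_fun measurableSet_Ioi this]
    simp
  rw [hpolar, hprod, integral_add hA (hB.const_mul I), ← hprod, h1, integral_const_mul, h2]
  simp

open MeasureTheory in
theorem cauchy_pompeiu {g : ℂ → ℂ} (hg : ContDiff ℝ 1 g) (hc : HasCompactSupport g) (z : ℂ) :
    g z = -(2 * Real.pi : ℂ)⁻¹ * ∫ w, cauchyRiemannOp g w / (w - z) := by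
  have h1 : ContDiff ℝ 1 (fun w => g (w + z)) := hg.comp (contDiff_id.add contDiff_const)
  have h2 : HasCompactSupport (fun w => g (w + z)) :=
    hc.comp_homeomorph (Homeomorph.addRight z)
  have h := cauchy_pompeiu_zero h1 h2
  have h3 : ∀ w, cauchyRiemannOp (fun w => g (w + z)) w = cauchyRiemannOp g (w + z) := by
    intro w
    simp only [cauchyRiemannOp, fderiv_comp_add_right]
  simp only [h3, zero_add] at h
  have h4 := integral_add_right_eq_self (μ := (volume : Measure ℂ))
    (fun w => cauchyRiemannOp g w / (w - z)) z
  simp only [add_sub_cancel_right] at h4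
  rw [← h4, h]
  have : (Real.pi : ℂ) ≠ 0 := by exact_mod_cast Real.pi_ne_zero
  field_simp

theorem rpow_mul_rpow_inv_le {A B Z a δ : ℝ} (hA : 0 < A) (hB : 0 < B) (hZ : 0 ≤ Z)
    (hZAB : Z ≤ A + B) (hδ0 : 0 < δ) (hδ1 : δ ≤ 1) (hδa : δ ≤ a) :
    Z ^ δ * (A ^ (-a) * B⁻¹) ≤ 2 * (A ^ (-(a + 1 - δ)) + B ^ (-(a + 1 - δ))) := by
  have key : ∀ μ ν : ℝ, 0 < μ → μ ≤ ν → Z ≤ μ + ν → Z ^ δ ≤ 2 * ν ^ δ := by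
    intro μ ν hμ h hZ'
    calc Z ^ δ ≤ (2 * ν) ^ δ := Real.rpow_le_rpow hZ (by linarith) hδ0.le
      _ = 2 ^ δ * ν ^ δ := Real.mul_rpow (by norm_num) (by linarith)
      _ ≤ 2 ^ (1 : ℝ) * ν ^ δ := by
        have : 0 ≤ ν ^ δ := Real.rpow_nonneg (by linarith) _
        gcongr
        norm_num
      _ = _ := by rw [Real.rpow_one]
  have hA' := Real.rpow_pos_of_pos hA (-(a + 1 - δ))
  have hB' := Real.rpow_pos_of_pos hB (-(a + 1 - δ))
  rcases le_total A B with h | h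
  · calc Z ^ δ * (A ^ (-a) * B⁻¹) ≤ (2 * B ^ δ) * (A ^ (-a) * B⁻¹) := by
          gcongr
          exact key A B hA h hZAB
      _ = 2 * (A ^ (-a) * B ^ (-(1 - δ))) := by
          rw [← Real.rpow_neg_one, show -(1 - δ) = δ + -1 by ring, Real.rpow_add hB]; ring
      _ ≤ 2 * (A ^ (-a) * A ^ (-(1 - δ))) := by
          gcongr 2 * (_ * ?_)
          exact Real.rpow_le_rpow_of_nonpos hA h (by linarith)
      _ = 2 * A ^ (-(a + 1 - δ)) := by rw [← Real.rpow_add hA]; ring_nf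
      _ ≤ _ := by linarith
  · calc Z ^ δ * (A ^ (-a) * B⁻¹) ≤ (2 * A ^ δ) * (A ^ (-a) * B⁻¹) := by
          gcongr
          exact key B A hB h (by linarith)
      _ = 2 * (A ^ (-(a - δ)) * B⁻¹) := by
          rw [show -(a - δ) = δ + -a by ring, Real.rpow_add hA]; ring
      _ ≤ 2 * (B ^ (-(a - δ)) * B⁻¹) := by
          gcongr 2 * (?_ * _)
          exact Real.rpow_le_rpow_of_nonpos hB h (by linarith)
      _ = 2 * B ^ (-(a + 1 - δ)) := by
          rw [← Real.rpow_neg_one, ← Real.rpow_add hB]; ring_nf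
      _ ≤ _ := by linarith

theorem inv_sub_eq_geom_sum {K : Type*} [Field K] (m : ℕ) {ζ z : K} (h0 : ζ ≠ 0) (h1 : ζ - z ≠ 0) :
    (ζ - z)⁻¹ = (∑ j ∈ Finset.range m, z ^ j * (ζ ^ (j + 1))⁻¹) + z ^ m * ((ζ ^ m)⁻¹ * (ζ - z)⁻¹) := by
  induction m with
  | zero => simp
  | succ m ih =>
    rw [Finset.sum_range_succ, add_assoc]
    refine ih.trans ?_
    congr 1
    field_simp
    ring

open MeasureTheory in
theorem exists_taylor_of_cauchyRiemannOp_le (m : ℕ) (hm : 1 ≤ m) (M : ℝ) {a δ : ℝ} (hδ0 : 0 < δ)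
    (hδ1 : δ ≤ 1) (hδa : δ ≤ a) (ha : a < 1 + δ) :
    ∃ K : ℝ, 0 ≤ K ∧ ∀ (g : ℂ → ℂ) (C : ℝ), ContDiff ℝ 1 g → tsupport g ⊆ closedBall 0 M →
      (∀ ζ, ‖cauchyRiemannOp g ζ‖ ≤ C * ‖ζ‖ ^ ((m : ℝ) - a)) →
      ∃ c : ℕ → ℂ, ∀ z, ‖z‖ ≤ 1 →
        ‖g z - ∑ j ∈ Finset.range m, c j * z ^ j‖ ≤ K * C * ‖z‖ ^ ((m : ℝ) - δ) := by
  set p := a + 1 - δ with hp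
  have hfin : (Module.finrank ℝ ℂ : ℝ) = 2 := by simp
  have hpint : ∀ R, IntegrableOn (fun w : ℂ => ‖w‖ ^ (-p)) (ball 0 R) := by
    intro R
    refine integrableOn_ball_of_norm_le_rpow (C := 1) (α := p) (by simp)
      (by rw [hfin]; linarith) ?_ ?_
    · refine Filter.Eventually.of_forall fun x => ?_
      rw [Real.norm_of_nonneg (by positivity), one_mul]
    · exact (measurable_norm.pow_const _).aestronglyMeasurable
  set W : ℝ := ∫ w in ball (0 : ℂ) (M + 2), ‖w‖ ^ (-p) with hW
  have hW0 : 0 ≤ W := setIntegral_nonneg measurableSet_ball fun w _ => by positivity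
  refine ⟨4 * W * (2 * Real.pi)⁻¹, by positivity, fun g C hg hs hD => ?_⟩
  have hc : HasCompactSupport g := (isCompact_closedBall (0 : ℂ) M).of_isClosed_subset
    (isClosed_tsupport g) hs
  set D := cauchyRiemannOp g with hDdef
  have hDc : Continuous D := by
    have := hg.continuous_fderiv one_ne_zero
    unfold D cauchyRiemannOp
    fun_prop
  have hD0 : ∀ ζ, ζ ∉ ball (0 : ℂ) (M + 1) → D ζ = 0 := by
    intro ζ hζ
    have : fderiv ℝ g ζ = 0 := by
      by_contra h
      have := hs (support_fderiv_subset ℝ h)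
      simp only [mem_ball, mem_closedBall] at *
      linarith
    simp [D, cauchyRiemannOp, this]
  have hC : 0 ≤ C := by
    have := (norm_nonneg _).trans (hD 1)
    simpa using this
  have hae : ∀ z : ℂ, ∀ᵐ ζ : ℂ, ζ ≠ z := fun z => by
    simp [ae_iff]
  -- coefficient integrability
  have hf : ∀ᵐ ζ : ℂ, ‖D ζ * (ζ ^ m)⁻¹‖ ≤ C * ‖ζ‖ ^ (-a) := by
    filter_upwards [hae 0] with ζ hζ
    have hn : 0 < ‖ζ‖ := norm_pos_iff.2 hζ
    rw [norm_mul, norm_inv, norm_pow]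
    calc _ ≤ C * ‖ζ‖ ^ ((m : ℝ) - a) * (‖ζ‖ ^ m)⁻¹ := by gcongr; exact hD ζ
      _ = _ := by
        rw [sub_eq_add_neg, Real.rpow_add hn, Real.rpow_natCast]
        field_simp
  have hmeas : ∀ j z, AEStronglyMeasurable (fun ζ => D ζ * ((ζ ^ j)⁻¹ * (ζ - z)⁻¹)) volume := by
    intro j z
    have : Measurable D := hDc.measurable
    exact Measurable.aestronglyMeasurable (by fun_prop)
  have hmeas' : ∀ j, AEStronglyMeasurable (fun ζ => D ζ * (ζ ^ j)⁻¹) volume := by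
    intro j
    have : Measurable D := hDc.measurable
    exact Measurable.aestronglyMeasurable (by fun_prop)
  have hint : ∀ j < m, Integrable (fun ζ => D ζ * (ζ ^ (j + 1))⁻¹) := by
    intro j hj
    have h1 : IntegrableOn (fun ζ => D ζ * (ζ ^ m)⁻¹) (ball 0 (M + 1)) :=
      integrableOn_ball_of_norm_le_rpow (C := C) (α := a) (by simp) (by rw [hfin]; linarith)
        (ae_restrict_of_ae hf) (hmeas' m)
    have h2 : Integrable (fun ζ => D ζ * (ζ ^ m)⁻¹) :=
      h1.integrable_of_forall_notMem_eq_zero fun ζ hζ => by rw [hD0 ζ hζ, zero_mul]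
    have h3 : IntegrableOn (fun ζ => ζ ^ (m - (j + 1)) * (D ζ * (ζ ^ m)⁻¹))
        (closedBall 0 (M + 1)) :=
      h2.integrableOn.continuousOn_mul (by fun_prop) (isCompact_closedBall _ _)
    have h4 : Integrable (fun ζ => ζ ^ (m - (j + 1)) * (D ζ * (ζ ^ m)⁻¹)) :=
      h3.integrable_of_forall_notMem_eq_zero fun ζ hζ => by
        rw [hD0 ζ (fun h => hζ (ball_subset_closedBall h)), zero_mul, mul_zero]
    refine h4.congr ?_
    filter_upwards [hae 0] with ζ hζ
    have : ζ ^ m = ζ ^ (m - (j + 1)) * ζ ^ (j + 1) := by rw [← pow_add]; congr 1; omega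
    rw [this]
    field_simp
  refine ⟨fun j => -(2 * Real.pi : ℂ)⁻¹ * ∫ ζ, D ζ * (ζ ^ (j + 1))⁻¹, fun z hz => ?_⟩
  -- remainder bound
  set bd : ℂ → ℝ := fun ζ => (ball (0 : ℂ) (M + 1)).indicator
    (fun ζ => C * (2 * (‖ζ‖ ^ (-p) + ‖ζ - z‖ ^ (-p)))) ζ with hbd
  have hpz : IntegrableOn (fun ζ : ℂ => ‖ζ - z‖ ^ (-p)) (ball 0 (M + 1)) ∧
      ∫ ζ in ball (0 : ℂ) (M + 1), ‖ζ - z‖ ^ (-p) ≤ W := by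
    have h1 : Integrable ((ball (0 : ℂ) (M + 2)).indicator fun w : ℂ => ‖w‖ ^ (-p)) :=
      (hpint _).integrable_indicator measurableSet_ball
    have h2 := h1.comp_sub_right z
    have hle : ∀ ζ ∈ ball (0 : ℂ) (M + 1), ‖ζ - z‖ ^ (-p) =
        (ball (0 : ℂ) (M + 2)).indicator (fun w : ℂ => ‖w‖ ^ (-p)) (ζ - z) := by
      intro ζ hζ
      rw [Set.indicator_of_mem]
      rw [mem_ball_zero_iff] at *
      linarith [norm_sub_le ζ z]
    refine ⟨(h2.integrableOn).congr_fun (fun ζ hζ => (hle ζ hζ).symm) measurableSet_ball, ?_⟩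
    rw [setIntegral_congr_fun measurableSet_ball hle]
    refine (setIntegral_le_integral h2 (Filter.Eventually.of_forall fun ζ =>
      Set.indicator_nonneg (fun w _ => by positivity) _)).trans ?_
    rw [integral_sub_right_eq_self (μ := (volume : Measure ℂ)), integral_indicator measurableSet_ball]
  have hbdint : Integrable bd := by
    refine IntegrableOn.integrable_indicator ?_ measurableSet_ball
    exact (((hpint _).add hpz.1).const_mul 2).const_mul C
  have hbdle : ∫ ζ, bd ζ ≤ C * (4 * W) := by
    rw [hbd, integral_indicator measurableSet_ball, integral_const_mul, integral_const_mul,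
      integral_add (hpint _) hpz.1]
    have : ∫ ζ in ball (0 : ℂ) (M + 1), ‖ζ‖ ^ (-p) ≤ W :=
      setIntegral_mono_set (hpint _) (Filter.Eventually.of_forall fun ζ => by positivity)
        (ball_subset_ball (by linarith)).eventuallyLE
    refine mul_le_mul_of_nonneg_left ?_ hC
    linarith [hpz.2]
  have hrem : ∀ᵐ ζ : ℂ, ‖z‖ ^ δ * ‖D ζ * ((ζ ^ m)⁻¹ * (ζ - z)⁻¹)‖ ≤ bd ζ := by
    filter_upwards [hf, hae 0, hae z] with ζ h1 h0 hz
    by_cases hζ : ζ ∈ ball (0 : ℂ) (M + 1)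
    · rw [hbd]
      simp only [Set.indicator_of_mem hζ]
      rw [← mul_assoc (D ζ), norm_mul _ (ζ - z)⁻¹, norm_inv]
      have hA : 0 < ‖ζ‖ := norm_pos_iff.2 h0
      have hB : 0 < ‖ζ - z‖ := norm_pos_iff.2 (sub_ne_zero.2 hz)
      calc _ ≤ ‖z‖ ^ δ * (C * ‖ζ‖ ^ (-a) * ‖ζ - z‖⁻¹) := by gcongr
        _ = C * (‖z‖ ^ δ * (‖ζ‖ ^ (-a) * ‖ζ - z‖⁻¹)) := by ring
        _ ≤ _ := by
          refine mul_le_mul_of_nonneg_left ?_ hC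
          refine rpow_mul_rpow_inv_le hA hB (norm_nonneg z) ?_ hδ0 hδ1 hδa
          calc ‖z‖ = ‖ζ - (ζ - z)‖ := by congr 1; ring
            _ ≤ _ := norm_sub_le _ _
    · rw [hD0 ζ hζ]
      simp [hbd, Set.indicator_of_notMem hζ]
  by_cases hz0 : z = 0
  · have : g z = ∑ j ∈ Finset.range m,
        (-(2 * Real.pi : ℂ)⁻¹ * ∫ ζ, D ζ * (ζ ^ (j + 1))⁻¹) * z ^ j := by
      rw [Finset.sum_eq_single_of_mem 0 (Finset.mem_range.2 hm)
        (fun j _ hj => by rw [hz0, zero_pow hj, mul_zero]), cauchy_pompeiu hg hc z]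
      simp [hz0, div_eq_mul_inv, D]
    rw [this, sub_self, norm_zero]
    positivity
  · have hzpos : 0 < ‖z‖ := norm_pos_iff.2 hz0
    have hRint : Integrable (fun ζ => D ζ * ((ζ ^ m)⁻¹ * (ζ - z)⁻¹)) := by
      refine (hbdint.const_mul ((‖z‖ ^ δ)⁻¹)).mono' (hmeas m z) ?_
      filter_upwards [hrem] with ζ h
      exact (le_inv_mul_iff₀ (Real.rpow_pos_of_pos hzpos δ)).2 h
    have hsplit : ∫ ζ, D ζ / (ζ - z) = (∑ j ∈ Finset.range m, z ^ j * ∫ ζ, D ζ * (ζ ^ (j + 1))⁻¹) +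
        z ^ m * ∫ ζ, D ζ * ((ζ ^ m)⁻¹ * (ζ - z)⁻¹) := by
      simp_rw [← integral_const_mul]
      rw [← integral_finsetSum, ← integral_add]
      · refine integral_congr_ae ?_
        filter_upwards [hae 0, hae z] with ζ h0 hz
        conv_lhs => rw [div_eq_mul_inv, inv_sub_eq_geom_sum m h0 (sub_ne_zero.2 hz), mul_add, Finset.mul_sum]
        congr 1
        · refine Finset.sum_congr rfl fun j _ => by ring
        · ring
      · exact integrable_finsetSum _ fun j hj => (hint j (Finset.mem_range.1 hj)).const_mul _
      · exact hRint.const_mul _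
      · exact fun j hj => (hint j (Finset.mem_range.1 hj)).const_mul _
    have heq : g z - ∑ j ∈ Finset.range m, (-(2 * Real.pi : ℂ)⁻¹ * ∫ ζ, D ζ * (ζ ^ (j + 1))⁻¹) * z ^ j
        = -(2 * Real.pi : ℂ)⁻¹ * (z ^ m * ∫ ζ, D ζ * ((ζ ^ m)⁻¹ * (ζ - z)⁻¹)) := by
      rw [cauchy_pompeiu hg hc z, hsplit, mul_add, Finset.mul_sum]
      rw [add_comm, add_sub_assoc]
      rw [← Finset.sum_sub_distrib, Finset.sum_eq_zero, add_zero]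
      intro j _
      ring
    rw [heq, norm_mul, norm_mul, norm_neg, norm_inv, norm_pow]
    have hnpi : ‖(2 * Real.pi : ℂ)‖ = 2 * Real.pi := by
      rw [norm_mul, Complex.norm_real, Real.norm_of_nonneg Real.pi_pos.le]; simp
    rw [hnpi]
    have hI : ‖z‖ ^ δ * ‖∫ ζ, D ζ * ((ζ ^ m)⁻¹ * (ζ - z)⁻¹)‖ ≤ C * (4 * W) := by
      calc _ ≤ ‖z‖ ^ δ * ∫ ζ, ‖D ζ * ((ζ ^ m)⁻¹ * (ζ - z)⁻¹)‖ := by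
            gcongr; exact norm_integral_le_integral_norm _
        _ = ∫ ζ, ‖z‖ ^ δ * ‖D ζ * ((ζ ^ m)⁻¹ * (ζ - z)⁻¹)‖ := (integral_const_mul _ _).symm
        _ ≤ ∫ ζ, bd ζ := integral_mono_ae (hRint.norm.const_mul _) hbdint hrem
        _ ≤ _ := hbdle
    have hpow : ‖z‖ ^ m = ‖z‖ ^ ((m : ℝ) - δ) * ‖z‖ ^ δ := by
      rw [← Real.rpow_add hzpos, sub_add_cancel, Real.rpow_natCast]
    calc _ = (2 * Real.pi)⁻¹ * ‖z‖ ^ ((m : ℝ) - δ) *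
          (‖z‖ ^ δ * ‖∫ ζ, D ζ * ((ζ ^ m)⁻¹ * (ζ - z)⁻¹)‖) := by rw [hpow]; ring
      _ ≤ (2 * Real.pi)⁻¹ * ‖z‖ ^ ((m : ℝ) - δ) * (C * (4 * W)) := by gcongr
      _ = _ := by ring

theorem exists_local_taylor_of_cauchyRiemannOp_le (m : ℕ) (hm : 1 ≤ m) {R a δ : ℝ} (hR : 0 < R)
    (hR1 : R ≤ 1) (hδ0 : 0 < δ) (hδ1 : δ ≤ 1) (hδa : δ ≤ a) (ha : a < 1 + δ) (ham : a ≤ m) :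
    ∃ K : ℝ, 0 ≤ K ∧ ∀ (g : ℂ → ℂ) (C : ℝ), ContDiffOn ℝ 1 g (ball 0 (3 * R)) →
      (∀ ζ ∈ ball (0 : ℂ) (3 * R), ‖g ζ‖ ≤ C) →
      (∀ ζ ∈ ball (0 : ℂ) (3 * R), ‖cauchyRiemannOp g ζ‖ ≤ C * ‖ζ‖ ^ ((m : ℝ) - a)) →
      ∃ c : ℕ → ℂ, ∀ z, ‖z‖ < R →
        ‖g z - ∑ j ∈ Finset.range m, c j * z ^ j‖ ≤ K * C * ‖z‖ ^ ((m : ℝ) - δ) := by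
  obtain ⟨K, hK0, hK⟩ := exists_taylor_of_cauchyRiemannOp_le m hm (2 * R) hδ0 hδ1 hδa ha
  let χ : ContDiffBump (0 : ℂ) := ⟨R, 2 * R, hR, by linarith⟩
  have hχ : ContDiff ℝ 1 χ := χ.contDiff
  obtain ⟨B, hB⟩ : ∃ B, ∀ ζ, ‖fderiv ℝ χ ζ‖ ≤ B :=
    (hχ.continuous_fderiv one_ne_zero).bounded_above_of_compact_support
      (χ.hasCompactSupport.fderiv (𝕜 := ℝ))
  have hB0 : 0 ≤ B := (norm_nonneg _).trans (hB 0)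
  set β := (m : ℝ) - a with hβ
  have hβ0 : 0 ≤ β := by linarith
  refine ⟨K * (1 + 2 * B * (R ^ β)⁻¹), by positivity, fun g C hg hgC hD => ?_⟩
  have hC : 0 ≤ C := (norm_nonneg _).trans (hgC 0 (by simpa using hR))
  set G : ℂ → ℂ := fun ζ => χ ζ • g ζ with hG
  have hzero : ∀ ζ, ζ ∉ ball (0 : ℂ) (3 * R) → G =ᶠ[nhds ζ] fun _ => 0 := by
    intro ζ hζ
    have hd : 2 * R < dist ζ 0 := by rw [mem_ball] at hζ; linarith
    filter_upwards [(isOpen_lt continuous_const (continuous_id.dist continuous_const)).mem_nhds hd]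
      with w hw
    simp only [hG]
    rw [χ.zero_of_le_dist (x := w) (le_of_lt hw), zero_smul]
  have hGc : ContDiff ℝ 1 G := by
    rw [contDiff_iff_contDiffAt]
    intro ζ
    by_cases hζ : ζ ∈ ball (0 : ℂ) (3 * R)
    · exact hχ.contDiffAt.smul (hg.contDiffAt (isOpen_ball.mem_nhds hζ))
    · exact contDiffAt_const.congr_of_eventuallyEq (hzero ζ hζ)
  have hGs : tsupport G ⊆ closedBall 0 (2 * R) := by
    refine closure_minimal ?_ isClosed_closedBall
    intro ζ hζ
    by_contra h
    refine hζ ?_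
    simp only [hG]
    rw [χ.zero_of_le_dist (by rw [mem_closedBall, not_le] at h; exact h.le), zero_smul]
  have hGD : ∀ ζ, ‖cauchyRiemannOp G ζ‖ ≤ (1 + 2 * B * (R ^ β)⁻¹) * C * ‖ζ‖ ^ β := by
    intro ζ
    by_cases hζ : ζ ∈ ball (0 : ℂ) (3 * R)
    · have hgd : DifferentiableAt ℝ g ζ :=
        (hg.contDiffAt (isOpen_ball.mem_nhds hζ)).differentiableAt one_ne_zero
      have hχd : DifferentiableAt ℝ χ ζ := hχ.contDiffAt.differentiableAt one_ne_zero
      have hf : fderiv ℝ G ζ = χ ζ • fderiv ℝ g ζ + (fderiv ℝ χ ζ).smulRight (g ζ) :=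
        fderiv_fun_smul hχd hgd
      have hCR : cauchyRiemannOp G ζ = χ ζ • cauchyRiemannOp g ζ +
          (fderiv ℝ χ ζ 1 + I * fderiv ℝ χ ζ I) * g ζ := by
        simp only [cauchyRiemannOp, hf, add_apply,
          smul_apply, ContinuousLinearMap.smulRight_apply, Complex.real_smul]
        ring
      have h1 : ‖χ ζ • cauchyRiemannOp g ζ‖ ≤ C * ‖ζ‖ ^ β := by
        rw [norm_smul, Real.norm_of_nonneg χ.nonneg]
        calc _ ≤ 1 * ‖cauchyRiemannOp g ζ‖ := by gcongr; exact χ.le_one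
          _ ≤ _ := by rw [one_mul]; exact hD ζ hζ
      have h2 : ‖(fderiv ℝ χ ζ 1 + I * fderiv ℝ χ ζ I) * g ζ‖ ≤
          2 * B * (R ^ β)⁻¹ * C * ‖ζ‖ ^ β := by
        by_cases hζR : ζ ∈ ball (0 : ℂ) R
        · have : fderiv ℝ χ ζ = 0 := by
            have : χ =ᶠ[nhds ζ] fun _ => 1 := χ.eventuallyEq_one_of_mem_ball hζR
            rw [this.fderiv_eq]; simp
          rw [this]
          simp only [zero_apply, Complex.ofReal_zero, mul_zero, add_zero,
            zero_mul, norm_zero]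
          positivity
        · have hR' : R ≤ ‖ζ‖ := by simpa using hζR
          have h3 : 1 ≤ (R ^ β)⁻¹ * ‖ζ‖ ^ β := by
            rw [inv_mul_eq_div, one_le_div (by positivity)]
            exact Real.rpow_le_rpow hR.le hR' hβ0
          have h4 : ∀ v : ℂ, ‖v‖ = 1 → ‖((fderiv ℝ χ ζ v : ℝ) : ℂ)‖ ≤ B := by
            intro v hv
            rw [Complex.norm_real]
            refine ((fderiv ℝ χ ζ).le_opNorm v).trans ?_
            rw [hv, mul_one]; exact hB ζ
          rw [norm_mul]
          calc _ ≤ (B + B) * C := by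
                gcongr
                · refine (norm_add_le _ _).trans (add_le_add (h4 1 (by simp)) ?_)
                  rw [norm_mul, norm_I, one_mul]; exact h4 I (by simp)
                · exact hgC ζ hζ
            _ = 2 * B * C * 1 := by ring
            _ ≤ 2 * B * C * ((R ^ β)⁻¹ * ‖ζ‖ ^ β) := by gcongr
            _ = _ := by ring
      rw [hCR]
      calc _ ≤ _ := norm_add_le _ _
        _ ≤ _ := add_le_add h1 h2
        _ = _ := by ring
    · have : fderiv ℝ G ζ = 0 := by rw [(hzero ζ hζ).fderiv_eq]; simp
      simp only [cauchyRiemannOp, this]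
      simp only [zero_apply, mul_zero, add_zero, norm_zero]
      positivity
  obtain ⟨c, hc⟩ := hK G _ hGc hGs hGD
  refine ⟨c, fun z hz => ?_⟩
  have h := hc z (by linarith)
  have hz1 : G z = g z := by
    simp only [hG]
    rw [χ.one_of_mem_closedBall (by simpa using hz.le), one_smul]
  rw [hz1] at h
  linarith

section Taylor

variable {V F : Type*} [NormedAddCommGroup V] [NormedSpace ℝ V] [NormedAddCommGroup F]
  [NormedSpace ℝ F]

theorem ContinuousLinearMap.opNorm_le_of_norm_eq {L : V →L[ℝ] F} {r c : ℝ} (hr : 0 < r)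
    (hc : 0 ≤ c) (h : ∀ v, ‖v‖ = r → ‖L v‖ ≤ c * r) : ‖L‖ ≤ c := by
  refine ContinuousLinearMap.opNorm_le_of_unit_norm hc fun x hx => ?_
  have := h (r • x) (by rw [norm_smul, hx, mul_one, Real.norm_of_nonneg hr.le])
  rw [map_smul, norm_smul, Real.norm_of_nonneg hr.le, mul_comm] at this
  exact le_of_mul_le_mul_right this hr

theorem hasFDerivAt_of_norm_le_rpow {f : V → F} {L : V →L[ℝ] F} {x : V} {R K γ : ℝ} (hR : 0 < R)
    (hγ : 0 < γ) (h : ∀ k, ‖k‖ < R → ‖f (x + k) - f x - L k‖ ≤ K * ‖k‖ ^ (1 + γ)) :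
    HasFDerivAt f L x := by
  rw [hasFDerivAt_iff_isLittleO_nhds_zero]
  have h1 : (fun k => f (x + k) - f x - L k) =O[nhds 0] fun k => ‖k‖ ^ (1 + γ) := by
    refine Asymptotics.IsBigO.of_bound K ?_
    filter_upwards [ball_mem_nhds (0 : V) hR] with k hk
    rw [Real.norm_of_nonneg (by positivity)]
    exact h k (by simpa using hk)
  refine h1.trans_isLittleO ?_
  have h2 : (fun k : V => ‖k‖ ^ (1 + γ)) = fun k => ‖k‖ * ‖k‖ ^ γ := by
    ext k
    rw [Real.rpow_add_of_nonneg (norm_nonneg k) zero_le_one hγ.le, Real.rpow_one]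
  rw [h2]
  have h3 : (fun k : V => ‖k‖ ^ γ) =o[nhds 0] fun _ => (1 : ℝ) := by
    rw [Asymptotics.isLittleO_one_iff]
    have : Continuous fun k : V => ‖k‖ ^ γ := continuous_norm.rpow_const fun _ => Or.inr hγ.le
    simpa [Real.zero_rpow hγ.ne'] using this.tendsto 0
  have := (Asymptotics.isBigO_refl (fun k : V => ‖k‖) (nhds 0)).mul_isLittleO h3
  simp only [mul_one] at this
  exact this.of_norm_right

theorem norm_sub_le_rpow_of_taylor {f : V → F} {B : V → V →L[ℝ] F} {x₀ : V} {R K γ : ℝ}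
    (hK : 0 ≤ K) (hγ : 0 < γ)
    (h : ∀ x ∈ ball x₀ R, ∀ k, ‖k‖ < R → ‖f (x + k) - f x - B x k‖ ≤ K * ‖k‖ ^ (1 + γ))
    {x y : V} (hx : x ∈ ball x₀ (R / 4)) (hy : y ∈ ball x₀ (R / 4)) :
    ‖B y - B x‖ ≤ K * (2 ^ (1 + γ) + 2) * ‖y - x‖ ^ γ := by
  rcases eq_or_ne y x with rfl | hne
  · simp [Real.zero_rpow hγ.ne']
  rw [mem_ball] at hx hy
  have hR : 0 < R := by linarith [dist_nonneg (x := x) (y := x₀)]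
  set r := ‖y - x‖ with hr
  have hr0 : 0 < r := norm_pos_iff.2 (sub_ne_zero.2 hne)
  have hr1 : r < R / 2 := by
    rw [hr, ← dist_eq_norm]; linarith [dist_triangle_right y x x₀]
  refine ContinuousLinearMap.opNorm_le_of_norm_eq hr0 (by positivity) fun v hv => ?_
  have e1 := h y (mem_ball.2 (by linarith)) v (by linarith)
  have hvr : ‖y - x + v‖ ≤ 2 * r := (norm_add_le _ _).trans (by linarith)
  have e2 := h x (mem_ball.2 (by linarith)) (y - x + v) (by linarith)
  have e3 := h x (mem_ball.2 (by linarith)) (y - x) (by linarith)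
  have e2' : K * ‖y - x + v‖ ^ (1 + γ) ≤ K * (2 ^ (1 + γ) * r ^ (1 + γ)) := by
    rw [← Real.mul_rpow (by norm_num) hr0.le]
    gcongr
  have hkey : (B y - B x) v = (f (x + (y - x + v)) - f x - B x (y - x + v)) -
      (f (x + (y - x)) - f x - B x (y - x)) - (f (y + v) - f y - B y v) := by
    rw [map_add, show x + (y - x + v) = y + v by abel, show x + (y - x) = y by abel,
      sub_apply]
    abel
  rw [hkey]
  have hpow : r ^ (1 + γ) = r ^ γ * r := by
    rw [add_comm, Real.rpow_add hr0, Real.rpow_one]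
  rw [hv] at e1
  calc _ ≤ _ := (norm_sub_le _ _).trans (add_le_add_left (norm_sub_le _ _) _)
    _ ≤ K * (2 ^ (1 + γ) * r ^ (1 + γ)) + K * r ^ (1 + γ) + K * r ^ (1 + γ) :=
        add_le_add (add_le_add (e2.trans e2') e3) e1
    _ = _ := by rw [hpow]; ring

theorem contDiffAt_one_of_taylor {f : V → F} {B : V → V →L[ℝ] F} {x₀ : V} {R K γ : ℝ}
    (hR : 0 < R) (hK : 0 ≤ K) (hγ : 0 < γ)
    (h : ∀ x ∈ ball x₀ R, ∀ k, ‖k‖ < R → ‖f (x + k) - f x - B x k‖ ≤ K * ‖k‖ ^ (1 + γ)) :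
    ContDiffAt ℝ 1 f x₀ := by
  rw [contDiffAt_one_iff]
  refine ⟨B, ball x₀ (R / 4), ball_mem_nhds _ (by linarith), ?_, fun x hx =>
    hasFDerivAt_of_norm_le_rpow hR hγ (h x (ball_subset_ball (by linarith) hx))⟩
  intro x hx
  refine ContinuousAt.continuousWithinAt ?_
  rw [ContinuousAt, tendsto_iff_norm_sub_tendsto_zero]
  have hlim : Filter.Tendsto (fun y => K * (2 ^ (1 + γ) + 2) * ‖y - x‖ ^ γ) (nhds x) (nhds 0) := by
    have : Continuous fun y : V => K * (2 ^ (1 + γ) + 2) * ‖y - x‖ ^ γ := by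
      refine continuous_const.mul (Continuous.rpow_const (by fun_prop) fun _ => Or.inr hγ.le)
    simpa [Real.zero_rpow hγ.ne'] using this.tendsto x
  refine squeeze_zero' (Filter.Eventually.of_forall fun _ => norm_nonneg _) ?_ hlim
  filter_upwards [isOpen_ball.mem_nhds hx] with y hy
  exact norm_sub_le_rpow_of_taylor hK hγ h hx hy

theorem contDiffAt_two_of_taylor {g : V → F} {x₀ : V} {R K γ : ℝ} (hR : 0 < R) (hK : 0 ≤ K)
    (hγ : 0 < γ)
    (h : ∀ x ∈ ball x₀ R, ∃ (c : F) (L : V →L[ℝ] F) (B : V →L[ℝ] V →L[ℝ] F), ∀ k, ‖k‖ < R →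
      ‖g (x + k) - c - L k - B k k‖ ≤ K * ‖k‖ ^ (2 + γ)) :
    ContDiffAt ℝ 2 g x₀ := by
  choose! c L B h using h
  have hc : ∀ x ∈ ball x₀ R, c x = g x := by
    intro x hx
    have := h x hx 0 (by simpa using hR)
    simp only [add_zero, map_zero, sub_zero, norm_zero,
      Real.zero_rpow (by linarith : 2 + γ ≠ 0), mul_zero] at this
    rw [norm_le_zero_iff, sub_eq_zero] at this
    exact this.symm
  have hL : ∀ x ∈ ball x₀ R, HasFDerivAt g (L x) x := by
    intro x hx
    refine hasFDerivAt_of_norm_le_rpow (R := min R 1) (γ := 1) (K := ‖B x‖ + K)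
      (lt_min hR one_pos) one_pos fun k hk => ?_
    have h1 := h x hx k (hk.trans_le (min_le_left _ _))
    rw [hc x hx] at h1
    have h2 : ‖B x k k‖ ≤ ‖B x‖ * ‖k‖ ^ (2 : ℝ) := by
      refine ((B x).le_opNorm₂ k k).trans_eq ?_
      rw [Real.rpow_two]; ring
    have h3 : ‖k‖ ^ (2 + γ) ≤ ‖k‖ ^ (2 : ℝ) := by
      rcases eq_or_ne k 0 with rfl | hk0
      · simp [Real.zero_rpow (by linarith : 2 + γ ≠ 0)]
      · exact Real.rpow_le_rpow_of_exponent_ge (norm_pos_iff.2 hk0)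
          (hk.trans_le (min_le_right _ _)).le (by linarith)
    calc _ = ‖(g (x + k) - g x - L x k - B x k k) + B x k k‖ := by rw [sub_add_cancel]
      _ ≤ _ := norm_add_le _ _
      _ ≤ K * ‖k‖ ^ (2 : ℝ) + ‖B x‖ * ‖k‖ ^ (2 : ℝ) :=
        add_le_add (h1.trans (mul_le_mul_of_nonneg_left h3 hK)) h2
      _ = _ := by norm_num; ring
  rw [show (2 : WithTop ℕ∞) = ((1 : ℕ) : WithTop ℕ∞) + 1 by norm_num,
    contDiffAt_succ_iff_hasFDerivAt]
  refine ⟨L, ⟨ball x₀ R, ball_mem_nhds _ hR, hL⟩, ?_⟩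
  rw [Nat.cast_one]
  refine contDiffAt_one_of_taylor (R := R / 2) (K := K * (1 + 2 ^ (2 + γ))) (γ := γ)
    (B := fun x => B x + (B x).flip) (by linarith) (by positivity) hγ fun x hx k hk => ?_
  rcases eq_or_ne k 0 with rfl | hk0
  · simp [Real.zero_rpow (by linarith : 1 + γ ≠ 0)]
  set r := ‖k‖ with hr
  have hr0 : 0 < r := norm_pos_iff.2 hk0
  have hxR : x ∈ ball x₀ R := ball_subset_ball (by linarith) hx
  have hyR : x + k ∈ ball x₀ R := by
    rw [mem_ball] at *
    calc dist (x + k) x₀ ≤ dist (x + k) x + dist x x₀ := dist_triangle _ _ _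
      _ < R := by rw [dist_eq_norm, add_sub_cancel_left]; linarith
  refine ContinuousLinearMap.opNorm_le_of_norm_eq hr0 (by positivity) fun v hv => ?_
  have e1 := h _ hyR v (by linarith)
  have e2 := h _ hyR (-v) (by rw [norm_neg]; linarith)
  have n3 : ‖k + v‖ ≤ 2 * r := (norm_add_le _ _).trans (by linarith)
  have n4 : ‖k + -v‖ ≤ 2 * r := (norm_add_le _ _).trans (by rw [norm_neg]; linarith)
  have e3 := h _ hxR (k + v) (by linarith)
  have e4 := h _ hxR (k + -v) (by linarith)
  have hpow2 : ∀ w : V, ‖w‖ ≤ 2 * r → K * ‖w‖ ^ (2 + γ) ≤ K * (2 ^ (2 + γ) * r ^ (2 + γ)) := by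
    intro w hw
    rw [← Real.mul_rpow (by norm_num) hr0.le]
    gcongr
  have e3' := e3.trans (hpow2 _ n3)
  have e4' := e4.trans (hpow2 _ n4)
  rw [norm_neg] at e2
  rw [hv] at e1 e2
  have hpow : r ^ (2 + γ) = r ^ (1 + γ) * r := by
    rw [← Real.rpow_add_one hr0.ne']; ring_nf
  have hkey : (2 : ℝ) • ((L (x + k) - L x - (B x + (B x).flip) k) v) =
      (g (x + (k + v)) - c x - L x (k + v) - B x (k + v) (k + v)) -
      (g (x + (k + -v)) - c x - L x (k + -v) - B x (k + -v) (k + -v)) -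
      ((g (x + k + v) - c (x + k) - L (x + k) v - B (x + k) v v) -
      (g (x + k + -v) - c (x + k) - L (x + k) (-v) - B (x + k) (-v) (-v))) := by
    simp only [map_add, map_neg, sub_apply, add_apply,
      neg_apply, ContinuousLinearMap.flip_apply, add_assoc, two_smul]
    abel
  have h2 : 2 * ‖(L (x + k) - L x - (B x + (B x).flip) k) v‖ ≤
      2 * (K * (1 + 2 ^ (2 + γ)) * r ^ (1 + γ) * r) := by
    rw [← Real.norm_of_nonneg (zero_le_two (α := ℝ)), ← norm_smul, hkey,
      Real.norm_of_nonneg (zero_le_two (α := ℝ))]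
    calc _ ≤ _ := (norm_sub_le _ _).trans (add_le_add (norm_sub_le _ _) (norm_sub_le _ _))
      _ ≤ (K * (2 ^ (2 + γ) * r ^ (2 + γ)) + K * (2 ^ (2 + γ) * r ^ (2 + γ))) +
          (K * r ^ (2 + γ) + K * r ^ (2 + γ)) := add_le_add (add_le_add e3' e4') (add_le_add e1 e2)
      _ = _ := by rw [hpow]; ring
  linarith

end Taylor

section FrozenStructure

variable {E : Type*} [NormedAddCommGroup E] [NormedSpace ℝ E]

/-- The real functional `ℓ` turned into a functional that is complex linear for the complex
structure `A`. -/
noncomputable def complexifyFunctional (ℓ : E →L[ℝ] ℝ) (A : E →L[ℝ] E) : E →L[ℝ] ℂ :=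
  Complex.ofRealCLM.comp ℓ - I • Complex.ofRealCLM.comp (ℓ.comp A)

theorem complexifyFunctional_apply (ℓ : E →L[ℝ] ℝ) (A : E →L[ℝ] E) (v : E) :
    complexifyFunctional ℓ A v = ℓ v - I * ℓ (A v) := by
  simp [complexifyFunctional]

theorem re_complexifyFunctional (ℓ : E →L[ℝ] ℝ) (A : E →L[ℝ] E) (v : E) :
    (complexifyFunctional ℓ A v).re = ℓ v := by
  simp [complexifyFunctional_apply]

theorem complexifyFunctional_map (ℓ : E →L[ℝ] ℝ) {A : E →L[ℝ] E} (hA : ∀ v, A (A v) = -v) (v : E) :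
    complexifyFunctional ℓ A (A v) = I * complexifyFunctional ℓ A v := by
  rw [complexifyFunctional_apply, complexifyFunctional_apply, hA, map_neg]
  push_cast
  linear_combination (ℓ (A v) : ℂ) * I_mul_I

theorem norm_complexifyFunctional_apply_le (ℓ : E →L[ℝ] ℝ) {A : E →L[ℝ] E} {M : ℝ} (hA : ‖A‖ ≤ M)
    (v : E) : ‖complexifyFunctional ℓ A v‖ ≤ ‖ℓ‖ * (1 + M) * ‖v‖ := by
  rw [complexifyFunctional_apply]
  calc _ ≤ ‖((ℓ v : ℝ) : ℂ)‖ + ‖I * ((ℓ (A v) : ℝ) : ℂ)‖ := norm_sub_le _ _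
    _ = ‖ℓ v‖ + ‖ℓ (A v)‖ := by rw [norm_mul, norm_I, one_mul, norm_real, norm_real]
    _ ≤ ‖ℓ‖ * ‖v‖ + ‖ℓ‖ * (M * ‖v‖) := by
      refine add_le_add (ℓ.le_opNorm v) ((ℓ.le_opNorm _).trans ?_)
      gcongr
      exact A.le_of_opNorm_le hA v
    _ = _ := by ring

theorem cauchyRiemannOp_complexifyFunctional {u : ℂ → E} (ℓ : E →L[ℝ] ℝ) {A B : E →L[ℝ] E}
    {x ζ : ℂ} (hA : ∀ v, A (A v) = -v) (hu : DifferentiableAt ℝ u (x + ζ))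
    (hCR : fderiv ℝ u (x + ζ) 1 + B (fderiv ℝ u (x + ζ) I) = 0) :
    cauchyRiemannOp (fun ζ => complexifyFunctional ℓ A (u (x + ζ))) ζ =
      complexifyFunctional ℓ A ((A - B) (fderiv ℝ u (x + ζ) I)) := by
  have h1 : HasFDerivAt (fun ζ => u (x + ζ)) (fderiv ℝ u (x + ζ)) ζ := by
    have := hu.hasFDerivAt.comp ζ ((hasFDerivAt_id (𝕜 := ℝ) ζ).const_add x)
    rwa [ContinuousLinearMap.comp_id] at this
  have h2 := ((complexifyFunctional ℓ A).hasFDerivAt.comp ζ h1).fderiv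
  have h3 : fderiv ℝ (fun ζ => complexifyFunctional ℓ A (u (x + ζ))) ζ = _ := h2
  rw [cauchyRiemannOp, h3, ContinuousLinearMap.comp_apply, ContinuousLinearMap.comp_apply,
    ← complexifyFunctional_map ℓ hA, ← map_add]
  congr 1
  rw [sub_apply, eq_neg_of_add_eq_zero_left hCR]
  abel

theorem exists_holder_fderiv_of_lipschitz {u : ℂ → E} {A : ℂ → E →L[ℝ] E} {z₀ : ℂ} {R M : ℝ}
    (hR : 0 < R) (hR1 : R ≤ 1 / 3) (hM : 0 ≤ M)
    (hu : ContDiffOn ℝ 1 u (ball z₀ (4 * R)))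
    (hA : ∀ z ∈ ball z₀ (4 * R), ∀ v, A z (A z v) = -v)
    (hCR : ∀ z ∈ ball z₀ (4 * R), fderiv ℝ u z 1 + A z (fderiv ℝ u z I) = 0)
    (huM : ∀ z ∈ ball z₀ (4 * R), ‖u z‖ ≤ M)
    (hduM : ∀ z ∈ ball z₀ (4 * R), ‖fderiv ℝ u z‖ ≤ M)
    (hAM : ∀ z ∈ ball z₀ (4 * R), ‖A z‖ ≤ M)
    (hAL : ∀ z ∈ ball z₀ (4 * R), ∀ w ∈ ball z₀ (4 * R), ‖A z - A w‖ ≤ M * ‖z - w‖) :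
    ∃ K : ℝ, 0 ≤ K ∧ ∀ x ∈ ball z₀ (R / 4), ∀ y ∈ ball z₀ (R / 4),
      ‖fderiv ℝ u y - fderiv ℝ u x‖ ≤ K * ‖y - x‖ ^ (1 / 2 : ℝ) := by
  obtain ⟨K, hK0, hK⟩ := exists_local_taylor_of_cauchyRiemannOp_le 2 (by norm_num) (R := R)
    (a := 1) (δ := 1 / 2) hR (by linarith) (by norm_num) (by norm_num) (by norm_num) (by norm_num)
    (by norm_num)
  set C := (1 + M) * (M + M * M) with hC
  have hC0 : 0 ≤ C := by positivity
  refine ⟨K * C * (2 ^ (1 + 1 / 2 : ℝ) + 2), by positivity, fun x hx y hy => ?_⟩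
  refine norm_sub_le_rpow_of_taylor (f := u) (R := R) (by positivity) (by norm_num) ?_ hx hy
  intro x hx k hk
  have hmem : ∀ ζ ∈ ball (0 : ℂ) (3 * R), x + ζ ∈ ball z₀ (4 * R) := by
    intro ζ hζ
    rw [mem_ball_zero_iff] at hζ
    rw [mem_ball, dist_eq_norm] at *
    calc ‖x + ζ - z₀‖ = ‖(x - z₀) + ζ‖ := by congr 1; ring
      _ ≤ _ := norm_add_le _ _
      _ < _ := by linarith
  have hx4 : x ∈ ball z₀ (4 * R) := by
    have := hmem 0 (mem_ball_self (by linarith))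
    rwa [add_zero] at this
  have hdiff : ∀ z ∈ ball z₀ (4 * R), DifferentiableAt ℝ u z := fun z hz =>
    (hu.contDiffAt (isOpen_ball.mem_nhds hz)).differentiableAt one_ne_zero
  obtain ⟨ℓ, hℓ1, hℓ⟩ := exists_dual_vector'' ℝ (u (x + k) - u x - fderiv ℝ u x k)
  set L := complexifyFunctional ℓ (A x) with hL
  have hLle : ∀ v, ‖L v‖ ≤ (1 + M) * ‖v‖ := by
    intro v
    refine (norm_complexifyFunctional_apply_le ℓ (hAM x hx4) v).trans ?_
    gcongr
    nlinarith
  have hg1 : ContDiffOn ℝ 1 (fun ζ => L (u (x + ζ))) (ball 0 (3 * R)) :=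
    L.contDiff.comp_contDiffOn (hu.comp (contDiff_const.add contDiff_id).contDiffOn hmem)
  have hg2 : ∀ ζ ∈ ball (0 : ℂ) (3 * R), ‖L (u (x + ζ))‖ ≤ C := by
    intro ζ hζ
    calc _ ≤ (1 + M) * ‖u (x + ζ)‖ := hLle _
      _ ≤ (1 + M) * (M + M * M) := by
        gcongr
        linarith [huM _ (hmem ζ hζ), mul_nonneg hM hM]
  have hg3 : ∀ ζ ∈ ball (0 : ℂ) (3 * R),
      ‖cauchyRiemannOp (fun ζ => L (u (x + ζ))) ζ‖ ≤ C * ‖ζ‖ ^ (((2 : ℕ) : ℝ) - 1) := by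
    intro ζ hζ
    have hy := hmem ζ hζ
    rw [cauchyRiemannOp_complexifyFunctional ℓ (hA x hx4) (hdiff _ hy) (hCR _ hy)]
    have h1 : ‖A x - A (x + ζ)‖ ≤ M * ‖ζ‖ := by
      have := hAL x hx4 _ hy
      rwa [sub_add_cancel_left, norm_neg] at this
    have h2 : ‖fderiv ℝ u (x + ζ) I‖ ≤ M := by
      have := (fderiv ℝ u (x + ζ)).le_of_opNorm_le (hduM _ hy) I
      rwa [norm_I, mul_one] at this
    calc _ ≤ (1 + M) * ‖(A x - A (x + ζ)) (fderiv ℝ u (x + ζ) I)‖ := hLle _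
      _ ≤ (1 + M) * (M * ‖ζ‖ * M) := by
        gcongr
        exact (ContinuousLinearMap.le_opNorm _ _).trans (by gcongr)
      _ ≤ (1 + M) * ((M + M * M) * ‖ζ‖) := by
        refine mul_le_mul_of_nonneg_left ?_ (by positivity)
        nlinarith [mul_nonneg hM (norm_nonneg ζ)]
      _ = C * ‖ζ‖ ^ (((2 : ℕ) : ℝ) - 1) := by
        rw [hC]; norm_num; ring
  obtain ⟨c, hc⟩ := hK _ C hg1 hg2 hg3
  have hc' : ∀ z, ‖z‖ < R → ‖L (u (x + z)) - (c 0 + c 1 * z)‖ ≤ K * C * ‖z‖ ^ (1 + 1 / 2 : ℝ) := by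
    intro z hz
    have := hc z hz
    simp only [Finset.sum_range_succ, Finset.sum_range_zero, zero_add, pow_zero, mul_one,
      pow_one] at this
    convert this using 2
    norm_num
  have hc0 : c 0 = L (u x) := by
    have := hc' 0 (by simpa using hR)
    simp only [norm_zero, Real.zero_rpow (by norm_num : (1 + 1 / 2 : ℝ) ≠ 0), mul_zero,
      add_zero, norm_le_zero_iff, sub_eq_zero] at this
    exact this.symm
  have hd1 : HasFDerivAt (fun z => L (u z)) (c 1 • (1 : ℂ →L[ℝ] ℂ)) x := by
    refine hasFDerivAt_of_norm_le_rpow (K := K * C) (γ := 1 / 2) hR (by norm_num) fun z hz => ?_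
    have := hc' z hz
    rwa [hc0, ← sub_sub] at this
  have hd2 := hd1.unique (L.hasFDerivAt.comp x (hdiff x hx4).hasFDerivAt)
  have hd3 : c 1 * k = L (fderiv ℝ u x k) := by
    have := DFunLike.congr_fun hd2 k
    simpa using this
  have h := hc' k hk
  rw [hc0, hd3, ← sub_sub, ← map_sub, ← map_sub] at h
  have h1 := (abs_re_le_norm _).trans h
  rw [hL, re_complexifyFunctional, hℓ] at h1
  exact (le_abs_self _).trans h1
theorem exists_bilinear_cauchyRiemannOp_eq (p : ℂ →L[ℝ] ℂ) : ∃ Q : ℂ →L[ℝ] ℂ →L[ℝ] ℂ,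
    (∀ ζ, cauchyRiemannOp (fun ζ => Q ζ ζ) ζ = p ζ) ∧ ∀ ζ, ‖Q ζ ζ‖ ≤ ‖p‖ * ‖ζ‖ ^ 2 := by
  set Q : ℂ →L[ℝ] ℂ →L[ℝ] ℂ := reCLM.smulRight ((reCLM.smulRight (p 1 / 2) : ℂ →L[ℝ] ℂ)) -
    imCLM.smulRight ((imCLM.smulRight (I * p I / 2) : ℂ →L[ℝ] ℂ)) with hQ
  have hQa : ∀ ζ w, Q ζ w = ζ.re * (w.re * (p 1 / 2)) - ζ.im * (w.im * (I * p I / 2)) := by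
    intro ζ w
    simp [hQ]
  refine ⟨Q, fun ζ => ?_, fun ζ => ?_⟩
  · have hd : HasFDerivAt (fun ζ => Q ζ ζ) (Q ζ + Q.flip ζ) ζ := by
      have := Q.hasFDerivAt.clm_apply (hasFDerivAt_id (𝕜 := ℝ) ζ)
      refine this.congr_fderiv ?_
      ext v; simp
    have hp : p ζ = ζ.re * p 1 + ζ.im * p I := by
      conv_lhs => rw [← re_add_im ζ]
      have : (ζ.re + ζ.im * I : ℂ) = ζ.re • (1 : ℂ) + ζ.im • I := by simp
      rw [this, map_add, map_smul, map_smul]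
      simp
    rw [cauchyRiemannOp, hd.fderiv, hp]
    simp only [add_apply, ContinuousLinearMap.flip_apply, hQa]
    simp
    linear_combination -(ζ.im : ℂ) * p I * I_mul_I
  · have h1 : ‖p 1‖ ≤ ‖p‖ := by simpa using p.le_opNorm 1
    have h2 : ‖p I‖ ≤ ‖p‖ := by simpa using p.le_opNorm I
    have hr := abs_re_le_norm ζ
    have hi := abs_im_le_norm ζ
    rw [hQa]
    calc _ ≤ ‖(ζ.re * (ζ.re * (p 1 / 2)) : ℂ)‖ + ‖(ζ.im * (ζ.im * (I * p I / 2)) : ℂ)‖ :=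
          norm_sub_le _ _
      _ = |ζ.re| * (|ζ.re| * (‖p 1‖ / 2)) + |ζ.im| * (|ζ.im| * (‖p I‖ / 2)) := by
        simp
      _ ≤ ‖ζ‖ * (‖ζ‖ * (‖p‖ / 2)) + ‖ζ‖ * (‖ζ‖ * (‖p‖ / 2)) := by gcongr
      _ = _ := by ring

theorem contDiffAt_two_functional_of_holder {u : ℂ → E} {A : ℂ → E →L[ℝ] E}
    {A' : ℂ → ℂ →L[ℝ] E →L[ℝ] E} {z₀ : ℂ} {R M : ℝ}
    (hR : 0 < R) (hR1 : R ≤ 1 / 3) (hM : 0 ≤ M)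
    (hu : ContDiffOn ℝ 1 u (ball z₀ (4 * R)))
    (hA : ∀ z ∈ ball z₀ (4 * R), ∀ v, A z (A z v) = -v)
    (hCR : ∀ z ∈ ball z₀ (4 * R), fderiv ℝ u z 1 + A z (fderiv ℝ u z I) = 0)
    (huM : ∀ z ∈ ball z₀ (4 * R), ‖u z‖ ≤ M)
    (hduM : ∀ z ∈ ball z₀ (4 * R), ‖fderiv ℝ u z‖ ≤ M)
    (hAM : ∀ z ∈ ball z₀ (4 * R), ‖A z‖ ≤ M)
    (hA'M : ∀ z ∈ ball z₀ (4 * R), ‖A' z‖ ≤ M)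
    (hAT : ∀ z ∈ ball z₀ (4 * R), ∀ w ∈ ball z₀ (4 * R),
      ‖A w - A z - A' z (w - z)‖ ≤ M * ‖w - z‖ ^ (3 / 2 : ℝ))
    (hduH : ∀ z ∈ ball z₀ (4 * R), ∀ w ∈ ball z₀ (4 * R),
      ‖fderiv ℝ u w - fderiv ℝ u z‖ ≤ M * ‖w - z‖ ^ (1 / 2 : ℝ)) (ℓ : E →L[ℝ] ℝ) :
    ContDiffAt ℝ 2 (fun z => ℓ (u z)) z₀ := by
  obtain ⟨K, hK0, hK⟩ := exists_local_taylor_of_cauchyRiemannOp_le 3 (by norm_num) (R := R)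
    (a := 3 / 2) (δ := 3 / 4) hR (by linarith) (by norm_num) (by norm_num) (by norm_num)
    (by norm_num) (by norm_num)
  set Λ := ‖ℓ‖ * (1 + M) with hΛ
  have hΛ0 : 0 ≤ Λ := by positivity
  set C := Λ * (M + 2 * (M * M)) with hC
  have hC0 : 0 ≤ C := by positivity
  refine contDiffAt_two_of_taylor (R := R) (K := K * C) (γ := 1 / 4) hR (by positivity)
    (by norm_num) fun x hx => ?_
  have hmem : ∀ ζ ∈ ball (0 : ℂ) (3 * R), x + ζ ∈ ball z₀ (4 * R) := by
    intro ζ hζ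
    rw [mem_ball_zero_iff] at hζ
    rw [mem_ball, dist_eq_norm] at *
    calc ‖x + ζ - z₀‖ = ‖(x - z₀) + ζ‖ := by congr 1; ring
      _ ≤ _ := norm_add_le _ _
      _ < _ := by linarith
  have hx4 : x ∈ ball z₀ (4 * R) := by
    have := hmem 0 (mem_ball_self (by linarith))
    rwa [add_zero] at this
  have hdiff : ∀ z ∈ ball z₀ (4 * R), DifferentiableAt ℝ u z := fun z hz =>
    (hu.contDiffAt (isOpen_ball.mem_nhds hz)).differentiableAt one_ne_zero
  have hduI : ∀ z ∈ ball z₀ (4 * R), ‖fderiv ℝ u z I‖ ≤ M := by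
    intro z hz
    have := (fderiv ℝ u z).le_of_opNorm_le (hduM _ hz) I
    rwa [norm_I, mul_one] at this
  set L := complexifyFunctional ℓ (A x) with hL
  have hLle : ∀ v, ‖L v‖ ≤ Λ * ‖v‖ := norm_complexifyFunctional_apply_le ℓ (hAM x hx4)
  set p : ℂ →L[ℝ] ℂ := -(L.comp ((A' x).flip (fderiv ℝ u x I))) with hp
  have hpa : ∀ ζ, p ζ = -L (A' x ζ (fderiv ℝ u x I)) := fun ζ => by simp [hp]
  have hpn : ‖p‖ ≤ Λ * (M * M) := by
    refine ContinuousLinearMap.opNorm_le_bound _ (by positivity) fun ζ => ?_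
    rw [hpa, norm_neg]
    calc _ ≤ Λ * ‖A' x ζ (fderiv ℝ u x I)‖ := hLle _
      _ ≤ Λ * (M * ‖ζ‖ * M) := by
        gcongr
        refine ((A' x ζ).le_opNorm _).trans ?_
        gcongr
        · exact (A' x).le_of_opNorm_le (hA'M x hx4) ζ
        · exact hduI x hx4
      _ = _ := by ring
  obtain ⟨Q, hQ, hQn⟩ := exists_bilinear_cauchyRiemannOp_eq p
  have hQc : ContDiff ℝ 1 (fun ζ => Q ζ ζ) := Q.contDiff.clm_apply contDiff_id
  have hg0 : ContDiffOn ℝ 1 (fun ζ => L (u (x + ζ))) (ball 0 (3 * R)) :=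
    L.contDiff.comp_contDiffOn (hu.comp (contDiff_const.add contDiff_id).contDiffOn hmem)
  have hg2 : ∀ ζ ∈ ball (0 : ℂ) (3 * R), ‖L (u (x + ζ)) - Q ζ ζ‖ ≤ C := by
    intro ζ hζ
    have hζ1 : ‖ζ‖ ≤ 1 := by rw [mem_ball_zero_iff] at hζ; linarith
    have h1 : ‖L (u (x + ζ))‖ ≤ Λ * M := (hLle _).trans (by gcongr; exact huM _ (hmem ζ hζ))
    have h2 : ‖Q ζ ζ‖ ≤ Λ * (M * M) := by
      refine (hQn ζ).trans ?_
      calc _ ≤ Λ * (M * M) * 1 ^ 2 := by gcongr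
        _ = _ := by ring
    calc _ ≤ _ := norm_sub_le _ _
      _ ≤ Λ * M + Λ * (M * M) := add_le_add h1 h2
      _ ≤ C := by
        rw [hC]; nlinarith [mul_nonneg hΛ0 (mul_nonneg hM hM)]
  have hg3 : ∀ ζ ∈ ball (0 : ℂ) (3 * R), ‖cauchyRiemannOp (fun ζ => L (u (x + ζ)) - Q ζ ζ) ζ‖ ≤
      C * ‖ζ‖ ^ (((3 : ℕ) : ℝ) - 3 / 2) := by
    intro ζ hζ
    have hy := hmem ζ hζ
    have hsub : cauchyRiemannOp (fun ζ => L (u (x + ζ)) - Q ζ ζ) ζ =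
        cauchyRiemannOp (fun ζ => L (u (x + ζ))) ζ - cauchyRiemannOp (fun ζ => Q ζ ζ) ζ := by
      have h1 : DifferentiableAt ℝ (fun ζ => L (u (x + ζ))) ζ :=
        (hg0.contDiffAt (isOpen_ball.mem_nhds hζ)).differentiableAt one_ne_zero
      have h2 : DifferentiableAt ℝ (fun ζ => Q ζ ζ) ζ := hQc.contDiffAt.differentiableAt one_ne_zero
      simp only [cauchyRiemannOp]
      rw [fderiv_fun_sub h1 h2]
      simp only [sub_apply]
      ring
    rw [hsub, hQ, hpa, cauchyRiemannOp_complexifyFunctional ℓ (hA x hx4) (hdiff _ hy) (hCR _ hy),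
      sub_neg_eq_add, ← hL, ← map_add]
    have hT := hAT x hx4 _ hy
    have hH := hduH x hx4 _ hy
    rw [add_sub_cancel_left] at hT hH
    have hsplit : (A x - A (x + ζ)) (fderiv ℝ u (x + ζ) I) + A' x ζ (fderiv ℝ u x I) =
        -((A (x + ζ) - A x - A' x ζ) (fderiv ℝ u (x + ζ) I)) -
        A' x ζ ((fderiv ℝ u (x + ζ) - fderiv ℝ u x) I) := by
      simp only [sub_apply, map_sub]
      abel
    have hn1 : ‖(A (x + ζ) - A x - A' x ζ) (fderiv ℝ u (x + ζ) I)‖ ≤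
        M * ‖ζ‖ ^ (3 / 2 : ℝ) * M := by
      refine (ContinuousLinearMap.le_opNorm _ _).trans ?_
      gcongr
      exact hduI _ hy
    have hn2 : ‖A' x ζ ((fderiv ℝ u (x + ζ) - fderiv ℝ u x) I)‖ ≤
        M * ‖ζ‖ * (M * ‖ζ‖ ^ (1 / 2 : ℝ)) := by
      refine (ContinuousLinearMap.le_opNorm _ _).trans ?_
      gcongr
      · exact (A' x).le_of_opNorm_le (hA'M x hx4) ζ
      · have := (fderiv ℝ u (x + ζ) - fderiv ℝ u x).le_of_opNorm_le hH I
        rwa [norm_I, mul_one] at this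
    have hpow : ‖ζ‖ * ‖ζ‖ ^ (1 / 2 : ℝ) = ‖ζ‖ ^ (3 / 2 : ℝ) := by
      rw [show (3 / 2 : ℝ) = 1 + 1 / 2 by norm_num,
        Real.rpow_add_of_nonneg (norm_nonneg _) (by norm_num) (by norm_num), Real.rpow_one]
    have hexp : (((3 : ℕ) : ℝ) - 3 / 2) = 3 / 2 := by norm_num
    rw [hsplit, hexp]
    have hz : 0 ≤ ‖ζ‖ ^ (3 / 2 : ℝ) := by positivity
    calc _ ≤ Λ * ‖-((A (x + ζ) - A x - A' x ζ) (fderiv ℝ u (x + ζ) I)) -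
        A' x ζ ((fderiv ℝ u (x + ζ) - fderiv ℝ u x) I)‖ := hLle _
      _ ≤ Λ * (M * ‖ζ‖ ^ (3 / 2 : ℝ) * M + M * ‖ζ‖ * (M * ‖ζ‖ ^ (1 / 2 : ℝ))) := by
        gcongr
        refine (norm_sub_le _ _).trans ?_
        rw [norm_neg]
        exact add_le_add hn1 hn2
      _ = Λ * (2 * (M * M)) * ‖ζ‖ ^ (3 / 2 : ℝ) := by rw [← hpow]; ring
      _ ≤ C * ‖ζ‖ ^ (3 / 2 : ℝ) := by
        rw [hC]
        gcongr
        linarith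
  obtain ⟨c, hc⟩ := hK _ C (hg0.sub hQc.contDiffOn) hg2 hg3
  refine ⟨(c 0).re, reCLM.comp (c 1 • (1 : ℂ →L[ℝ] ℂ)),
    (ContinuousLinearMap.compL ℝ ℂ ℂ ℝ reCLM).comp (c 2 • ContinuousLinearMap.mul ℝ ℂ + Q),
    fun k hk => ?_⟩
  have h := (abs_re_le_norm _).trans (hc k hk)
  have hexp : ((3 : ℕ) : ℝ) - 3 / 4 = 2 + 1 / 4 := by norm_num
  simp only [Finset.sum_range_succ, Finset.sum_range_zero, zero_add, pow_zero, mul_one,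
    pow_one, sub_re, add_re, hL, re_complexifyFunctional, hexp] at h
  rw [Real.norm_eq_abs]
  refine le_of_eq_of_le (congrArg _ ?_) h
  simp [pow_two]
  ring

end FrozenStructure

theorem norm_sub_sub_le_rpow_of_holder {V F : Type*} [NormedAddCommGroup V] [NormedSpace ℝ V]
    [NormedAddCommGroup F] [NormedSpace ℝ F] {f : V → F} {f' : V → V →L[ℝ] F} {s : Set V}
    (hs : Convex ℝ s) {K γ : ℝ} (hK : 0 ≤ K) (hγ : 0 ≤ γ) (hf : ∀ z ∈ s, HasFDerivAt f (f' z) z)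
    (hf' : ∀ z ∈ s, ∀ w ∈ s, ‖f' w - f' z‖ ≤ K * ‖w - z‖ ^ γ) {z w : V} (hz : z ∈ s) (hw : w ∈ s) :
    ‖f w - f z - f' z (w - z)‖ ≤ K * ‖w - z‖ ^ (γ + 1) := by
  have hconv : Convex ℝ (s ∩ closedBall z ‖w - z‖) := hs.inter (convex_closedBall _ _)
  have h := hconv.norm_image_sub_le_of_norm_hasFDerivWithin_le' (f := f) (f' := f') (φ := f' z)
    (C := K * ‖w - z‖ ^ γ) (fun x hx => (hf x hx.1).hasFDerivWithinAt)
    (fun x hx => (hf' z hz x hx.1).trans (by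
      have := mem_closedBall_iff_norm.1 hx.2
      gcongr)) ⟨hz, mem_closedBall_self (norm_nonneg _)⟩ ⟨hw, mem_closedBall_iff_norm.2 le_rfl⟩
  rwa [mul_assoc, ← Real.rpow_add_one' (norm_nonneg _) (by linarith)] at h

theorem ContinuousAt.eventually_norm_le_add_one {X F : Type*} [TopologicalSpace X]
    [NormedAddCommGroup F] {f : X → F} {x : X} (hf : ContinuousAt f x) :
    ∀ᶠ y in nhds x, ‖f y‖ ≤ ‖f x‖ + 1 :=
  (hf.norm.eventually (gt_mem_nhds (lt_add_one ‖f x‖))).mono fun _ h => le_of_lt h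

theorem contDiffAt_two_of_cauchyRiemann {E : Type*} [NormedAddCommGroup E] [NormedSpace ℝ E]
    [FiniteDimensional ℝ E] {J : E → E →L[ℝ] E} (hJ : ContDiff ℝ 2 J)
    (hJ2 : ∀ x v, J x (J x v) = -v) {U : Set ℂ} (hU : IsOpen U) {u : ℂ → E}
    (hu : ContDiffOn ℝ 1 u U) (hCR : ∀ z ∈ U, fderiv ℝ u z 1 + J (u z) (fderiv ℝ u z I) = 0)
    {z₀ : ℂ} (hz₀ : z₀ ∈ U) : ContDiffAt ℝ 2 u z₀ := by
  have hu0 : ContDiffAt ℝ 1 u z₀ := hu.contDiffAt (hU.mem_nhds hz₀)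
  have hdu0 : ContinuousAt (fderiv ℝ u) z₀ :=
    (hu0.fderiv_right (m := 0) (by norm_num)).continuousAt
  have hA0 : ContDiffAt ℝ 1 (fun z => J (u z)) z₀ :=
    (hJ.of_le (by norm_num)).contDiffAt.comp z₀ hu0
  have hDJ : ContDiff ℝ 1 (fderiv ℝ J) := hJ.fderiv_right (by norm_num)
  have hD0 : ContDiffAt ℝ 1 (fun z => fderiv ℝ J (u z)) z₀ := hDJ.contDiffAt.comp z₀ hu0
  obtain ⟨KA, tA, htA, hAL⟩ := hA0.exists_lipschitzOnWith
  obtain ⟨KD, tD, htD, hDL⟩ := hD0.exists_lipschitzOnWith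
  obtain ⟨M, hM0, hM1, hM2, hM3, hM4, hM5, hM6⟩ : ∃ M : ℝ, 0 ≤ M ∧ ‖u z₀‖ + 1 ≤ M ∧
      ‖fderiv ℝ u z₀‖ + 1 ≤ M ∧ ‖J (u z₀)‖ + 1 ≤ M ∧ ‖fderiv ℝ J (u z₀)‖ + 1 ≤ M ∧ (KA : ℝ) ≤ M ∧
      (KD : ℝ) ≤ M := by
    have h1 := norm_nonneg (u z₀)
    have h2 := norm_nonneg (fderiv ℝ u z₀)
    have h3 := norm_nonneg (J (u z₀))
    have h4 := norm_nonneg (fderiv ℝ J (u z₀))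
    have h5 := KA.coe_nonneg
    have h6 := KD.coe_nonneg
    exact ⟨‖u z₀‖ + ‖fderiv ℝ u z₀‖ + ‖J (u z₀)‖ + ‖fderiv ℝ J (u z₀)‖ + KA + KD + 1,
      by positivity, by linarith, by linarith, by linarith, by linarith, by linarith, by linarith⟩
  have hev : ∀ᶠ z in nhds z₀, z ∈ U ∧ z ∈ tA ∧ z ∈ tD ∧ ‖u z‖ ≤ M ∧ ‖fderiv ℝ u z‖ ≤ M ∧
      ‖J (u z)‖ ≤ M ∧ ‖fderiv ℝ J (u z)‖ ≤ M := by
    filter_upwards [hU.mem_nhds hz₀, htA, htD, hu0.continuousAt.eventually_norm_le_add_one,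
      hdu0.eventually_norm_le_add_one, hA0.continuousAt.eventually_norm_le_add_one,
      hD0.continuousAt.eventually_norm_le_add_one] with z h1 h2 h3 h4 h5 h6 h7
    exact ⟨h1, h2, h3, h4.trans hM1, h5.trans hM2, h6.trans hM3, h7.trans hM4⟩
  obtain ⟨r, hr, hball⟩ := Metric.eventually_nhds_iff_ball.1 hev
  obtain ⟨R, hR, hR1, hR2⟩ : ∃ R : ℝ, 0 < R ∧ R ≤ 1 / 3 ∧ 4 * R ≤ r :=
    ⟨min (r / 4) (1 / 3), by positivity, min_le_right _ _, by
      linarith [min_le_left (r / 4) (1 / 3)]⟩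
  have hb : ∀ z ∈ ball z₀ (4 * R), _ := fun z hz => hball z (ball_subset_ball hR2 hz)
  have huR : ContDiffOn ℝ 1 u (ball z₀ (4 * R)) := hu.mono fun z hz => (hb z hz).1
  obtain ⟨K, hK0, hK⟩ := exists_holder_fderiv_of_lipschitz (A := fun z => J (u z)) hR hR1 hM0 huR
    (fun z _ => hJ2 _) (fun z hz => hCR z (hb z hz).1) (fun z hz => (hb z hz).2.2.2.1)
    (fun z hz => (hb z hz).2.2.2.2.1) (fun z hz => (hb z hz).2.2.2.2.2.1)
    (fun z hz w hw => (hAL.norm_sub_le (hb z hz).2.1 (hb w hw).2.1).trans (by gcongr))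
  set A' : ℂ → ℂ →L[ℝ] E →L[ℝ] E := fun z => (fderiv ℝ J (u z)).comp (fderiv ℝ u z) with hA'
  have hsub : ball z₀ (4 * (R / 16)) ⊆ ball z₀ (4 * R) := ball_subset_ball (by linarith)
  have hsub' : ball z₀ (4 * (R / 16)) ⊆ ball z₀ (R / 4) := ball_subset_ball (by linarith)
  have hdA : ∀ z ∈ ball z₀ (4 * (R / 16)), HasFDerivAt (fun z => J (u z)) (A' z) z := by
    intro z hz
    have h1 : DifferentiableAt ℝ u z :=
      (huR.contDiffAt (isOpen_ball.mem_nhds (hsub hz))).differentiableAt one_ne_zero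
    exact ((hJ.differentiable two_ne_zero (u z)).hasFDerivAt).comp z h1.hasFDerivAt
  have hA'n : ∀ z ∈ ball z₀ (4 * (R / 16)), ‖A' z‖ ≤ M * M := by
    intro z hz
    obtain ⟨-, -, -, -, h1, -, h2⟩ := hb z (hsub hz)
    exact (ContinuousLinearMap.opNorm_comp_le _ _).trans (by gcongr)
  have hA'H : ∀ z ∈ ball z₀ (4 * (R / 16)), ∀ w ∈ ball z₀ (4 * (R / 16)),
      ‖A' w - A' z‖ ≤ (M * M + M * K) * ‖w - z‖ ^ (1 / 2 : ℝ) := by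
    intro z hz w hw
    obtain ⟨-, -, hzD, -, -, -, h1⟩ := hb z (hsub hz)
    obtain ⟨-, -, hwD, -, h2, -, -⟩ := hb w (hsub hw)
    have hle : ‖w - z‖ ≤ ‖w - z‖ ^ (1 / 2 : ℝ) := by
      refine Real.self_le_rpow_of_le_one (norm_nonneg _) ?_ (by norm_num)
      rw [← dist_eq_norm]
      rw [mem_ball] at hz hw
      linarith [dist_triangle_right w z z₀]
    have hsplit : A' w - A' z =
        (fderiv ℝ J (u w) - fderiv ℝ J (u z)).comp (fderiv ℝ u w) +
        (fderiv ℝ J (u z)).comp (fderiv ℝ u w - fderiv ℝ u z) := by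
      simp only [hA', ContinuousLinearMap.sub_comp, ContinuousLinearMap.comp_sub]
      abel
    have h3 : ‖fderiv ℝ J (u w) - fderiv ℝ J (u z)‖ ≤ M * ‖w - z‖ ^ (1 / 2 : ℝ) := by
      refine (hDL.norm_sub_le hwD hzD).trans ?_
      gcongr
    rw [hsplit, add_mul]
    refine (norm_add_le (_ : ℂ →L[ℝ] E →L[ℝ] E) _).trans (add_le_add ?_ ?_)
    · refine (ContinuousLinearMap.opNorm_comp_le _ _).trans ?_
      calc _ ≤ (M * ‖w - z‖ ^ (1 / 2 : ℝ)) * M := by gcongr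
        _ = _ := by ring
    · refine (ContinuousLinearMap.opNorm_comp_le _ _).trans ?_
      rw [mul_assoc]
      gcongr
      exact hK z (hsub' hz) w (hsub' hw)
  set N := M + K + (M * M + M * K)
  have hMK : 0 ≤ M * K := by positivity
  have hMM : 0 ≤ M * M := by positivity
  have hMN : M ≤ N := by linarith
  have hC2 := contDiffAt_two_functional_of_holder (A := fun z => J (u z)) (A' := A') (M := N)
    (R := R / 16) (by positivity) (by linarith) (by positivity) (huR.mono hsub) (fun z _ => hJ2 _)
    (fun z hz => hCR z (hb z (hsub hz)).1) (fun z hz => (hb z (hsub hz)).2.2.2.1.trans hMN)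
    (fun z hz => (hb z (hsub hz)).2.2.2.2.1.trans hMN)
    (fun z hz => (hb z (hsub hz)).2.2.2.2.2.1.trans hMN)
    (fun z hz => (hA'n z hz).trans (by linarith))
    (fun z hz w hw => (norm_sub_sub_le_rpow_of_holder (convex_ball _ _) (add_nonneg hMM hMK)
      (by norm_num) hdA hA'H hz hw).trans (by norm_num; gcongr; linarith))
    (fun z hz w hw => (hK z (hsub' hz) w (hsub' hw)).trans (by gcongr; linarith))
  set e := (Module.finBasis ℝ E).equivFunL with he
  rw [← e.comp_contDiffAt_iff, contDiffAt_pi]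
  exact fun i => hC2 ((ContinuousLinearMap.proj i).comp
    (e : E →L[ℝ] (Fin (Module.finrank ℝ E) → ℝ)))

section Tangent

variable {E : Type*} [NormedAddCommGroup E] [NormedSpace ℝ E]

/-- The almost complex structure on the tangent bundle `E × E` induced by `J`. -/
noncomputable def tangentStructure (J : E → E →L[ℝ] E) (p : E × E) : E × E →L[ℝ] E × E :=
  (ContinuousLinearMap.inl ℝ E E).comp ((J p.1).comp (ContinuousLinearMap.fst ℝ E E)) +
    (ContinuousLinearMap.inr ℝ E E).comp ((J p.1).comp (ContinuousLinearMap.snd ℝ E E) +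
      (fderiv ℝ J p.1 p.2).comp (ContinuousLinearMap.fst ℝ E E))

theorem tangentStructure_apply (J : E → E →L[ℝ] E) (p v : E × E) :
    tangentStructure J p v = (J p.1 v.1, J p.1 v.2 + fderiv ℝ J p.1 p.2 v.1) := by
  simp [tangentStructure]

theorem contDiff_tangentStructure {J : E → E →L[ℝ] E} (hJ : ContDiff ℝ (⊤ : ℕ∞) J) :
    ContDiff ℝ (⊤ : ℕ∞) (tangentStructure J) := by
  have h1 : ContDiff ℝ (⊤ : ℕ∞) fun p : E × E => J p.1 := hJ.comp contDiff_fst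
  have h2 : ContDiff ℝ (⊤ : ℕ∞) fun p : E × E => fderiv ℝ J p.1 p.2 :=
    ((hJ.fderiv_right (by simp)).comp contDiff_fst).clm_apply contDiff_snd
  exact (contDiff_const.clm_comp (h1.clm_comp contDiff_const)).add
    (contDiff_const.clm_comp ((h1.clm_comp contDiff_const).add (h2.clm_comp contDiff_const)))

theorem fderiv_apply_apply_add_eq_zero {J : E → E →L[ℝ] E} {x : E} (hJ : DifferentiableAt ℝ J x)
    (hJ2 : ∀ x v, J x (J x v) = -v) (ξ v : E) :
    fderiv ℝ J x ξ (J x v) + J x (fderiv ℝ J x ξ v) = 0 := by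
  have h1 := hJ.hasFDerivAt.clm_apply (hJ.hasFDerivAt.clm_apply (hasFDerivAt_const v x))
  have h2 : HasFDerivAt (fun x => J x (J x v)) (0 : E →L[ℝ] E) x := by
    simp only [hJ2]
    exact hasFDerivAt_const _ _
  have h3 := DFunLike.congr_fun (h1.unique h2) ξ
  simp at h3
  rw [add_comm]
  exact h3

theorem tangentStructure_tangentStructure {J : E → E →L[ℝ] E} (hJ : Differentiable ℝ J)
    (hJ2 : ∀ x v, J x (J x v) = -v) (p v : E × E) :
    tangentStructure J p (tangentStructure J p v) = -v := by
  rw [tangentStructure_apply, tangentStructure_apply]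
  refine Prod.ext (hJ2 _ _) ?_
  simp only [map_add, hJ2, Prod.snd_neg]
  rw [add_assoc, add_comm (J p.1 _), fderiv_apply_apply_add_eq_zero (hJ p.1) hJ2, add_zero]

theorem cauchyRiemann_tangent {J : E → E →L[ℝ] E} (hJ : Differentiable ℝ J) {U : Set ℂ}
    (hU : IsOpen U) {u : ℂ → E}
    (hCR : ∀ z ∈ U, fderiv ℝ u z 1 + J (u z) (fderiv ℝ u z I) = 0) {z : ℂ} (hz : z ∈ U)
    (hu : ContDiffAt ℝ 2 u z) :
    fderiv ℝ (fun z => (u z, fderiv ℝ u z 1)) z 1 +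
      tangentStructure J (u z, fderiv ℝ u z 1)
        (fderiv ℝ (fun z => (u z, fderiv ℝ u z 1)) z I) = 0 := by
  have hd : HasFDerivAt u (fderiv ℝ u z) z := (hu.differentiableAt two_ne_zero).hasFDerivAt
  have hdd : HasFDerivAt (fderiv ℝ u) (fderiv ℝ (fderiv ℝ u) z) z :=
    ((hu.fderiv_right (m := 1) (by norm_num)).differentiableAt one_ne_zero).hasFDerivAt
  have hsymm : fderiv ℝ (fderiv ℝ u) z 1 I = fderiv ℝ (fderiv ℝ u) z I 1 :=
    hu.isSymmSndFDerivAt (by simp) 1 I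
  have h1 := (hdd.clm_apply (hasFDerivAt_const (1 : ℂ) z)).add
    (((hJ (u z)).hasFDerivAt.comp z hd).clm_apply (hdd.clm_apply (hasFDerivAt_const I z)))
  have h2 : (fun z => fderiv ℝ u z 1 + J (u z) (fderiv ℝ u z I)) =ᶠ[nhds z] fun _ => 0 := by
    filter_upwards [hU.mem_nhds hz] with w hw using hCR w hw
  have h3 := DFunLike.congr_fun (h1.unique ((hasFDerivAt_const (0 : E) z).congr_of_eventuallyEq h2)) 1
  have h4 := (hd.prodMk (hdd.clm_apply (hasFDerivAt_const (1 : ℂ) z))).fderiv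
  rw [h4, tangentStructure_apply]
  refine Prod.ext ?_ ?_
  · simpa using hCR z hz
  · simp [hsymm] at h3 ⊢
    exact h3

theorem contDiffOn_of_cauchyRiemann [FiniteDimensional ℝ E] {J : E → E →L[ℝ] E}
    (hJ : ContDiff ℝ (⊤ : ℕ∞) J) (hJ2 : ∀ x v, J x (J x v) = -v) {U : Set ℂ} (hU : IsOpen U)
    {u : ℂ → E} (hu : ContDiffOn ℝ 1 u U)
    (hCR : ∀ z ∈ U, fderiv ℝ u z 1 + J (u z) (fderiv ℝ u z I) = 0) (k : ℕ) :
    ContDiffOn ℝ (k + 1 : ℕ) u U := by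
  induction k generalizing E with
  | zero => exact_mod_cast hu
  | succ k ih =>
    have hJd : Differentiable ℝ J := hJ.differentiable (by simp)
    have hu2 : ∀ z ∈ U, ContDiffAt ℝ 2 u z := fun z hz =>
      contDiffAt_two_of_cauchyRiemann (hJ.of_le (by norm_cast)) hJ2 hU hu hCR hz
    have hv : ContDiffOn ℝ 1 (fun z => (u z, fderiv ℝ u z 1)) U := fun z hz =>
      (((hu2 z hz).of_le (by norm_num)).prodMk
        (((hu2 z hz).fderiv_right (m := 1) (by norm_num)).clm_apply
          contDiffAt_const)).contDiffWithinAt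
    have hk := ih (contDiff_tangentStructure hJ) (tangentStructure_tangentStructure hJd hJ2) hv
      fun z hz => cauchyRiemann_tangent hJd hU hCR hz (hu2 z hz)
    have h1 : ContDiffOn ℝ (k + 1 : ℕ) (fun z => fderiv ℝ u z 1) U := hk.snd
    have h2 : ContDiffOn ℝ (k + 1 : ℕ) (fun z => J (u z) (fderiv ℝ u z 1)) U :=
      ((hJ.of_le (by exact_mod_cast le_top)).comp_contDiffOn hk.fst).clm_apply h1
    have h3 : ∀ z ∈ U, fderiv ℝ u z =
        reCLM.smulRight (fderiv ℝ u z 1) + imCLM.smulRight (J (u z) (fderiv ℝ u z 1)) := by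
      intro z hz
      have hI : J (u z) (fderiv ℝ u z 1) = fderiv ℝ u z I := by
        rw [eq_neg_of_add_eq_zero_left (hCR z hz), map_neg, hJ2, neg_neg]
      ext w
      conv_lhs => rw [← re_add_im w]
      have : (w.re + w.im * I : ℂ) = w.re • (1 : ℂ) + w.im • I := by simp
      rw [this, map_add, map_smul, map_smul, hI]
      simp
    have h4 : ContDiffOn ℝ (k + 1 : ℕ) (fderiv ℝ u) U :=
      ((contDiffOn_const.smulRight h1).add (contDiffOn_const.smulRight h2)).congr h3
    push_cast
    rw [contDiffOn_succ_iff_fderiv_of_isOpen hU]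
    exact ⟨fun z hz => ((hu2 z hz).differentiableAt two_ne_zero).differentiableWithinAt, by simp,
      by exact_mod_cast h4⟩

end Tangent

/-- **Elliptic regularity for pseudoholomorphic curves.**  Let `J` be an almost complex
structure on `ℂⁿ` and `U ⊆ ℂ` open.  Every `C¹` map `u : U → ℂⁿ` satisfying the
nonlinear Cauchy–Riemann equation `∂ₛu + J(u)∂ₜu = 0` on `U` is smooth on `U`. -/
theorem pseudoholomorphic_regularity (n : ℕ)
    (J : EuclideanSpace ℂ (Fin n) →
      (EuclideanSpace ℂ (Fin n) →L[ℝ] EuclideanSpace ℂ (Fin n)))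
    (hJsmooth : ContDiff ℝ (⊤ : ℕ∞) J)
    (hJsq : ∀ x v, J x (J x v) = -v)
    (U : Set ℂ) (hU : IsOpen U)
    (u : ℂ → EuclideanSpace ℂ (Fin n))
    (huC1 : ContDiffOn ℝ 1 u U)
    (huCR : ∀ z ∈ U, fderiv ℝ u z 1 + J (u z) (fderiv ℝ u z Complex.I) = 0) :
    ContDiffOn ℝ (⊤ : ℕ∞) u U := by
  have : FiniteDimensional ℝ (EuclideanSpace ℂ (Fin n)) := FiniteDimensional.complexToReal _
  rw [contDiffOn_infty]
  intro k
  exact (contDiffOn_of_cauchyRiemann hJsmooth hJsq hU huC1 huCR k).of_le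
    (by exact_mod_cast Nat.le_succ k)
end
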